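/- There exists a simple group G of cardinality ℵ₁ that is both Jónsson and strongly bounded. -/

import Mathlib

/-- `wordSet Y n` is the set `Y^{[n]}` of all products of length at most `n`
of elements of `Y` and their inverses. -/
def wordSet {H : Type*} [Group H] (Y : Set H) (n : ℕ) : Set H :=
  {h | ∃ m : ℕ, m ≤ n ∧ ∃ g : Fin m → H,
    (∀ i, g i ∈ Y ∨ (g i)⁻¹ ∈ Y) ∧ h = (List.ofFn g).prod}

/-- A subgroup `K` of `G` is malnormal if `K ∩ gKg⁻¹ = {1}` for all `g ∉ K`. -/
def Malnormal {G : Type*} [Group G] (K : Subgroup G) : Prop :=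
  ∀ g : G, g ∉ K → ∀ y : G, y ∈ K → g⁻¹ * y * g ∈ K → y = 1

/-- A group is strongly bounded if every action by isometries on a metric
space has bounded orbits. -/
def StronglyBounded (H : Type*) [Group H] : Prop :=
  ∀ (X : Type) (_ : MetricSpace X) (_ : MulAction H X),
    (∀ h : H, Isometry (fun x : X => h • x)) →
    ∀ x : X, Bornology.IsBounded (MulAction.orbit H x)

/-- A group is Jónsson if every proper subgroup has strictly smaller cardinality. -/
def Jonsson (H : Type*) [Group H] : Prop :=
  ∀ K : Subgroup H, K ≠ ⊤ → Cardinal.mk K < Cardinal.mk H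

open scoped Pointwise

universe u

namespace TreeSide

variable {V : Type*} {G : SimpleGraph V}

/-- The vertices on the `b`-side of the edge `ab`. -/
def side (G : SimpleGraph V) (a b : V) : Set V :=
  {v | (G.deleteEdges {s(a, b)}).Reachable b v}

/-- Every edge separating `x` from `y` has both ends in `Y`. -/
def Conn (G : SimpleGraph V) (Y : Set V) (x y : V) : Prop :=
  ∀ a b, G.Adj a b → x ∈ side G b a → y ∈ side G a b → a ∈ Y ∧ b ∈ Y

/-- Convex vertex sets of a tree. -/
def Conv (G : SimpleGraph V) (Y : Set V) : Prop :=
  ∀ x ∈ Y, ∀ y ∈ Y, Conn G Y x y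

/-- Bi-infinite paths without backtracking. -/
def IsLine (G : SimpleGraph V) (m : ℤ → V) : Prop :=
  ∀ i, G.Adj (m i) (m (i + 1)) ∧ m i ≠ m (i + 2)

theorem mem_side (a b : V) : b ∈ side G a b := SimpleGraph.Reachable.refl _

theorem adj_deleteEdges {a b u v : V} (h : G.Adj u v) (hne : ¬ (u = a ∧ v = b))
    (hne' : ¬ (u = b ∧ v = a)) : (G.deleteEdges {s(a, b)}).Adj u v := by
  rw [SimpleGraph.deleteEdges_adj]
  refine ⟨h, ?_⟩
  simp only [Set.mem_singleton_iff, Sym2.eq_iff]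
  tauto

theorem mem_side_or (hT : G.IsTree) {a b : V} (hab : G.Adj a b) (v : V) :
    v ∈ side G a b ∨ v ∈ side G b a := by
  obtain ⟨w⟩ := hT.connected.preconnected v a
  induction w with
  | nil => right; exact mem_side _ _
  | @cons u v' a huv w ih =>
    by_cases h1 : u = a
    · subst h1; right; exact mem_side _ _
    by_cases h2 : u = b
    · subst h2; left; exact mem_side _ _
    rcases ih hab with h | h
    · left
      exact SimpleGraph.Reachable.trans h
        (adj_deleteEdges huv.symm (fun h => h2 h.2) (fun h => h1 h.2)).reachable
    · right
      exact SimpleGraph.Reachable.trans h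
        (adj_deleteEdges huv.symm (fun h => h1 h.2) (fun h => h2 h.2)).reachable

theorem not_mem_side (hT : G.IsTree) {a b v : V} (hab : G.Adj a b) (h : v ∈ side G a b) :
    v ∉ side G b a := by
  intro h'
  have hb := SimpleGraph.isAcyclic_iff_forall_adj_isBridge.1 hT.isAcyclic hab
  rw [SimpleGraph.isBridge_iff] at hb
  apply hb
  have h1 : (G.deleteEdges {s(a, b)}).Reachable b v := h
  have h2 : (G.deleteEdges {s(b, a)}).Reachable a v := h'
  rw [Sym2.eq_swap] at h2
  exact h2.trans h1.symm

theorem not_mem_side_iff (hT : G.IsTree) {a b v : V} (hab : G.Adj a b) :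
    v ∉ side G a b ↔ v ∈ side G b a :=
  ⟨fun h => (mem_side_or hT hab v).resolve_left h, fun h => not_mem_side hT hab.symm h⟩

/-- The only edge between the two sides of `ab` is `ab`. -/
theorem crossing (hT : G.IsTree) {a b u v : V} (hab : G.Adj a b) (huv : G.Adj u v)
    (hu : u ∈ side G b a) (hv : v ∈ side G a b) : u = a ∧ v = b := by
  by_contra hne
  have h2 : ¬ (u = b ∧ v = a) := by
    rintro ⟨rfl, rfl⟩
    exact not_mem_side hT hab.symm hu (mem_side _ _)
  have := (adj_deleteEdges huv hne h2).symm.reachable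
  exact not_mem_side hT hab.symm hu (SimpleGraph.Reachable.trans hv this)

theorem side_subset (hT : G.IsTree) {a b c d : V} (hab : G.Adj a b) (hcd : G.Adj c d)
    (hd : d ∈ side G a b) (ha : a ∈ side G d c) : side G c d ⊆ side G a b := by
  rintro v ⟨w⟩
  suffices h : ∀ u v : V, (G.deleteEdges {s(c, d)}).Walk u v → u ∈ side G c d → u ∈ side G a b →
      v ∈ side G a b from h d v w (mem_side _ _) hd
  intro u v w
  induction w with
  | nil => intro _ h; exact h
  | @cons u v' x huv w ih =>
    intro h1 h2
    have h3 : v' ∈ side G c d := SimpleGraph.Reachable.trans h1 huv.reachable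
    refine ih h3 ?_
    by_contra h4
    rw [not_mem_side_iff hT hab] at h4
    have := crossing hT hab.symm (SimpleGraph.deleteEdges_le _ huv) h2 h4
    rw [this.2] at h3
    exact not_mem_side hT hcd h3 ha

section Convexity

theorem Conn.symm {Y : Set V} {x y : V} (h : Conn G Y x y) : Conn G Y y x :=
  fun a b hab hy hx => (h b a hab.symm hx hy).symm

theorem Conn.trans (hT : G.IsTree) {Y : Set V} {x y z : V} (h : Conn G Y x y)
    (h' : Conn G Y y z) : Conn G Y x z := by
  intro a b hab hx hz
  rcases mem_side_or hT hab y with hy | hy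
  · exact h a b hab hx hy
  · exact h' a b hab hy hz

theorem Conn.mono {Y Z : Set V} (hYZ : Y ⊆ Z) {x y : V} (h : Conn G Y x y) : Conn G Z x y :=
  fun a b hab hx hy => ⟨hYZ (h a b hab hx hy).1, hYZ (h a b hab hx hy).2⟩

theorem Conn.of_adj (hT : G.IsTree) {Y : Set V} {x y : V} (hx : x ∈ Y) (hy : y ∈ Y)
    (h : G.Adj x y) : Conn G Y x y := by
  intro a b hab hxa hyb
  obtain ⟨rfl, rfl⟩ := crossing hT hab h hxa hyb
  exact ⟨hx, hy⟩

theorem conv_singleton (hT : G.IsTree) (p : V) : Conv G {p} := by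
  rintro x rfl y rfl a b hab h1 h2
  exact absurd h1 (not_mem_side hT hab h2)

/-- A convex set not containing both ends of an edge lies on one side of it. -/
theorem Conv.subset_side (hT : G.IsTree) {Y : Set V} (hY : Conv G Y) {a b : V} (hab : G.Adj a b)
    (hne : ¬ (a ∈ Y ∧ b ∈ Y)) {y : V} (hy : y ∈ Y) (hys : y ∈ side G a b) : Y ⊆ side G a b := by
  intro z hz
  by_contra h
  rw [not_mem_side_iff hT hab] at h
  exact hne (hY z hz y hy a b hab h hys)

end Convexity

section Lines

variable {m : ℤ → V}

theorem IsLine.adj (hm : IsLine G m) (i : ℤ) : G.Adj (m i) (m (i + 1)) := (hm i).1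

theorem IsLine.rev (hm : IsLine G m) : IsLine G (fun i => m (-i)) := by
  intro i
  constructor
  · have := (hm (-(i + 1))).1.symm
    simpa using this
  · have := (hm (-(i + 2))).2.symm
    simpa using this

theorem IsLine.side_succ_subset (hT : G.IsTree) (hm : IsLine G m) (i : ℤ) :
    side G (m (i + 1)) (m (i + 1 + 1)) ⊆ side G (m i) (m (i + 1)) := by
  have h1 := hm.adj i
  have h2 := hm.adj (i + 1)
  have hne : m i ≠ m (i + 1 + 1) := by
    have := (hm i).2
    rwa [show i + 2 = i + 1 + 1 by ring] at this
  apply side_subset hT h1 h2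
  · by_contra h
    rw [not_mem_side_iff hT h1] at h
    exact hne (crossing hT h1.symm h2 (mem_side _ _) h).2.symm
  · by_contra h
    rw [not_mem_side_iff hT h2.symm] at h
    exact hne (crossing hT h2 h1.symm (mem_side _ _) h).2

theorem IsLine.side_subset_of_le (hT : G.IsTree) (hm : IsLine G m) {i j : ℤ} (hij : i ≤ j) :
    side G (m j) (m (j + 1)) ⊆ side G (m i) (m (i + 1)) := by
  induction j, hij using Int.leInduction with
  | base => exact subset_rfl
  | succ k _ ih => exact (hm.side_succ_subset hT k).trans ih

theorem IsLine.mem_side_of_lt (hT : G.IsTree) (hm : IsLine G m) {i j : ℤ} (hij : i < j) :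
    m j ∈ side G (m i) (m (i + 1)) := by
  have h := hm.side_subset_of_le hT (show i ≤ j - 1 by lia)
  apply h
  rw [sub_add_cancel]
  exact mem_side _ _

theorem IsLine.mem_side_of_le (hT : G.IsTree) (hm : IsLine G m) {i j : ℤ} (hij : j ≤ i) :
    m j ∈ side G (m (i + 1)) (m i) := by
  have := hm.rev.mem_side_of_lt hT (i := -(i + 1)) (j := -j) (by lia)
  simpa using this

theorem IsLine.injective (hT : G.IsTree) (hm : IsLine G m) : Function.Injective m := by
  intro i j hij
  by_contra hne
  wlog h : i < j generalizing i j
  · exact this hij.symm (Ne.symm hne) (by lia)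
  have h1 := hm.mem_side_of_lt hT h
  rw [← hij] at h1
  exact not_mem_side hT (hm.adj i) h1 (hm.mem_side_of_le hT le_rfl)

theorem IsLine.exists_crossing (hT : G.IsTree) (hm : IsLine G m) {a b : V} (hab : G.Adj a b)
    {i j : ℤ} (hij : i ≤ j) (hi : m i ∈ side G b a) (hj : m j ∈ side G a b) :
    ∃ k, i ≤ k ∧ k < j ∧ a = m k ∧ b = m (k + 1) := by
  induction j, hij using Int.leInduction with
  | base => exact absurd hi (not_mem_side hT hab hj)
  | succ k hk ih =>
    rcases mem_side_or hT hab (m k) with h | h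
    · obtain ⟨l, h1, h2, h3⟩ := ih h
      exact ⟨l, h1, by lia, h3⟩
    · obtain ⟨h1, h2⟩ := crossing hT hab (hm.adj k) h hj
      exact ⟨k, hk, by lia, h1.symm, h2.symm⟩

theorem IsLine.conv (hT : G.IsTree) (hm : IsLine G m) : Conv G (Set.range m) := by
  rintro _ ⟨i, rfl⟩ _ ⟨j, rfl⟩ a b hab ha hb
  rcases le_total i j with h | h
  · obtain ⟨k, -, -, rfl, rfl⟩ := hm.exists_crossing hT hab h ha hb
    exact ⟨⟨k, rfl⟩, ⟨k + 1, rfl⟩⟩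
  · obtain ⟨k, -, -, rfl, rfl⟩ := hm.exists_crossing hT hab.symm h hb ha
    exact ⟨⟨k + 1, rfl⟩, ⟨k, rfl⟩⟩

end Lines

section Distance

theorem dist_eq_of_separates (hT : G.IsTree) {a b p q : V} (hab : G.Adj a b)
    (hp : p ∈ side G b a) (hq : q ∈ side G a b) :
    G.dist p q = G.dist p a + 1 + G.dist b q := by
  apply le_antisymm
  · have h1 := hT.connected.dist_triangle (u := p) (v := a) (w := q)
    have h2 := hT.connected.dist_triangle (u := a) (v := b) (w := q)
    have h3 : G.dist a b = 1 := SimpleGraph.dist_eq_one_iff_adj.2 hab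
    omega
  · obtain ⟨w, hw⟩ := hT.connected.exists_walk_length_eq_dist p q
    rw [← hw]
    clear hw
    induction w with
    | nil => exact absurd hp (not_mem_side hT hab hq)
    | @cons u v q huv w ih =>
      rw [SimpleGraph.Walk.length_cons]
      rcases mem_side_or hT hab v with h | h
      · obtain ⟨rfl, rfl⟩ := crossing hT hab huv hp h
        have := SimpleGraph.dist_le w
        simp only [SimpleGraph.dist_self]
        omega
      · have h1 := ih h hq
        have h2 := hT.connected.dist_triangle (u := u) (v := v) (w := a)
        have h3 : G.dist u v = 1 := SimpleGraph.dist_eq_one_iff_adj.2 huv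
        omega

end Distance

section Action

variable {A : Type*} [Group A] [MulAction A V]

theorem reachable_smul {G G' : SimpleGraph V} (g : A)
    (h : ∀ v w, G.Adj v w → G'.Adj (g • v) (g • w)) {x y : V} (hxy : G.Reachable x y) :
    G'.Reachable (g • x) (g • y) :=
  hxy.map ⟨fun v => g • v, fun {v w} => h v w⟩

theorem smul_mem_side (hact : ∀ (g : A) (v w : V), G.Adj v w → G.Adj (g • v) (g • w)) (g : A)
    {a b v : V} (h : v ∈ side G a b) : g • v ∈ side G (g • a) (g • b) := by
  refine reachable_smul g ?_ h
  intro v w hvw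
  rw [SimpleGraph.deleteEdges_adj] at hvw ⊢
  refine ⟨hact g v w hvw.1, ?_⟩
  have := hvw.2
  simp only [Set.mem_singleton_iff, Sym2.eq_iff, smul_left_cancel_iff] at this ⊢
  exact this

theorem smul_mem_side_iff (hact : ∀ (g : A) (v w : V), G.Adj v w → G.Adj (g • v) (g • w)) (g : A)
    {a b v : V} : g • v ∈ side G (g • a) (g • b) ↔ v ∈ side G a b := by
  refine ⟨fun h => ?_, smul_mem_side hact g⟩
  simpa using smul_mem_side hact g⁻¹ h

theorem Conn.smul (hact : ∀ (g : A) (v w : V), G.Adj v w → G.Adj (g • v) (g • w)) (g : A)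
    {Y : Set V} {x y : V} (h : Conn G Y x y) : Conn G (g • Y) (g • x) (g • y) := by
  intro a b hab hx hy
  have h1 := h (g⁻¹ • a) (g⁻¹ • b) (hact _ _ _ hab)
    (by simpa using smul_mem_side hact g⁻¹ hx) (by simpa using smul_mem_side hact g⁻¹ hy)
  rwa [← Set.mem_smul_set_iff_inv_smul_mem, ← Set.mem_smul_set_iff_inv_smul_mem] at h1

theorem Conv.smul (hact : ∀ (g : A) (v w : V), G.Adj v w → G.Adj (g • v) (g • w)) (g : A)
    {Y : Set V} (h : Conv G Y) : Conv G (g • Y) := by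
  rintro _ ⟨x, hx, rfl⟩ _ ⟨y, hy, rfl⟩
  exact (h x hx y hy).smul hact g

theorem IsLine.smul (hact : ∀ (g : A) (v w : V), G.Adj v w → G.Adj (g • v) (g • w)) (g : A)
    {m : ℤ → V} (h : IsLine G m) : IsLine G (fun i => g • m i) :=
  fun i => ⟨hact g _ _ (h i).1, fun h' => (h i).2 (smul_left_cancel g h')⟩

theorem dist_smul (hT : G.IsTree)
    (hact : ∀ (g : A) (v w : V), G.Adj v w → G.Adj (g • v) (g • w)) (g : A) (x y : V) :
    G.dist (g • x) (g • y) = G.dist x y := by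
  have key : ∀ (g : A) (x y : V), G.dist (g • x) (g • y) ≤ G.dist x y := by
    intro g x y
    obtain ⟨w, hw⟩ := hT.connected.exists_walk_length_eq_dist x y
    rw [← hw, ← SimpleGraph.Walk.length_map (⟨fun v => g • v, fun {v w} => hact g v w⟩ : G →g G)]
    exact SimpleGraph.dist_le _
  refine le_antisymm (key g x y) ?_
  simpa using key g⁻¹ (g • x) (g • y)

end Action

set_option linter.unusedSectionVars false

variable {V A J : Type*} [Group A] [MulAction A V] [MulAction A J]

/-- A family of lines in a tree with translations along them, such that distinct lines have
overlaps much shorter than the translation length. -/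
structure RotFamily (G : SimpleGraph V) (r : J → A) (ℓ : J → ℤ → V) (τ κ : ℤ) : Prop where
  tree : G.IsTree
  act : ∀ (g : A) (v w : V), G.Adj v w → G.Adj (g • v) (g • w)
  line : ∀ j, IsLine G (ℓ j)
  r_smul : ∀ (g : A) (j : J), r (g • j) = g * r j * g⁻¹
  l_smul : ∀ (g : A) (j : J) (i : ℤ), ℓ (g • j) i = g • ℓ j i
  r_line : ∀ (j : J) (i : ℤ), r j • ℓ j i = ℓ j (i + τ)
  overlap : ∀ (j j' : J) (i i' : ℤ), ℓ j i ∈ Set.range (ℓ j') → ℓ j i' ∈ Set.range (ℓ j') →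
    κ < i' - i → Subgroup.zpowers (r j) = Subgroup.zpowers (r j') ∧
      Set.range (ℓ j) = Set.range (ℓ j')
  one_le : 1 ≤ κ
  lt_tau : 10 * κ < τ

/-- The set `S` meets the line `m` in a set of diameter at most `2 * κ`. -/
def Thin (κ : ℤ) (S : Set V) (m : ℤ → V) : Prop :=
  ∀ i i', m i ∈ S → m i' ∈ S → i' - i ≤ 2 * κ

/-- A segment of length `τ - 4 * κ` of some line separates `p` from `q`. -/
def LongSep (G : SimpleGraph V) (ℓ : J → ℤ → V) (τ κ : ℤ) (p q : V) : Prop :=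
  ∃ (j : J) (m : ℤ → V) (a : ℤ), (m = ℓ j ∨ m = fun i => ℓ j (-i)) ∧
    ∀ i, a ≤ i → i < a + τ - 4 * κ →
      p ∈ side G (m (i + 1)) (m i) ∧ q ∈ side G (m i) (m (i + 1))

/-- The group generated by the translations along lines contained in `Y`. -/
def lineGroup (r : J → A) (ℓ : J → ℤ → V) (Y : Set V) : Subgroup A :=
  Subgroup.closure (r '' {j | Set.range (ℓ j) ⊆ Y})

/-- The induction hypothesis in the proof of the separation theorem. -/
structure Windmill (G : SimpleGraph V) (r : J → A) (ℓ : J → ℤ → V) (τ κ : ℤ) (p : V)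
    (Y : Set V) : Prop where
  mem : p ∈ Y
  conv : Conv G Y
  stab : ∀ j, Set.range (ℓ j) ⊆ Y → ∀ y ∈ Y, r j • y ∈ Y ∧ (r j)⁻¹ • y ∈ Y
  absorb : ∀ j i i', ℓ j i ∈ Y → ℓ j i' ∈ Y → 2 * κ < i' - i → Set.range (ℓ j) ⊆ Y
  sep : ∀ n ∈ lineGroup r ℓ Y, n ≠ 1 → LongSep G ℓ τ κ p (n • p)

variable {G : SimpleGraph V} {r : J → A} {ℓ : J → ℤ → V} {τ κ : ℤ} {p : V} {Y : Set V}

section Gap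

variable {m : ℤ → V}

theorem exists_gap (hT : G.IsTree)
    (hact : ∀ (g : A) (v w : V), G.Adj v w → G.Adj (g • v) (g • w)) (hm : IsLine G m)
    {ρ : A} {T : ℤ} (hτ : τ ≤ T) (hκ : 0 ≤ κ) (hρ : ∀ i, ρ • m i = m (i + T)) (hY : Conv G Y)
    (hthin : Thin κ Y m) (hne : ∃ i, m i ∈ Y) :
    ∃ a, (∀ i, a ≤ i → Y ⊆ side G (m (i + 1)) (m i)) ∧
      (∀ i, i < a + τ - 2 * κ → ρ • Y ⊆ side G (m i) (m (i + 1))) := by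
  obtain ⟨i0, hi0⟩ := hne
  obtain ⟨a, ha, hmax⟩ := Int.exists_greatest_of_bdd (P := fun i => m i ∈ Y)
    ⟨i0 + 2 * κ, fun z hz => by have := hthin i0 z hi0 hz; lia⟩ ⟨i0, hi0⟩
  refine ⟨a, fun i hi => ?_, fun i hi => ?_⟩
  · refine hY.subset_side hT (hm.adj i).symm ?_ ha (hm.mem_side_of_le hT hi)
    rintro ⟨h, -⟩
    have := hmax _ h
    lia
  · have ha' : m (a + T) ∈ ρ • Y := by
      rw [← hρ]
      exact Set.smul_mem_smul_set ha
    refine (hY.smul hact ρ).subset_side hT (hm.adj i) ?_ ha' (hm.mem_side_of_lt hT (by lia))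
    rintro ⟨h, -⟩
    have h1 : m (i - T) ∈ Y := by
      rw [Set.mem_smul_set_iff_inv_smul_mem] at h
      have := hρ (i - T)
      rw [sub_add_cancel] at this
      rwa [← this, inv_smul_smul] at h
    have := hthin _ _ h1 ha
    lia

theorem subset_far (hT : G.IsTree) (hm : IsLine G m) (hκ : 0 ≤ κ) {S R : Set V} {a : ℤ}
    (hR : ∀ i, i < a + τ - 2 * κ → R ⊆ side G (m i) (m (i + 1))) (hS : Conv G S)
    (hSR : (S ∩ R).Nonempty) (hthin : Thin κ S m) :
    ∀ i, i < a + τ - 4 * κ → S ⊆ side G (m i) (m (i + 1)) := by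
  obtain ⟨z, hzS, hzR⟩ := hSR
  intro i hi
  refine hS.subset_side hT (hm.adj i) ?_ hzS (hR i (by lia) hzR)
  rintro ⟨h, -⟩
  have := (hS _ h _ hzS _ _ (hm.adj (i + 2 * κ)) (hm.mem_side_of_le hT (by lia))
    (hR _ (by lia) hzR)).2
  have := hthin _ _ h this
  lia

theorem subset_near (hT : G.IsTree) (hm : IsLine G m) (hκ : 0 ≤ κ) {S : Set V} {a : ℤ}
    (hY : ∀ i, a ≤ i → Y ⊆ side G (m (i + 1)) (m i)) (hS : Conv G S)
    (hSY : (S ∩ Y).Nonempty) (hthin : ∀ i i', m i ∈ S → m i' ∈ S → i' - i ≤ κ) :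
    ∀ i, a + κ ≤ i → S ⊆ side G (m (i + 1)) (m i) := by
  obtain ⟨z, hzS, hzY⟩ := hSY
  intro i hi
  refine hS.subset_side hT (hm.adj i).symm ?_ hzS (hY i (by lia) hzY)
  rintro ⟨h, -⟩
  have := (hS _ hzS _ h _ _ (hm.adj a) (hY _ le_rfl hzY) (hm.mem_side_of_lt hT (by lia))).1
  have := hthin _ _ this h
  lia

theorem Thin.rev {S : Set V} (h : Thin κ S m) : Thin κ S (fun i => m (-i)) := by
  intro i i' hi hi'
  have := h _ _ hi' hi
  lia

end Gap

section Extension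

/-- The lines which meet `Y` but are not contained in `Y`. -/
def border (ℓ : J → ℤ → V) (Y : Set V) : Set J :=
  {j | (∃ i, ℓ j i ∈ Y) ∧ ¬ Set.range (ℓ j) ⊆ Y}

/-- Translates of elements of the class `Z` by alternating products of translations along border
lines; the first factor of the product is recorded. An element `x` stands for the set `f x`. -/
inductive Far {X : Type*} [MulAction A X] (f : X → Set V) (r : J → A) (ℓ : J → ℤ → V) (κ : ℤ)
    (B : Set J) (Z : X → Prop) : J → A → X → Prop
  | base (b : J) (ρ : A) (S : X) (hb : b ∈ B) (hρ : ρ ∈ Subgroup.zpowers (r b)) (h1 : ρ ≠ 1)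
      (hS : Z S) (hthin : Thin κ (f S) (ℓ b)) : Far f r ℓ κ B Z b ρ (ρ • S)
  | step (b b' : J) (ρ ρ' : A) (W : X) (hb : b ∈ B) (hρ : ρ ∈ Subgroup.zpowers (r b))
      (h1 : ρ ≠ 1) (hW : Far f r ℓ κ B Z b' ρ' W) (hne : Set.range (ℓ b) ≠ Set.range (ℓ b')) :
      Far f r ℓ κ B Z b ρ (ρ • W)

section

variable {X : Type*} [MulAction A X] {f : X → Set V}

omit [MulAction A V] [MulAction A J] in
theorem Far.mem {B : Set J} {Z : X → Prop} {b : J} {ρ : A} {W : X}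
    (h : Far f r ℓ κ B Z b ρ W) : b ∈ B := by
  cases h <;> assumption

end

theorem RotFamily.pow_line (F : RotFamily G r ℓ τ κ) (j : J) (k i : ℤ) :
    (r j) ^ k • ℓ j i = ℓ j (i + k * τ) := by
  induction k generalizing i with
  | zero => simp
  | succ k ih => rw [zpow_add_one, mul_smul, F.r_line, ih]; congr 1; ring
  | pred k ih =>
    rw [zpow_sub_one, mul_smul]
    have : (r j)⁻¹ • ℓ j i = ℓ j (i - τ) := by
      rw [inv_smul_eq_iff, F.r_line, sub_add_cancel]
    rw [this, ih]; congr 1; ring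

theorem RotFamily.zpowers_smul_range (F : RotFamily G r ℓ τ κ) {j : J} {ρ : A}
    (hρ : ρ ∈ Subgroup.zpowers (r j)) : ρ • Set.range (ℓ j) = Set.range (ℓ j) := by
  obtain ⟨k, rfl⟩ := Subgroup.mem_zpowers_iff.1 hρ
  ext v
  rw [Set.mem_smul_set]
  constructor
  · rintro ⟨_, ⟨i, rfl⟩, rfl⟩
    exact ⟨_, (F.pow_line j k i).symm⟩
  · rintro ⟨i, rfl⟩
    exact ⟨_, ⟨i - k * τ, rfl⟩, by rw [F.pow_line, sub_add_cancel]⟩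

theorem RotFamily.range_smul (F : RotFamily G r ℓ τ κ) (g : A) (j : J) :
    Set.range (ℓ (g • j)) = g • Set.range (ℓ j) := by
  ext v
  rw [Set.mem_smul_set]
  constructor
  · rintro ⟨i, rfl⟩
    exact ⟨_, ⟨i, rfl⟩, (F.l_smul g j i).symm⟩
  · rintro ⟨_, ⟨i, rfl⟩, rfl⟩
    exact ⟨i, F.l_smul g j i⟩

theorem RotFamily.zpowers_smul (F : RotFamily G r ℓ τ κ) {g ρ : A} {j : J}
    (hρ : ρ ∈ Subgroup.zpowers (r j)) : g * ρ * g⁻¹ ∈ Subgroup.zpowers (r (g • j)) := by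
  obtain ⟨k, rfl⟩ := Subgroup.mem_zpowers_iff.1 hρ
  rw [F.r_smul, ← conj_zpow]
  exact Subgroup.zpow_mem_zpowers _ _

theorem RotFamily.exists_orient (F : RotFamily G r ℓ τ κ) {j : J} {ρ : A}
    (hρ : ρ ∈ Subgroup.zpowers (r j)) (h1 : ρ ≠ 1) :
    ∃ m : ℤ → V, (m = ℓ j ∨ m = fun i => ℓ j (-i)) ∧ ∃ T, τ ≤ T ∧ ∀ i, ρ • m i = m (i + T) := by
  obtain ⟨k, rfl⟩ := Subgroup.mem_zpowers_iff.1 hρ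
  have hτ : 0 < τ := by have := F.lt_tau; have := F.one_le; lia
  rcases lt_trichotomy k 0 with hk | rfl | hk
  · refine ⟨_, Or.inr rfl, -k * τ, by nlinarith, fun i => ?_⟩
    simp only [F.pow_line]
    congr 1; ring
  · simp at h1
  · exact ⟨_, Or.inl rfl, k * τ, by nlinarith, fun i => F.pow_line _ _ _⟩

theorem RotFamily.line_orient (F : RotFamily G r ℓ τ κ) {j : J} {m : ℤ → V}
    (h : m = ℓ j ∨ m = fun i => ℓ j (-i)) : IsLine G m := by
  rcases h with rfl | rfl
  · exact F.line j
  · exact (F.line j).rev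

theorem range_orient {j : J} {m : ℤ → V}
    (h : m = ℓ j ∨ m = fun i => ℓ j (-i)) : Set.range m = Set.range (ℓ j) := by
  rcases h with rfl | rfl
  · rfl
  · exact (Equiv.neg ℤ).surjective.range_comp (ℓ j)

theorem Thin.orient {j : J} {m : ℤ → V} {S : Set V}
    (h : m = ℓ j ∨ m = fun i => ℓ j (-i)) (hS : Thin κ S (ℓ j)) : Thin κ S m := by
  rcases h with rfl | rfl
  · exact hS
  · exact hS.rev

theorem RotFamily.overlap_le (F : RotFamily G r ℓ τ κ) {j j' : J} {m : ℤ → V}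
    (h : m = ℓ j ∨ m = fun i => ℓ j (-i)) (hne : Set.range (ℓ j) ≠ Set.range (ℓ j')) (i i' : ℤ)
    (hi : m i ∈ Set.range (ℓ j')) (hi' : m i' ∈ Set.range (ℓ j')) : i' - i ≤ κ := by
  by_contra hlt
  rcases h with rfl | rfl
  · exact hne (F.overlap _ _ _ _ hi hi' (by lia)).2
  · exact hne (F.overlap _ _ _ _ hi' hi (by lia)).2

theorem RotFamily.zpowers_eq (F : RotFamily G r ℓ τ κ) {j j' : J}
    (h : Set.range (ℓ j) = Set.range (ℓ j')) :
    Subgroup.zpowers (r j) = Subgroup.zpowers (r j') :=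
  (F.overlap j j' 0 (κ + 1) (h ▸ ⟨_, rfl⟩) (h ▸ ⟨_, rfl⟩) (by lia)).1

theorem Windmill.thin_of_mem (w : Windmill G r ℓ τ κ p Y) {b : J} (hb : b ∈ border ℓ Y) :
    Thin κ Y (ℓ b) := by
  intro i i' hi hi'
  by_contra h
  exact hb.2 (w.absorb b i i' hi hi' (by lia))

variable {X : Type*} [MulAction A X] {f : X → Set V}

/-- The sets produced by `Far` lie beyond a long gap along the first border line. -/
theorem Far.gap (F : RotFamily G r ℓ τ κ) (w : Windmill G r ℓ τ κ p Y) {Z : X → Prop}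
    (hf : ∀ (g : A) x, f (g • x) = g • f x) (hZ : ∀ S, Z S → Conv G (f S) ∧ (f S ∩ Y).Nonempty)
    {b : J} {ρ : A} {W : X}
    (h : Far f r ℓ κ (border ℓ Y) Z b ρ W) :
    ∃ m : ℤ → V, (m = ℓ b ∨ m = fun i => ℓ b (-i)) ∧ ∃ a,
      (∀ i, a ≤ i → Y ⊆ side G (m (i + 1)) (m i)) ∧
      (∀ i, i < a + τ - 4 * κ → f W ⊆ side G (m i) (m (i + 1))) := by
  have hκ := F.one_le
  have hτκ := F.lt_tau
  have main : ∀ (b : J) (ρ : A), b ∈ border ℓ Y → ρ ∈ Subgroup.zpowers (r b) → ρ ≠ 1 →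
      ∃ m : ℤ → V, (m = ℓ b ∨ m = fun i => ℓ b (-i)) ∧ ∃ a,
      (∀ i, a ≤ i → Y ⊆ side G (m (i + 1)) (m i)) ∧
      (∀ S, Conv G S → (S ∩ Y).Nonempty → Thin κ S (ℓ b) →
        ∀ i, i < a + τ - 4 * κ → ρ • S ⊆ side G (m i) (m (i + 1))) := by
    intro b ρ hb hρ h1
    obtain ⟨m, hm, T, hT, hρm⟩ := F.exists_orient hρ h1
    have hml := F.line_orient hm
    have hne : ∃ i, m i ∈ Y := by
      obtain ⟨i, hi⟩ := hb.1
      have : ℓ b i ∈ Set.range m := by rw [range_orient hm]; exact ⟨i, rfl⟩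
      obtain ⟨i', hi'⟩ := this
      exact ⟨i', hi' ▸ hi⟩
    obtain ⟨a, ha1, ha2⟩ := exists_gap F.tree F.act hml hT (by lia) hρm w.conv
      ((w.thin_of_mem hb).orient hm) hne
    refine ⟨m, hm, a, ha1, fun S hS hSY hthin => ?_⟩
    refine subset_far F.tree hml (by lia) ha2 (hS.smul F.act ρ) ?_ ?_
    · obtain ⟨z, h1, h2⟩ := hSY
      exact ⟨ρ • z, Set.smul_mem_smul_set h1, Set.smul_mem_smul_set h2⟩
    · intro i i' hi hi'
      have key : ∀ i, m i ∈ ρ • S → m (i - T) ∈ S := by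
        intro i h
        rw [Set.mem_smul_set_iff_inv_smul_mem] at h
        have := hρm (i - T)
        rw [sub_add_cancel] at this
        rwa [← this, inv_smul_smul] at h
      have := (hthin.orient hm) _ _ (key _ hi) (key _ hi')
      lia
  induction h with
  | base b ρ S hb hρ h1 hS hthin =>
    obtain ⟨m, hm, a, ha1, ha2⟩ := main b ρ hb hρ h1
    exact ⟨m, hm, a, ha1, hf ρ S ▸ ha2 (f S) (hZ S hS).1 (hZ S hS).2 hthin⟩
  | step b b' ρ ρ' W hb hρ h1 hW hne ih =>
    obtain ⟨m, hm, a, ha1, ha2⟩ := main b ρ hb hρ h1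
    obtain ⟨m', hm', a', ha1', ha2'⟩ := ih
    refine ⟨m, hm, a, ha1, fun i hi => ?_⟩
    have hml := F.line_orient hm
    have hml' := F.line_orient hm'
    have hmeet : ∀ b ∈ border ℓ Y, (Set.range (ℓ b) ∩ Y).Nonempty := by
      intro b hb
      obtain ⟨i, hi⟩ := hb.1
      exact ⟨_, ⟨i, rfl⟩, hi⟩
    have h2 := ha2 (Set.range (ℓ b')) ((F.line b').conv F.tree) (hmeet b' hW.mem)
      (fun i i' hi hi' => by
        have := F.overlap_le (Or.inl rfl) hne i i' hi hi'
        lia) i hi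
    have h3 := subset_near F.tree hml' (κ := κ) (by lia) ha1' ((F.line b).conv F.tree)
      (hmeet b hb) (fun i i' hi hi' => F.overlap_le hm' hne.symm i i' hi hi') (a' + κ) le_rfl
    have h4 := ha2' (a' + κ) (by lia)
    rw [hf]
    refine (Set.smul_set_mono h4).trans ?_
    have h5 : side G (ρ • m' (a' + κ)) (ρ • m' (a' + κ + 1)) ⊆ side G (m i) (m (i + 1)) := by
      refine side_subset F.tree (hml.adj i) (F.act _ _ _ (hml'.adj _)) ?_ ?_
      · apply h2
        rw [← range_orient hm']
        exact Set.smul_mem_smul_set ⟨_, rfl⟩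
      · have : m i ∈ ρ • Set.range (ℓ b) := by
          rw [F.zpowers_smul_range hρ, ← range_orient hm]
          exact ⟨_, rfl⟩
        obtain ⟨v, hv, hv'⟩ := this
        have hv' : ρ • v = m i := hv'
        rw [← hv', smul_mem_side_iff F.act]
        exact h3 hv
    rintro _ ⟨v, hv, rfl⟩
    exact h5 ((smul_mem_side_iff F.act ρ).2 hv)

theorem Windmill.stab_group (w : Windmill G r ℓ τ κ p Y) {g : A} (hg : g ∈ lineGroup r ℓ Y) :
    ∀ y, g • y ∈ Y ↔ y ∈ Y := by
  have key : ∀ g ∈ lineGroup r ℓ Y, ∀ y ∈ Y, g • y ∈ Y ∧ g⁻¹ • y ∈ Y := by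
    intro g hg
    induction hg using Subgroup.closure_induction with
    | mem x hx =>
      obtain ⟨j, hj, rfl⟩ := hx
      exact w.stab j hj
    | one => simp
    | mul x y _ _ hx hy =>
      intro z hz
      rw [mul_inv_rev, mul_smul, mul_smul]
      exact ⟨(hx _ (hy _ hz).1).1, (hy _ (hx _ hz).2).2⟩
    | inv x _ hx =>
      intro z hz
      rw [inv_inv]
      exact (hx z hz).symm
  intro y
  refine ⟨fun h => ?_, fun h => (key g hg y h).1⟩
  simpa using (key g hg _ h).2

theorem Windmill.smul_border (F : RotFamily G r ℓ τ κ) (w : Windmill G r ℓ τ κ p Y) {g : A}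
    (hg : g ∈ lineGroup r ℓ Y) {b : J} (hb : b ∈ border ℓ Y) : g • b ∈ border ℓ Y := by
  obtain ⟨⟨i, hi⟩, h2⟩ := hb
  refine ⟨⟨i, ?_⟩, fun h => h2 ?_⟩
  · rwa [F.l_smul, w.stab_group hg]
  · rintro _ ⟨i, rfl⟩
    rw [← w.stab_group hg, ← F.l_smul]
    exact h ⟨i, rfl⟩

/-- The group generated by translations along lines meeting `Y`. -/
def extGroup (r : J → A) (ℓ : J → ℤ → V) (Y : Set V) : Subgroup A :=
  lineGroup r ℓ Y ⊔ Subgroup.closure (r '' border ℓ Y)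

theorem Far.smul (F : RotFamily G r ℓ τ κ) (w : Windmill G r ℓ τ κ p Y) {Z : X → Prop}
    (hf : ∀ (g : A) x, f (g • x) = g • f x) (hZ : ∀ g ∈ lineGroup r ℓ Y, ∀ S, Z S → Z (g • S))
    {g : A} (hg : g ∈ lineGroup r ℓ Y)
    {b : J} {ρ : A} {W : X} (h : Far f r ℓ κ (border ℓ Y) Z b ρ W) :
    Far f r ℓ κ (border ℓ Y) Z (g • b) (g * ρ * g⁻¹) (g • W) := by
  induction h with
  | base b ρ S hb hρ h1 hS hthin =>
    have : g • ρ • S = (g * ρ * g⁻¹) • g • S := by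
      simp [← mul_smul]
    rw [this]
    refine Far.base _ _ _ (w.smul_border F hg hb) (F.zpowers_smul hρ) (by simpa using h1)
      (hZ g hg S hS) ?_
    intro i i' hi hi'
    rw [hf, F.l_smul, Set.smul_mem_smul_set_iff] at hi hi'
    exact hthin i i' hi hi'
  | step b b' ρ ρ' W hb hρ h1 hW hne ih =>
    have : g • ρ • W = (g * ρ * g⁻¹) • g • W := by
      simp [← mul_smul]
    rw [this]
    refine Far.step _ _ _ _ _ (w.smul_border F hg hb) (F.zpowers_smul hρ) (by simpa using h1)
      ih ?_
    rw [F.range_smul, F.range_smul]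
    exact fun h => hne (smul_left_cancel g h)

theorem Far.normal_form (F : RotFamily G r ℓ τ κ) (w : Windmill G r ℓ τ κ p Y)
    {Z : X → Prop} (hf : ∀ (g : A) x, f (g • x) = g • f x)
    (hZ : ∀ g ∈ lineGroup r ℓ Y, ∀ S, Z S → Z (g • S))
    (hZB : ∀ b ∈ border ℓ Y, ∀ S, Z S → Thin κ (f S) (ℓ b) ∨ ∀ ρ ∈ Subgroup.zpowers (r b), ρ • S =
    S)
    {h : A} (hh : h ∈ extGroup r ℓ Y) {S : X} (hS : Z S) :
    Z (h • S) ∨ ∃ b ρ, Far f r ℓ κ (border ℓ Y) Z b ρ (h • S) := by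
  set Q : X → Prop := fun W => Z W ∨ ∃ b ρ, Far f r ℓ κ (border ℓ Y) Z b ρ W with hQ
  have hg : ∀ g ∈ lineGroup r ℓ Y, ∀ W, Q W → Q (g • W) := by
    rintro g hg W (h | ⟨b, ρ, h⟩)
    · exact Or.inl (hZ g hg W h)
    · exact Or.inr ⟨_, _, h.smul F w hf hZ hg⟩
  have hr : ∀ b ∈ border ℓ Y, ∀ ρ ∈ Subgroup.zpowers (r b), ∀ W, Q W → Q (ρ • W) := by
    intro b hb ρ hρ W hW
    by_cases h1 : ρ = 1
    · rwa [h1, one_smul]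
    rcases hW with h | ⟨b', ρ', h⟩
    · rcases hZB b hb W h with h2 | h2
      · exact Or.inr ⟨_, _, Far.base b ρ W hb hρ h1 h h2⟩
      · rw [h2 ρ hρ]; exact Or.inl h
    by_cases hne : Set.range (ℓ b) = Set.range (ℓ b')
    · have hz := F.zpowers_eq hne
      rw [hz] at hρ
      cases h with
      | base _ _ S hb' hρ' h1' hS hthin =>
        rw [← mul_smul]
        by_cases h2 : ρ * ρ' = 1
        · rw [h2, one_smul]; exact Or.inl hS
        · exact Or.inr ⟨_, _, Far.base b' _ S hb' (mul_mem hρ hρ') h2 hS hthin⟩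
      | step _ b'' _ ρ'' W hb' hρ' h1' hW hne' =>
        rw [← mul_smul]
        by_cases h2 : ρ * ρ' = 1
        · rw [h2, one_smul]; exact Or.inr ⟨_, _, hW⟩
        · exact Or.inr ⟨_, _, Far.step b' _ _ _ W hb' (mul_mem hρ hρ') h2 hW hne'⟩
    · exact Or.inr ⟨_, _, Far.step b b' ρ ρ' W hb hρ h1 h hne⟩
  let N : Subgroup A :=
    { carrier := {h | (∀ W, Q W → Q (h • W)) ∧ ∀ W, Q W → Q (h⁻¹ • W)}
      mul_mem' := by
        rintro x y ⟨hx, hx'⟩ ⟨hy, hy'⟩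
        constructor
        · intro W hW
          rw [mul_smul]
          exact hx _ (hy _ hW)
        · intro W hW
          rw [mul_inv_rev, mul_smul]
          exact hy' _ (hx' _ hW)
      one_mem' := by simp
      inv_mem' := by
        rintro x ⟨hx, hx'⟩
        exact ⟨hx', by simpa using hx⟩ }
  have hN : extGroup r ℓ Y ≤ N := by
    refine sup_le (fun g h => ⟨hg g h, hg _ (inv_mem h)⟩) ?_
    rw [Subgroup.closure_le]
    rintro _ ⟨b, hb, rfl⟩
    exact ⟨hr b hb _ (Subgroup.mem_zpowers _), hr b hb _ (inv_mem (Subgroup.mem_zpowers _))⟩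
  exact (hN hh).1 S (Or.inl hS)

theorem Windmill.ext_sep (F : RotFamily G r ℓ τ κ) (w : Windmill G r ℓ τ κ p Y) {n : A}
    (hn : n ∈ extGroup r ℓ Y) (hn1 : n ≠ 1) : LongSep G ℓ τ κ p (n • p) := by
  have hκ := F.one_le
  have hf : ∀ (g x : A), ({(g • x) • p} : Set V) = g • {x • p} := by
    intro g x
    rw [Set.smul_set_singleton, smul_eq_mul, mul_smul]
  have hthin : ∀ (b : J) (x : A), Thin κ {x • p} (ℓ b) := by
    intro b x i i' hi hi'
    have := (F.line b).injective F.tree (hi.trans hi'.symm)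
    lia
  rcases Far.normal_form (f := fun x : A => ({x • p} : Set V)) F w hf
      (Z := fun x => x ∈ lineGroup r ℓ Y) (fun g hg x hx => mul_mem hg hx)
      (fun b hb x hx => Or.inl (hthin b x)) hn (one_mem _) with h | ⟨b, ρ, h⟩
  · exact w.sep n (by simpa using h) hn1
  · obtain ⟨m, hm, a, ha1, ha2⟩ := h.gap F w hf (fun x hx => ⟨conv_singleton F.tree _,
      _, rfl, (w.stab_group hx p).2 w.mem⟩)
    refine ⟨b, m, a, hm, fun i hi hi' => ⟨ha1 i hi w.mem, ha2 i hi' ?_⟩⟩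
    simp

/-- Two border lines and a line avoiding `Y`. -/
theorem Windmill.false_of_border (F : RotFamily G r ℓ τ κ) (w : Windmill G r ℓ τ κ p Y) {j b b' : J}
    (hj : ∀ i, ℓ j i ∉ Y) (hb : b ∈ border ℓ Y) (hb' : b' ∈ border ℓ Y) {i i' : ℤ}
    (hi : ℓ j i ∈ Set.range (ℓ b)) (hi' : ℓ j i' ∈ Set.range (ℓ b')) (hlt : 2 * κ < i' - i) :
    False := by
  have hκ := F.one_le
  have hne : ∀ b ∈ border ℓ Y, Set.range (ℓ j) ≠ Set.range (ℓ b) := by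
    rintro b ⟨⟨k, hk⟩, -⟩ h
    have : ℓ b k ∈ Set.range (ℓ j) := h ▸ ⟨k, rfl⟩
    obtain ⟨k', hk'⟩ := this
    exact hj k' (hk' ▸ hk)
  obtain ⟨k, hk⟩ := hb.1
  obtain ⟨k', hk'⟩ := hb'.1
  have hadj := (F.line j).adj (i + κ)
  have h1 := (F.line j).mem_side_of_le F.tree (show i ≤ i + κ by lia)
  have h2 := (F.line j).mem_side_of_lt F.tree (show i + κ < i' by lia)
  rcases mem_side_or F.tree hadj (ℓ b k) with h3 | h3
  · have := ((F.line b).conv F.tree _ hi _ ⟨k, rfl⟩ _ _ hadj h1 h3).2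
    have := F.overlap_le (Or.inl rfl) (hne b hb) _ _ hi this
    lia
  rcases mem_side_or F.tree hadj (ℓ b' k') with h4 | h4
  · exact hj _ (w.conv _ hk _ hk' _ _ hadj h3 h4).1
  · have := ((F.line b').conv F.tree _ ⟨k', rfl⟩ _ hi' _ _ hadj h4 h2).1
    have := F.overlap_le (Or.inl rfl) (hne b' hb') _ _ this hi'
    lia

theorem Far.not_overlap (F : RotFamily G r ℓ τ κ) (w : Windmill G r ℓ τ κ p Y)
    {b' : J} {ρ : A} {W : Set V}
    (h : Far id r ℓ κ (border ℓ Y) (fun S => ∃ b ∈ border ℓ Y, S = Set.range (ℓ b)) b' ρ W)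
    {j b : J} (hj : ∀ h ∈ extGroup r ℓ Y, ∀ i, h • ℓ j i ∉ Y) (hb : b ∈ border ℓ Y) {i i' : ℤ}
    (hi : ℓ j i ∈ Set.range (ℓ b)) (hi' : ℓ j i' ∈ W) (hlt : 2 * κ < |i' - i|) : False := by
  have hκ := F.one_le
  have hτ := F.lt_tau
  have hle : ∀ b ∈ border ℓ Y, ∀ ρ ∈ Subgroup.zpowers (r b), ρ ∈ extGroup r ℓ Y := by
    intro b hb ρ hρ
    have : Subgroup.zpowers (r b) ≤ extGroup r ℓ Y := by
      rw [Subgroup.zpowers_le]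
      exact (le_sup_right : _ ≤ extGroup r ℓ Y) (Subgroup.subset_closure ⟨b, hb, rfl⟩)
    exact this hρ
  have htr : ∀ ρ ∈ extGroup r ℓ Y, ∀ j, (∀ h ∈ extGroup r ℓ Y, ∀ i, h • ℓ j i ∉ Y) →
      ∀ h ∈ extGroup r ℓ Y, ∀ i, h • ℓ (ρ • j) i ∉ Y := by
    intro ρ hρ j hj h hh i
    rw [F.l_smul, ← mul_smul]
    exact hj _ (mul_mem hh hρ) i
  have hsep : ∀ {j b b' : J} {ρ : A} {W : Set V} {i i' : ℤ}, 
      Far id r ℓ κ (border ℓ Y) (fun S => ∃ b ∈ border ℓ Y, S = Set.range (ℓ b)) b' ρ W →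
      (∀ h ∈ extGroup r ℓ Y, ∀ i, h • ℓ j i ∉ Y) → b ∈ border ℓ Y → ℓ j i ∈ Set.range (ℓ b) →
      ℓ j i' ∈ W → Set.range (ℓ b') ≠ Set.range (ℓ b) → False := by
    intro j b b' ρ W i i' h hj hb hi hi' hne
    have hmeet : ∀ b ∈ border ℓ Y, (Set.range (ℓ b) ∩ Y).Nonempty := by
      intro b hb
      obtain ⟨i, hi⟩ := hb.1
      exact ⟨_, ⟨i, rfl⟩, hi⟩
    obtain ⟨m, hm, a, ha1, ha2⟩ := h.gap F w (fun _ _ => rfl) (by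
      rintro _ ⟨b, hb, rfl⟩
      exact ⟨(F.line b).conv F.tree, hmeet b hb⟩)
    have h1 := subset_near F.tree (F.line_orient hm) (κ := κ) (by lia) ha1
      ((F.line b).conv F.tree) (hmeet b hb) (fun i i' hi hi' => F.overlap_le hm hne i i' hi hi')
    have h2 : ∀ k, a + κ ≤ k → k < a + τ - 4 * κ → m k ∈ Set.range (ℓ j) := fun k hk hk' =>
      ((F.line j).conv F.tree _ ⟨i, rfl⟩ _ ⟨i', rfl⟩ _ _ ((F.line_orient hm).adj k)
        (h1 k hk hi) (ha2 k hk' hi')).1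
    have h3 : Set.range (ℓ b') ≠ Set.range (ℓ j) := by
      intro h'
      obtain ⟨_, ⟨k, rfl⟩, hk⟩ := hmeet b' h.mem
      have : ℓ b' k ∈ Set.range (ℓ j) := h' ▸ ⟨k, rfl⟩
      obtain ⟨k', hk'⟩ := this
      apply hj 1 (one_mem _) k'
      rwa [one_smul, hk']
    have := F.overlap_le hm h3 _ _ (h2 (a + κ) le_rfl (by lia))
      (h2 (a + 2 * κ + 1) (by lia) (by lia))
    lia
  have hzero : ∀ {j b b' : J} {i i' : ℤ}, (∀ h ∈ extGroup r ℓ Y, ∀ i, h • ℓ j i ∉ Y) →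
      b ∈ border ℓ Y → b' ∈ border ℓ Y → ℓ j i ∈ Set.range (ℓ b) → ℓ j i' ∈ Set.range (ℓ b') →
      2 * κ < |i' - i| → False := by
    intro j b b' i i' hj hb hb' hi hi' hlt
    have hj' : ∀ i, ℓ j i ∉ Y := fun i => by simpa using hj 1 (one_mem _) i
    rcases lt_abs.1 hlt with h | h
    · exact w.false_of_border F hj' hb hb' hi hi' h
    · exact w.false_of_border F hj' hb' hb hi' hi (by lia)
  have hback : ∀ {b b' j : J} {ρ : A} {i : ℤ}, ρ ∈ Subgroup.zpowers (r b') →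
      Set.range (ℓ b') = Set.range (ℓ b) → ℓ j i ∈ Set.range (ℓ b) →
      ℓ (ρ⁻¹ • j) i ∈ Set.range (ℓ b') := by
    intro b b' j ρ i hρ h hi
    rw [F.l_smul, ← Set.mem_smul_set_iff_inv_smul_mem, F.zpowers_smul_range hρ, h]
    exact hi
  induction h generalizing j b with
  | base b' ρ S hb' hρ h1 hS hthin =>
    by_cases hne : Set.range (ℓ b') = Set.range (ℓ b)
    · obtain ⟨b'', hb'', rfl⟩ := hS
      refine hzero (htr ρ⁻¹ (inv_mem (hle b' hb' ρ hρ)) j hj) hb' hb'' (hback hρ hne hi) ?_ hlt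
      rwa [F.l_smul, ← Set.mem_smul_set_iff_inv_smul_mem]
    · exact hsep (Far.base b' ρ S hb' hρ h1 hS hthin) hj hb hi hi' hne
  | step b' b'' ρ ρ' W hb' hρ h1 hW hne' ih =>
    by_cases hne : Set.range (ℓ b') = Set.range (ℓ b)
    · refine ih (htr ρ⁻¹ (inv_mem (hle b' hb' ρ hρ)) j hj) hb' (hback hρ hne hi) ?_
      rwa [F.l_smul, ← Set.mem_smul_set_iff_inv_smul_mem]
    · exact hsep (Far.step b' b'' ρ ρ' W hb' hρ h1 hW hne') hj hb hi hi' hne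

/-- The extension of `Y` by its border lines. -/
def ext (r : J → A) (ℓ : J → ℤ → V) (Y : Set V) : Set V :=
  {v | ∃ h ∈ extGroup r ℓ Y, h • v ∈ Y ∨ ∃ b ∈ border ℓ Y, h • v ∈ Set.range (ℓ b)}

theorem smul_mem_ext {h : A} (hh : h ∈ extGroup r ℓ Y) {v : V} (hv : v ∈ ext r ℓ Y) :
    h • v ∈ ext r ℓ Y := by
  obtain ⟨g, hg, hv⟩ := hv
  refine ⟨g * h⁻¹, mul_mem hg (inv_mem hh), ?_⟩
  rwa [mul_smul, inv_smul_smul]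

theorem subset_ext : Y ⊆ ext r ℓ Y := fun v hv => ⟨1, one_mem _, Or.inl (by simpa using hv)⟩

theorem border_subset_ext {b : J} (hb : b ∈ border ℓ Y) : Set.range (ℓ b) ⊆ ext r ℓ Y :=
  fun v hv => ⟨1, one_mem _, Or.inr ⟨b, hb, by simpa using hv⟩⟩

theorem mem_extGroup {j : J} {i : ℤ} (h : ℓ j i ∈ Y) : r j ∈ extGroup r ℓ Y := by
  by_cases hj : Set.range (ℓ j) ⊆ Y
  · exact (le_sup_left : _ ≤ extGroup r ℓ Y) (Subgroup.subset_closure ⟨j, hj, rfl⟩)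
  · exact (le_sup_right : _ ≤ extGroup r ℓ Y) (Subgroup.subset_closure ⟨j, ⟨⟨i, h⟩, hj⟩, rfl⟩)

/-- A line with a long overlap with the extension has a translate meeting `Y`. -/
theorem Windmill.exists_meet (F : RotFamily G r ℓ τ κ) (w : Windmill G r ℓ τ κ p Y) {j : J}
    {i i' : ℤ} (hi : ℓ j i ∈ ext r ℓ Y) (hi' : ℓ j i' ∈ ext r ℓ Y) (hlt : 2 * κ < i' - i) :
    ∃ h ∈ extGroup r ℓ Y, ∃ i, h • ℓ j i ∈ Y := by
  by_contra! hj
  obtain ⟨h, hh, h1⟩ := hi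
  obtain ⟨h', hh', h2⟩ := hi'
  obtain ⟨b, hb, h1⟩ := h1.resolve_left (hj h hh i)
  obtain ⟨b', hb', h2⟩ := h2.resolve_left (hj h' hh' i')
  have hj' : ∀ g ∈ extGroup r ℓ Y, ∀ i, g • ℓ (h • j) i ∉ Y := by
    intro g hg i
    rw [F.l_smul, ← mul_smul]
    exact hj _ (mul_mem hg hh) i
  have h3 : ℓ (h • j) i' ∈ (h * h'⁻¹) • Set.range (ℓ b') := by
    rw [F.l_smul, Set.mem_smul_set_iff_inv_smul_mem, ← mul_smul]
    simpa using h2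
  rw [← F.l_smul] at h1
  rcases Far.normal_form (f := id) F w (fun _ _ => rfl)
    (Z := fun S : Set V => ∃ b ∈ border ℓ Y, S = Set.range (ℓ b)) (by
      rintro g hg _ ⟨b, hb, rfl⟩
      exact ⟨g • b, w.smul_border F hg hb, (F.range_smul g b).symm⟩) (by
      rintro b hb _ ⟨b', hb', rfl⟩
      by_cases hne : Set.range (ℓ b) = Set.range (ℓ b')
      · right
        intro ρ hρ
        rw [← hne, F.zpowers_smul_range hρ]
      · left
        intro i i' hi hi'
        have := F.overlap_le (Or.inl rfl) hne i i' hi hi'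
        have := F.one_le
        lia) (mul_mem hh (inv_mem hh')) ⟨b', hb', rfl⟩ with ⟨b'', hb'', h4⟩ | ⟨b'', ρ, h4⟩
  · rw [h4] at h3
    exact w.false_of_border F (fun i => by simpa using hj' 1 (one_mem _) i) hb hb'' h1 h3 hlt
  · exact h4.not_overlap F w hj' hb h1 h3 (lt_abs.2 (Or.inl hlt))

theorem Windmill.conn_ext (F : RotFamily G r ℓ τ κ) (w : Windmill G r ℓ τ κ p Y) {h : A}
    (hh : h ∈ extGroup r ℓ Y) : Conn G (ext r ℓ Y) p (h • p) := by
  have htr : ∀ {h : A} {x y : V}, h ∈ extGroup r ℓ Y → Conn G (ext r ℓ Y) x y →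
      Conn G (ext r ℓ Y) (h • x) (h • y) := by
    intro h x y hh hxy
    refine (hxy.smul F.act h).mono ?_
    rintro _ ⟨v, hv, rfl⟩
    exact smul_mem_ext hh hv
  let N : Subgroup A :=
    { carrier := {h | h ∈ extGroup r ℓ Y ∧ Conn G (ext r ℓ Y) p (h • p)}
      mul_mem' := by
        rintro x y ⟨hx, hx'⟩ ⟨hy, hy'⟩
        refine ⟨mul_mem hx hy, ?_⟩
        rw [mul_smul]
        exact hx'.trans F.tree (htr hx hy')
      one_mem' := ⟨one_mem _, by
        rw [one_smul]; exact ((w.conv p w.mem p w.mem)).mono subset_ext⟩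
      inv_mem' := by
        rintro x ⟨hx, hx'⟩
        refine ⟨inv_mem hx, ?_⟩
        have := (htr (inv_mem hx) hx').symm
        rwa [inv_smul_smul] at this }
  have hN : extGroup r ℓ Y ≤ N := by
    refine sup_le ?_ ?_
    · refine fun g hg => ⟨(le_sup_left : _ ≤ extGroup r ℓ Y) hg, ?_⟩
      exact (w.conv p w.mem _ ((w.stab_group hg p).2 w.mem)).mono subset_ext
    · rw [Subgroup.closure_le]
      rintro _ ⟨b, hb, rfl⟩
      obtain ⟨i, hi⟩ := hb.1
      have hrb := mem_extGroup (r := r) hi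
      refine ⟨hrb, ?_⟩
      have h1 := (w.conv p w.mem _ hi).mono (subset_ext (r := r) (ℓ := ℓ))
      have h2 := ((F.line b).conv F.tree _ ⟨i, rfl⟩ _ ⟨i + τ, rfl⟩).mono
        (border_subset_ext (r := r) hb)
      rw [← F.r_line] at h2
      exact (h1.trans F.tree h2).trans F.tree (htr hrb h1.symm)
  exact (hN hh).2

theorem Windmill.ext (F : RotFamily G r ℓ τ κ) (w : Windmill G r ℓ τ κ p Y) :
    Windmill G r ℓ τ κ p (ext r ℓ Y) := by
  have hκ := F.one_le
  have key : ∀ {j : J} {h : A} {i : ℤ}, h ∈ extGroup r ℓ Y → h • ℓ j i ∈ Y →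
      r j ∈ extGroup r ℓ Y := by
    intro j h i hh hi
    rw [← F.l_smul] at hi
    have := mem_extGroup (r := r) hi
    rw [F.r_smul] at this
    have := mul_mem (mul_mem (inv_mem hh) this) hh
    simpa [mul_assoc] using this
  have key' : ∀ {j : J}, Set.range (ℓ j) ⊆ TreeSide.ext r ℓ Y → r j ∈ extGroup r ℓ Y := by
    intro j hj
    obtain ⟨h, hh, i, hi⟩ := w.exists_meet F (hj ⟨0, rfl⟩) (hj ⟨2 * κ + 1, rfl⟩) (by lia)
    exact key hh hi
  refine ⟨subset_ext w.mem, ?_, ?_, ?_, ?_⟩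
  · have main : ∀ v ∈ TreeSide.ext r ℓ Y, Conn G (TreeSide.ext r ℓ Y) p v := by
      rintro v ⟨h, hh, hv⟩
      have h1 : Conn G (TreeSide.ext r ℓ Y) p (h • v) := by
        rcases hv with hv | ⟨b, hb, hv⟩
        · exact (w.conv p w.mem _ hv).mono subset_ext
        · obtain ⟨i, hi⟩ := hb.1
          exact ((w.conv p w.mem _ hi).mono subset_ext).trans F.tree
            (((F.line b).conv F.tree _ ⟨i, rfl⟩ _ hv).mono (border_subset_ext hb))
      have h2 := w.conn_ext F (inv_mem hh)
      have h3 := (h1.smul F.act h⁻¹).mono (Z := TreeSide.ext r ℓ Y) (by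
        rintro _ ⟨v, hv, rfl⟩
        exact smul_mem_ext (inv_mem hh) hv)
      rw [inv_smul_smul] at h3
      exact h2.trans F.tree h3
    intro x hx y hy
    exact (main x hx).symm.trans F.tree (main y hy)
  · intro j hj y hy
    exact ⟨smul_mem_ext (key' hj) hy, smul_mem_ext (inv_mem (key' hj)) hy⟩
  · intro j i i' hi hi' hlt
    obtain ⟨h, hh, k, hk⟩ := w.exists_meet F hi hi' hlt
    rw [← F.l_smul] at hk
    rintro _ ⟨l, rfl⟩
    refine ⟨h, hh, ?_⟩
    rw [← F.l_smul]
    by_cases hj : Set.range (ℓ (h • j)) ⊆ Y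
    · exact Or.inl (hj ⟨l, rfl⟩)
    · exact Or.inr ⟨h • j, ⟨⟨k, hk⟩, hj⟩, ⟨l, rfl⟩⟩
  · intro n hn hn1
    refine w.ext_sep F ?_ hn1
    have : lineGroup r ℓ (TreeSide.ext r ℓ Y) ≤ extGroup r ℓ Y := by
      rw [lineGroup, Subgroup.closure_le]
      rintro _ ⟨j, hj, rfl⟩
      exact key' hj
    exact this hn

theorem Windmill.nbhd (F : RotFamily G r ℓ τ κ) (w : Windmill G r ℓ τ κ p Y)
    (hB : border ℓ Y = ∅) : Windmill G r ℓ τ κ p {v | ∃ y ∈ Y, y = v ∨ G.Adj y v} := by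
  have hκ := F.one_le
  set Y' := {v | ∃ y ∈ Y, y = v ∨ G.Adj y v} with hY'
  have hsub : Y ⊆ Y' := fun y hy => ⟨y, hy, Or.inl rfl⟩
  have habs : ∀ j i i', ℓ j i ∈ Y' → ℓ j i' ∈ Y' → 2 * κ < i' - i → Set.range (ℓ j) ⊆ Y := by
    rintro j i i' ⟨y, hy, hyi⟩ ⟨y', hy', hyi'⟩ hlt
    have hinj := (F.line j).injective F.tree
    have hadj := (F.line j).adj (i + 1)
    have h1 : y ∈ side G (ℓ j (i + 1 + 1)) (ℓ j (i + 1)) := by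
      have h := (F.line j).mem_side_of_le F.tree (show i ≤ i + 1 by lia)
      rcases hyi with rfl | hyi
      · exact h
      · by_contra h'
        rw [not_mem_side_iff F.tree hadj.symm] at h'
        have := hinj (crossing F.tree hadj hyi.symm h h').1
        lia
    have h2 : y' ∈ side G (ℓ j (i + 1)) (ℓ j (i + 1 + 1)) := by
      have h := (F.line j).mem_side_of_lt F.tree (show i + 1 < i' by lia)
      rcases hyi' with rfl | hyi'
      · exact h
      · by_contra h'
        rw [not_mem_side_iff F.tree hadj] at h'
        have := hinj (crossing F.tree hadj hyi' h' h).2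
        lia
    have h3 := (w.conv y hy y' hy' _ _ hadj h1 h2).1
    by_contra h
    have : j ∈ border ℓ Y := ⟨⟨_, h3⟩, h⟩
    rw [hB] at this
    exact this
  have habs' : ∀ j, Set.range (ℓ j) ⊆ Y' → Set.range (ℓ j) ⊆ Y := fun j hj =>
    habs j 0 (2 * κ + 1) (hj ⟨_, rfl⟩) (hj ⟨_, rfl⟩) (by lia)
  refine ⟨hsub w.mem, ?_, ?_, fun j i i' hi hi' hlt => (habs j i i' hi hi' hlt).trans hsub, ?_⟩
  · have main : ∀ v ∈ Y', Conn G Y' p v := by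
      rintro v ⟨y, hy, hv⟩
      have h1 := (w.conv p w.mem y hy).mono hsub
      rcases hv with rfl | hv
      · exact h1
      · exact h1.trans F.tree (Conn.of_adj F.tree (hsub hy) ⟨y, hy, Or.inr hv⟩ hv)
    intro x hx y hy
    exact (main x hx).symm.trans F.tree (main y hy)
  · rintro j hj v ⟨y, hy, hv⟩
    have h1 := w.stab j (habs' j hj) y hy
    constructor
    · exact ⟨_, h1.1, hv.imp (congrArg _) (F.act _ _ _)⟩
    · exact ⟨_, h1.2, hv.imp (congrArg _) (F.act _ _ _)⟩
  · intro n hn hn1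
    refine w.sep n ?_ hn1
    have : lineGroup r ℓ Y' ≤ lineGroup r ℓ Y :=
      Subgroup.closure_mono (Set.image_mono habs')
    exact this hn

end Extension

theorem Windmill.sUnion {c : Set (Set V)} (F : RotFamily G r ℓ τ κ)
    (hc : IsChain (· ⊆ ·) c) (hne : c.Nonempty) (hw : ∀ Y ∈ c, Windmill G r ℓ τ κ p Y) :
    Windmill G r ℓ τ κ p (⋃₀ c) := by
  have hκ := F.one_le
  have hdir : ∀ {Y Z : Set V}, Y ∈ c → Z ∈ c → ∃ W ∈ c, Y ⊆ W ∧ Z ⊆ W := by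
    intro Y Z hY hZ
    rcases hc.total hY hZ with h | h
    · exact ⟨Z, hZ, h, subset_rfl⟩
    · exact ⟨Y, hY, subset_rfl, h⟩
  have habs : ∀ j i i', ℓ j i ∈ ⋃₀ c → ℓ j i' ∈ ⋃₀ c → 2 * κ < i' - i →
      ∃ Y ∈ c, Set.range (ℓ j) ⊆ Y := by
    rintro j i i' ⟨Y, hY, hi⟩ ⟨Z, hZ, hi'⟩ hlt
    obtain ⟨W, hW, h1, h2⟩ := hdir hY hZ
    exact ⟨W, hW, (hw W hW).absorb j i i' (h1 hi) (h2 hi') hlt⟩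
  have habs' : ∀ j, Set.range (ℓ j) ⊆ ⋃₀ c → ∃ Y ∈ c, Set.range (ℓ j) ⊆ Y := fun j hj =>
    habs j 0 (2 * κ + 1) (hj ⟨_, rfl⟩) (hj ⟨_, rfl⟩) (by lia)
  obtain ⟨Y₀, hY₀⟩ := hne
  refine ⟨⟨Y₀, hY₀, (hw Y₀ hY₀).mem⟩, ?_, ?_, ?_, ?_⟩
  · rintro x ⟨Y, hY, hx⟩ y ⟨Z, hZ, hy⟩
    obtain ⟨W, hW, h1, h2⟩ := hdir hY hZ
    exact ((hw W hW).conv x (h1 hx) y (h2 hy)).mono (Set.subset_sUnion_of_mem hW)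
  · rintro j hj y ⟨Y, hY, hy⟩
    obtain ⟨Z, hZ, hj⟩ := habs' j hj
    obtain ⟨W, hW, h1, h2⟩ := hdir hY hZ
    have := (hw W hW).stab j (hj.trans h2) y (h1 hy)
    exact ⟨⟨W, hW, this.1⟩, ⟨W, hW, this.2⟩⟩
  · intro j i i' hi hi' hlt
    obtain ⟨W, hW, h⟩ := habs j i i' hi hi' hlt
    exact h.trans (Set.subset_sUnion_of_mem hW)
  · intro n hn hn1
    have : ∃ Y ∈ c, n ∈ lineGroup r ℓ Y := by
      clear hn1
      induction hn using Subgroup.closure_induction with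
      | mem x hx =>
        obtain ⟨j, hj, rfl⟩ := hx
        obtain ⟨Y, hY, hj⟩ := habs' j hj
        exact ⟨Y, hY, Subgroup.subset_closure ⟨j, hj, rfl⟩⟩
      | one => exact ⟨Y₀, hY₀, one_mem _⟩
      | mul x y _ _ hx hy =>
        obtain ⟨Y, hY, hx⟩ := hx
        obtain ⟨Z, hZ, hy⟩ := hy
        obtain ⟨W, hW, h1, h2⟩ := hdir hY hZ
        refine ⟨W, hW, mul_mem ?_ ?_⟩
        · exact Subgroup.closure_mono (Set.image_mono fun j hj => Set.Subset.trans hj h1) hx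
        · exact Subgroup.closure_mono (Set.image_mono fun j hj => Set.Subset.trans hj h2) hy
      | inv x _ hx =>
        obtain ⟨Y, hY, hx⟩ := hx
        exact ⟨Y, hY, inv_mem hx⟩
    obtain ⟨Y, hY, hn⟩ := this
    exact (hw Y hY).sep n hn hn1

theorem windmill_singleton (F : RotFamily G r ℓ τ κ) (p : V) : Windmill G r ℓ τ κ p {p} := by
  have hκ := F.one_le
  have h : ∀ j i i', ℓ j i ∈ ({p} : Set V) → ℓ j i' ∈ ({p} : Set V) → i = i' := fun j i i' hi hi' =>
    (F.line j).injective F.tree (hi.trans hi'.symm)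
  have h' : ∀ j, ¬ Set.range (ℓ j) ⊆ {p} := fun j hj => by
    have := h j 0 1 (hj ⟨_, rfl⟩) (hj ⟨_, rfl⟩)
    lia
  refine ⟨rfl, conv_singleton F.tree p, fun j hj => absurd hj (h' j),
    fun j i i' hi hi' hlt => ?_, fun n hn hn1 => ?_⟩
  · have := h j i i' hi hi'
    lia
  · have : {j | Set.range (ℓ j) ⊆ {p}} = ∅ := by
      ext j
      simpa using h' j
    rw [lineGroup, this, Set.image_empty, Subgroup.closure_empty, Subgroup.mem_bot] at hn
    exact absurd hn hn1

/-- A nontrivial element of the group generated by the translations moves every vertex across a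
long segment of one of the lines. -/
theorem RotFamily.longSep (F : RotFamily G r ℓ τ κ) (p : V) {n : A}
    (hn : n ∈ Subgroup.closure (Set.range r)) (hn1 : n ≠ 1) : LongSep G ℓ τ κ p (n • p) := by
  obtain ⟨Y, -, hY⟩ := zorn_subset_nonempty {Y | Windmill G r ℓ τ κ p Y}
    (fun c hc hchain hne => ⟨⋃₀ c, Windmill.sUnion F hchain hne hc,
      fun s hs => Set.subset_sUnion_of_mem hs⟩) {p} (windmill_singleton F p)
  have w : Windmill G r ℓ τ κ p Y := hY.prop
  have hB : border ℓ Y = ∅ := by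
    by_contra hne
    obtain ⟨b, hb⟩ := Set.nonempty_iff_ne_empty.2 hne
    exact hb.2 ((border_subset_ext hb).trans (hY.le_of_ge (w.ext F) subset_ext))
  have hadj : ∀ y ∈ Y, ∀ v, G.Adj y v → v ∈ Y := fun y hy v hv =>
    hY.le_of_ge (w.nbhd F hB) (fun y hy => ⟨y, hy, Or.inl rfl⟩) ⟨y, hy, Or.inr hv⟩
  have huniv : ∀ v, v ∈ Y := by
    intro v
    obtain ⟨q⟩ := F.tree.connected.preconnected p v
    have hp := w.mem
    clear hn hn1 hB w hY
    induction q with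
    | nil => exact hp
    | cons h _ ih => exact ih (hadj _ hp _ h)
  refine w.sep n ?_ hn1
  rw [lineGroup]
  convert hn
  rw [← Set.image_univ]
  congr 1
  ext j
  simp only [Set.mem_ofPred_eq, Set.mem_univ, iff_true]
  exact fun v _ => huniv v

section Tree

variable {A : Type*} [Group A]

/-- Alternating products starting with a letter in `Q \ P`; the flag says whether the last letter
is in `P` (or the product is empty) or in `Q`. -/
inductive AltWord (P Q : Subgroup A) : Bool → A → Prop
  | nil : AltWord P Q true 1
  | right {g q : A} (hg : AltWord P Q true g) (hq : q ∈ Q) (hq' : q ∉ P) : AltWord P Q false (g * q)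
  | left {g p : A} (hg : AltWord P Q false g) (hp : p ∈ P) (hp' : p ∉ Q) : AltWord P Q true (g * p)

/-- `A` is the amalgamated product of its subgroups `P` and `Q` over their intersection. -/
structure IsAmalgam (P Q : Subgroup A) : Prop where
  gen : P ⊔ Q = ⊤
  not_mem : ∀ g, AltWord P Q false g → g ∉ P

/-- The Bass–Serre graph of a pair of subgroups. -/
def bsGraph (P Q : Subgroup A) : SimpleGraph ((A ⧸ P) ⊕ (A ⧸ Q)) where
  Adj v w := ∃ g : A, (v = Sum.inl (g : A ⧸ P) ∧ w = Sum.inr (g : A ⧸ Q)) ∨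
    (v = Sum.inr (g : A ⧸ Q) ∧ w = Sum.inl (g : A ⧸ P))
  symm := ⟨by rintro v w ⟨g, h | h⟩
              · exact ⟨g, Or.inr h.symm⟩
              · exact ⟨g, Or.inl h.symm⟩⟩
  loopless := ⟨by rintro v ⟨g, ⟨h1, h2⟩ | ⟨h1, h2⟩⟩ <;> simp [h1] at h2⟩

variable {P Q : Subgroup A}

theorem bsGraph_adj (g : A) :
    (bsGraph P Q).Adj (Sum.inl (g : A ⧸ P)) (Sum.inr (g : A ⧸ Q)) := ⟨g, Or.inl ⟨rfl, rfl⟩⟩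

theorem bsGraph_act (g : A) (v w : (A ⧸ P) ⊕ (A ⧸ Q)) (h : (bsGraph P Q).Adj v w) :
    (bsGraph P Q).Adj (g • v) (g • w) := by
  obtain ⟨x, ⟨rfl, rfl⟩ | ⟨rfl, rfl⟩⟩ := h
  · exact ⟨g * x, Or.inl ⟨rfl, rfl⟩⟩
  · exact ⟨g * x, Or.inr ⟨rfl, rfl⟩⟩

theorem bsGraph_connected (h : P ⊔ Q = ⊤) : (bsGraph P Q).Connected := by
  have key : ∀ g : A, (bsGraph P Q).Reachable (Sum.inl ((1 : A) : A ⧸ P)) (Sum.inl (g : A ⧸ P)) :=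
      by
    have hadj : ∀ g : A, (bsGraph P Q).Reachable (Sum.inl (g : A ⧸ P)) (Sum.inr (g : A ⧸ Q)) :=
      fun g => (bsGraph_adj g).reachable
    let N : Subgroup A :=
      { carrier := {g | (bsGraph P Q).Reachable (Sum.inl ((1 : A) : A ⧸ P)) (Sum.inl (g : A ⧸ P))}
        mul_mem' := by
          intro x y hx hy
          have := reachable_smul x (bsGraph_act x) hy
          refine SimpleGraph.Reachable.trans hx ?_
          simpa using this
        one_mem' := SimpleGraph.Reachable.refl _
        inv_mem' := by
          intro x hx
          have := (reachable_smul x⁻¹ (bsGraph_act x⁻¹) hx).symm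
          simpa using this }
    have hN : P ⊔ Q ≤ N := by
      refine sup_le ?_ ?_
      · intro x hx
        have : ((1 : A) : A ⧸ P) = (x : A ⧸ P) := QuotientGroup.eq.2 (by simpa using hx)
        change (bsGraph P Q).Reachable _ _
        rw [this]
      · intro x hx
        have : ((1 : A) : A ⧸ Q) = (x : A ⧸ Q) := QuotientGroup.eq.2 (by simpa using hx)
        have h1 := hadj 1
        rw [this] at h1
        exact h1.trans (hadj x).symm
    intro g
    exact hN (h ▸ Subgroup.mem_top g)
  have key' : ∀ v, (bsGraph P Q).Reachable (Sum.inl ((1 : A) : A ⧸ P)) v := by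
    rintro (v | v)
    · obtain ⟨g, rfl⟩ := QuotientGroup.mk_surjective v
      exact key g
    · obtain ⟨g, rfl⟩ := QuotientGroup.mk_surjective v
      exact (key g).trans (bsGraph_adj g).reachable
  exact (SimpleGraph.connected_iff _).2
    ⟨fun v w => (key' v).symm.trans (key' w), ⟨Sum.inl ((1 : A) : A ⧸ P)⟩⟩

theorem bsGraph_not_reachable (h : ∀ g, AltWord P Q false g → g ∉ P) :
    ¬ ((bsGraph P Q).deleteEdges {s(Sum.inl ((1 : A) : A ⧸ P), Sum.inr
        ((1 : A) : A ⧸ Q))}).Reachable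
      (Sum.inr ((1 : A) : A ⧸ Q)) (Sum.inl ((1 : A) : A ⧸ P)) := by
  rintro ⟨w⟩
  set S : Set ((A ⧸ P) ⊕ (A ⧸ Q)) := {v | (∃ g, AltWord P Q false g ∧ v = Sum.inl (g : A ⧸ P)) ∨
    ∃ g, AltWord P Q true g ∧ v = Sum.inr (g : A ⧸ Q)} with hS
  have hmul : ∀ (R : Subgroup A) (g x : A), x ∈ R → ((g * x : A) : A ⧸ R) = (g : A ⧸ R) := by
    intro R g x hx
    exact QuotientGroup.eq.2 (by simpa using hx)
  have main : ∀ u v, ((bsGraph P Q).deleteEdges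
      {s(Sum.inl ((1 : A) : A ⧸ P), Sum.inr ((1 : A) : A ⧸ Q))}).Walk u v → u ∈ S → v ∈ S := by
    intro u v w
    induction w with
    | nil => exact id
    | @cons u v x huv w ih =>
      intro hu
      apply ih
      rw [SimpleGraph.deleteEdges_adj] at huv
      obtain ⟨⟨x, hx⟩, hne⟩ := huv
      simp only [Set.mem_singleton_iff] at hne
      rcases hx with ⟨rfl, rfl⟩ | ⟨rfl, rfl⟩
      · rcases hu with ⟨g, hg, hgx⟩ | ⟨g, hg, hgx⟩
        · have hgx := QuotientGroup.eq.1 (Sum.inl.inj hgx)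
          obtain ⟨p, hp, rfl⟩ : ∃ p ∈ P, x = g * p := ⟨g⁻¹ * x, by simpa using inv_mem hgx, by simp⟩
          by_cases hpQ : p ∈ Q
          · rw [hmul Q g p hpQ]
            cases hg with
            | right hg hq hq' => exact Or.inr ⟨_, hg, by rw [hmul Q _ _ hq]⟩
          · exact Or.inr ⟨_, AltWord.left hg hp hpQ, rfl⟩
        · simp at hgx
      · rcases hu with ⟨g, hg, hgx⟩ | ⟨g, hg, hgx⟩
        · simp at hgx
        · have hgx := QuotientGroup.eq.1 (Sum.inr.inj hgx)
          obtain ⟨q, hq, rfl⟩ : ∃ q ∈ Q, x = g * q := ⟨g⁻¹ * x, by simpa using inv_mem hgx, by simp⟩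
          by_cases hqP : q ∈ P
          · rw [hmul P g q hqP]
            rw [hmul P g q hqP, hmul Q g q hq] at hne
            cases hg with
            | nil => exact absurd Sym2.eq_swap hne
            | left hg hp hp' => exact Or.inl ⟨_, hg, by rw [hmul P _ _ hp]⟩
          · exact Or.inl ⟨_, AltWord.right hg hq hqP, rfl⟩
  rcases main _ _ w (Or.inr ⟨1, AltWord.nil, rfl⟩) with ⟨g, hg, hgx⟩ | ⟨g, hg, hgx⟩
  · refine h g hg ?_
    simpa using QuotientGroup.eq.1 (Sum.inl.inj hgx)
  · simp at hgx

theorem IsAmalgam.isTree (h : IsAmalgam P Q) : (bsGraph P Q).IsTree := by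
  refine ⟨bsGraph_connected h.gen, ?_⟩
  rw [SimpleGraph.isAcyclic_iff_forall_adj_isBridge]
  have key : ∀ x : A, (bsGraph P Q).IsBridge s(Sum.inl (x : A ⧸ P), Sum.inr (x : A ⧸ Q)) := by
    intro x
    rw [SimpleGraph.isBridge_iff]
    intro h'
    apply bsGraph_not_reachable h.not_mem
    have := smul_mem_side (G := bsGraph P Q) bsGraph_act x⁻¹ h'.symm
    simpa [side] using this
  rintro v w ⟨x, ⟨rfl, rfl⟩ | ⟨rfl, rfl⟩⟩
  · exact key x
  · rw [Sym2.eq_swap]; exact key x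

end Tree

section Existence

open Monoid

/-- The two-element family of groups `P, Q`. -/
def pairFam (P Q : Type u) : Bool → Type u
  | true => P
  | false => Q

instance (P Q : Type u) [Group P] [Group Q] : ∀ b, Group (pairFam P Q b)
  | true => inferInstanceAs (Group P)
  | false => inferInstanceAs (Group Q)

/-- The two-element family of homomorphisms. -/
def pairHom {H P Q : Type u} [Group H] [Group P] [Group Q] (φ : H →* P) (ψ : H →* Q) :
    ∀ b, H →* pairFam P Q b
  | true => φ
  | false => ψ

theorem exists_isAmalgam {H P Q : Type u} [Group H] [Group P] [Group Q] (φ : H →* P) (ψ : H →* Q)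
    (hφ : Function.Injective φ) (hψ : Function.Injective ψ) :
    ∃ (A : Type u) (_ : Group A) (f : P →* A) (g : Q →* A), Function.Injective f ∧
      Function.Injective g ∧ (∀ h, f (φ h) = g (ψ h)) ∧
      (∀ x y, f x = g y → ∃ h, x = φ h ∧ y = ψ h) ∧ IsAmalgam f.range g.range := by
  set Φ := pairHom φ ψ with hΦ
  have hinj : ∀ b, Function.Injective (Φ b)
    | true => hφ
    | false => hψ
  let f : P →* PushoutI Φ := PushoutI.of (φ := Φ) true
  let g : Q →* PushoutI Φ := PushoutI.of (φ := Φ) false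
  have hf : Function.Injective f := PushoutI.of_injective hinj true
  have hg : Function.Injective g := PushoutI.of_injective hinj false
  have hfb : ∀ h, f (φ h) = PushoutI.base Φ h := PushoutI.of_apply_eq_base Φ true
  have hgb : ∀ h, g (ψ h) = PushoutI.base Φ h := PushoutI.of_apply_eq_base Φ false
  have hinf : f.range ⊓ g.range = (PushoutI.base Φ).range :=
    PushoutI.inf_of_range_eq_base_range hinj (show true ≠ false by simp)
  refine ⟨PushoutI Φ, inferInstance, f, g, hf, hg, fun h => (hfb h).trans (hgb h).symm, ?_, ?_, ?_⟩
  · intro x y hxy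
    have : f x ∈ f.range ⊓ g.range := ⟨⟨x, rfl⟩, ⟨y, hxy.symm⟩⟩
    rw [hinf] at this
    obtain ⟨h, hh⟩ := this
    exact ⟨h, hf (hh.symm.trans (hfb h).symm), hg (hxy.symm.trans (hh.symm.trans (hgb h).symm))⟩
  · rw [eq_top_iff]
    intro x _
    induction x using PushoutI.induction_on with
    | of i x =>
      cases i with
      | true => exact (le_sup_left : f.range ≤ f.range ⊔ g.range) ⟨x, rfl⟩
      | false => exact (le_sup_right : g.range ≤ f.range ⊔ g.range) ⟨x, rfl⟩
    | base h => exact (le_sup_left : f.range ≤ f.range ⊔ g.range) ⟨φ h, hfb h⟩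
    | mul x y hx hy => exact mul_mem (hx trivial) (hy trivial)
  · have key : ∀ b x, AltWord f.range g.range b x → ∃ l : List (Σ i, pairFam P Q i),
        l.IsChain (fun a b => a.1 ≠ b.1) ∧ (∀ a ∈ l, a.2 ∉ (Φ a.1).range) ∧
        (∀ a ∈ l.getLast?, a.1 = b) ∧ (l.map fun a => PushoutI.of (φ := Φ) a.1 a.2).prod = x ∧
        (b = false → l ≠ []) := by
      intro b x h
      induction h with
      | nil => exact ⟨[], by simp⟩
      | @right x q hx hq hq' ih =>
        obtain ⟨l, h1, h2, h3, h4, -⟩ := ih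
        obtain ⟨y, rfl⟩ := hq
        refine ⟨l ++ [⟨false, y⟩], ?_, ?_, by simp, ?_, by simp⟩
        · rw [List.isChain_append]
          refine ⟨h1, by simp, fun a ha b hb => ?_⟩
          simp only [List.head?_cons, Option.mem_some_iff] at hb
          rw [h3 a ha, ← hb]
          simp
        · intro a ha
          rcases List.mem_append.1 ha with ha | ha
          · exact h2 a ha
          · rw [List.mem_singleton.1 ha]
            rintro ⟨h, hh⟩
            exact hq' ⟨φ h, (hfb h).trans ((hgb h).symm.trans (congrArg g hh))⟩
        · rw [List.map_append, List.prod_append, h4]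
          simp [g]
          rfl
      | @left x q hx hq hq' ih =>
        obtain ⟨l, h1, h2, h3, h4, -⟩ := ih
        obtain ⟨y, rfl⟩ := hq
        refine ⟨l ++ [⟨true, y⟩], ?_, ?_, by simp, ?_, by simp⟩
        · rw [List.isChain_append]
          refine ⟨h1, by simp, fun a ha b hb => ?_⟩
          simp only [List.head?_cons, Option.mem_some_iff] at hb
          rw [h3 a ha, ← hb]
          simp
        · intro a ha
          rcases List.mem_append.1 ha with ha | ha
          · exact h2 a ha
          · rw [List.mem_singleton.1 ha]
            rintro ⟨h, hh⟩
            exact hq' ⟨ψ h, (hgb h).trans ((hfb h).symm.trans (congrArg f hh))⟩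
        · rw [List.map_append, List.prod_append, h4]
          simp [f]
          rfl
    have key' : ∀ b x, AltWord f.range g.range b x → x ∈ (PushoutI.base Φ).range →
        ∀ l : List (Σ i, pairFam P Q i),
        l.IsChain (fun a b => a.1 ≠ b.1) → (∀ a ∈ l, a.2 ∉ (Φ a.1).range) →
        (l.map fun a => PushoutI.of (φ := Φ) a.1 a.2).prod = x → l = [] := by
      intro b x _ hx l h1 h2 h4
      let w : CoprodI.Word (pairFam P Q) := ⟨l, fun a ha h => h2 a ha (h ▸ one_mem _), h1⟩
      have hw : PushoutI.Reduced Φ w := h2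
      have := hw.eq_empty_of_mem_range hinj (by
        have : PushoutI.ofCoprodI w.prod = (l.map fun a => PushoutI.of (φ := Φ) a.1 a.2).prod := by
          simp only [CoprodI.Word.prod, w, map_list_prod, List.map_map]
          congr 1
        rw [this, h4]
        exact hx)
      exact congrArg CoprodI.Word.toList this
    intro x hx hxP
    by_cases hxQ : x ∈ g.range
    · obtain ⟨l, h1, h2, h3, h4, h5⟩ := key _ _ hx
      exact h5 rfl (key' _ _ hx (hinf ▸ ⟨hxP, hxQ⟩) l h1 h2 h4)
    · have hx' := AltWord.left hx (inv_mem hxP) (by simpa using hxQ)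
      obtain ⟨l, h1, h2, h3, h4, h5⟩ := key _ _ hx
      obtain ⟨y, hy⟩ := hxP
      have := key' _ _ hx' (by simp) (l ++ [⟨true, y⁻¹⟩]) (by
        rw [List.isChain_append]
        refine ⟨h1, by simp, fun a ha b hb => ?_⟩
        simp only [List.head?_cons, Option.mem_some_iff] at hb
        rw [h3 a ha, ← hb]
        simp) (by
        intro a ha
        rcases List.mem_append.1 ha with ha | ha
        · exact h2 a ha
        · rw [List.mem_singleton.1 ha]
          rintro ⟨h, hh⟩
          apply hxQ
          rw [← inv_mem_iff, ← hy]
          exact ⟨ψ h, (hgb h).trans ((hfb h).symm.trans ((congrArg f hh).trans (map_inv f y)))⟩) (by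
        rw [List.map_append, List.prod_append, h4, ← hy]
        simp only [List.map_cons, List.map_nil, List.prod_cons, List.prod_nil, mul_one]
        exact congrArg _ (map_inv f y))
      simp at this

end Existence

section Matching

variable {V : Type*} {G : SimpleGraph V} {m m' : ℤ → V}

theorem IsLine.eq_of_adj (hT : G.IsTree) (hm : IsLine G m) {k l : ℤ} (h : G.Adj (m k) (m l)) :
    l = k + 1 ∨ l = k - 1 := by
  have key : ∀ {k l : ℤ}, G.Adj (m k) (m l) → k < l → l = k + 1 := by
    intro k l h hkl
    exact hm.injective hT (crossing hT (hm.adj k) h (mem_side _ _) (hm.mem_side_of_lt hT hkl)).2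
  rcases lt_trichotomy k l with hkl | rfl | hkl
  · exact Or.inl (key h hkl)
  · exact (G.loopless.irrefl _ h).elim
  · have := key h.symm hkl
    right
    lia

theorem IsLine.mem_range_of_le (hT : G.IsTree) (hm : IsLine G m) (hm' : IsLine G m') {i i' t : ℤ}
    (hi : m i ∈ Set.range m') (hi' : m i' ∈ Set.range m') (h1 : i ≤ t) (h2 : t ≤ i') :
    m t ∈ Set.range m' := by
  rcases h1.eq_or_lt with rfl | h1
  · exact hi
  have := (hm'.conv hT _ hi _ hi' _ _ (hm.adj (t - 1)) (hm.mem_side_of_le hT (by lia))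
    (hm.mem_side_of_lt hT (by lia))).2
  rwa [sub_add_cancel] at this

/-- Two lines that share an initial edge agree as long as the first stays in the second. -/
theorem IsLine.eq_of_eq (hT : G.IsTree) (hm : IsLine G m) (hm' : IsLine G m') {i k T : ℤ}
    (h0 : m i = m' k) (h1 : m (i + 1) = m' (k + 1)) (hr : ∀ t, i ≤ t → t ≤ i + T →
      m t ∈ Set.range m') : ∀ t : ℕ, (t : ℤ) ≤ T → m (i + t) = m' (k + t) := by
  have key : ∀ t : ℕ, (t : ℤ) + 1 ≤ T → m (i + t) = m' (k + t) ∧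
      m (i + t + 1) = m' (k + t + 1) := by
    intro t
    induction t with
    | zero => intro _; simpa using ⟨h0, h1⟩
    | succ t ih =>
      intro ht
      push_cast at ht ⊢
      obtain ⟨e0, e1⟩ := ih (by lia)
      refine ⟨by rw [← add_assoc, ← add_assoc, e1], ?_⟩
      obtain ⟨l, hl⟩ := hr (i + (t + 1) + 1) (by lia) (by lia)
      have hadj := hm.adj (i + t + 1)
      rw [e1, show i + t + 1 + 1 = i + (t + 1) + 1 by ring, ← hl] at hadj
      rcases hm'.eq_of_adj hT hadj with h | h
      · rw [← hl, h]; congr 1; ring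
      · exfalso
        apply (hm (i + t)).2
        rw [e0, show i + t + 2 = i + (t + 1) + 1 by ring, ← hl, h]
        congr 1; ring
  intro t ht
  rcases t with _ | t
  · simpa using h0
  · have := (key t (by push_cast at ht; exact ht)).2
    push_cast
    rwa [← add_assoc, ← add_assoc]

theorem IsLine.matching (hT : G.IsTree) (hm : IsLine G m) (hm' : IsLine G m') {i i' : ℤ}
    (hi : m i ∈ Set.range m') (hi' : m i' ∈ Set.range m') (hii : i < i') :
    ∃ k, (∀ t : ℕ, (t : ℤ) ≤ i' - i → m (i + t) = m' (k + t)) ∨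
      (∀ t : ℕ, (t : ℤ) ≤ i' - i → m (i + t) = m' (k - t)) := by
  have hr : ∀ t, i ≤ t → t ≤ i + (i' - i) → m t ∈ Set.range m' := fun t h1 h2 =>
    hm.mem_range_of_le hT hm' hi hi' h1 (by lia)
  obtain ⟨k, hk⟩ := hi
  obtain ⟨l, hl⟩ := hr (i + 1) (by lia) (by lia)
  have hadj := hm.adj i
  rw [← hk, ← hl] at hadj
  refine ⟨k, ?_⟩
  rcases hm'.eq_of_adj hT hadj with rfl | rfl
  · exact Or.inl (hm.eq_of_eq hT hm' hk.symm hl.symm hr)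
  · right
    intro t ht
    have := hm.eq_of_eq hT hm'.rev (i := i) (k := -k) (by simp [hk]) (by rw [← hl]; congr 1; ring)
      (T := i' - i) (fun t h1 h2 => by
        obtain ⟨z, hz⟩ := hr t h1 h2
        exact ⟨-z, by simp [hz]⟩) t ht
    rw [this]
    congr 1; ring

end Matching

section Sequence

variable {A : Type*} [Group A]

/-- Partial products of a two-sided sequence, normalised to be `1` at `0`. -/
def intProd (s : ℤ → A) : ℤ → A
  | Int.ofNat n => Nat.rec 1 (fun k a => a * s k) n
  | Int.negSucc n => Nat.rec (s (-1))⁻¹ (fun k a => a * (s (-(k + 2)))⁻¹) n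

@[simp]
theorem intProd_zero (s : ℤ → A) : intProd s 0 = 1 := rfl

theorem intProd_succ (s : ℤ → A) (m : ℤ) : intProd s (m + 1) = intProd s m * s m := by
  rcases m with n | n
  · rfl
  · rcases n with _ | n
    · change (1 : A) = (s (-1))⁻¹ * s (-1)
      simp
    · have h1 : Int.negSucc (n + 1) + 1 = Int.negSucc n := by lia
      have h2 : Int.negSucc (n + 1) = -((n : ℤ) + 2) := by lia
      have h3 : intProd s (Int.negSucc (n + 1)) = intProd s (Int.negSucc n) *
        (s (-((n : ℤ) + 2)))⁻¹ := rfl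
      rw [h1, h3, h2]
      simp

theorem intProd_natCast (s : ℤ → A) (n : ℕ) :
    intProd s n = ((List.range n).map fun j : ℕ => s (j : ℤ)).prod := by
  induction n with
  | zero => simp
  | succ n ih =>
    push_cast
    rw [intProd_succ, ih, List.range_succ]
    simp

theorem intProd_add_period (s : ℤ → A) (N : ℤ) (hs : ∀ m, s (m + N) = s m) (m : ℤ) :
    intProd s (m + N) = intProd s N * intProd s m := by
  induction m using Int.induction_on with
  | zero => simp
  | succ n ih =>
    rw [intProd_succ, ← mul_assoc, ← ih, ← hs, ← intProd_succ]
    congr 1; ring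
  | pred n ih =>
    have h1 := intProd_succ s (-(n : ℤ) - 1)
    have h2 := intProd_succ s (-(n : ℤ) - 1 + N)
    rw [hs] at h2
    rw [show -(n : ℤ) - 1 + 1 = -n by ring] at h1
    rw [show -(n : ℤ) - 1 + N + 1 = -n + N by ring, ih, h1, ← mul_assoc] at h2
    exact (mul_right_cancel h2).symm

theorem intProd_add_mul_period (s : ℤ → A) (N : ℤ) (hs : ∀ m, s (m + N) = s m) (m k : ℤ) :
    intProd s (m + N * k) = intProd s N ^ k * intProd s m := by
  induction k using Int.induction_on with
  | zero => simp
  | succ n ih =>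
    rw [show m + N * ((n : ℤ) + 1) = m + N * n + N by ring, intProd_add_period s N hs, ih,
      ← mul_assoc, ← zpow_one_add, add_comm 1]
  | pred n ih =>
    have := intProd_add_period s N hs (m + N * (-(n : ℤ) - 1))
    rw [show m + N * (-(n : ℤ) - 1) + N = m + N * (-n) by ring, ih] at this
    rw [sub_eq_neg_add, zpow_add, zpow_neg_one, mul_assoc, this]
    simp [sub_eq_neg_add]

end Sequence

variable {A E : Type*} [Group A]

/-- Data for the relators `∏ (v m * x * h m * y)`, the product being over one period of `m`. -/
structure RelSys (P Q : Subgroup A) (N : ℕ) (x : E → A) (v h : E → ℤ → A) : Prop where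
  amalgam : IsAmalgam P Q
  malP : ∀ p ∈ P, p ∉ Q → ∀ c ∈ P, c ∈ Q → p⁻¹ * c * p ∈ Q → c = 1
  malQ : ∀ q ∈ Q, q ∉ P → ∀ c ∈ P, c ∈ Q → q⁻¹ * c * q ∈ P → c = 1
  x_mem : ∀ e, x e ∈ P
  x_not_mem : ∀ e, x e ∉ Q
  v_memP : ∀ e m, v e m ∈ P
  v_memQ : ∀ e m, v e m ∈ Q
  h_memP : ∀ e m, h e m ∈ P
  h_memQ : ∀ e m, h e m ∈ Q
  v_period : ∀ e m, v e (m + N) = v e m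
  h_period : ∀ e m, h e (m + N) = h e m
  v_one : ∀ e m, ¬ (N : ℤ) ∣ m → v e m = 1
  h_ne : ∀ e m, h e m ≠ h e (m + 1)
  sidon : ∀ e m m', ¬ (N : ℤ) ∣ m + 1 → ¬ (N : ℤ) ∣ m' + 1 →
    h e (m + 1) * (h e m)⁻¹ = h e (m' + 1) * (h e m')⁻¹ → (N : ℤ) ∣ m' - m
  coset : ∀ e e' c c', c ∈ P → c ∈ Q → c' ∈ P → c' ∈ Q → c * x e * c' = x e' → e = e'
  large : 1000 ≤ N

/-- Conjugates of relators: a position, a datum and a letter of `Q` outside `P`. -/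
structure RelIdx (P Q : Subgroup A) (E : Type*) where
  pos : A
  dat : E
  y : A
  y_mem : y ∈ Q
  y_not_mem : y ∉ P

variable {P Q : Subgroup A} {N : ℕ} {x : E → A} {v h : E → ℤ → A}

instance : MulAction A (RelIdx P Q E) where
  smul g j := { j with pos := g * j.pos }
  one_smul j := by
    change ({ j with pos := 1 * j.pos } : RelIdx P Q E) = j
    rw [one_mul]
  mul_smul a b j := by
    change ({ j with pos := a * b * j.pos } : RelIdx P Q E) = { j with pos := a * (b * j.pos) }
    rw [mul_assoc]

variable (x v h)

namespace RelIdx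

/-- The sequence of letters of the relator. -/
def letter (j : RelIdx P Q E) (m : ℤ) : A := v j.dat m * x j.dat * h j.dat m

/-- The vertices of type `Q` on the axis of the relator are the cosets of these elements. -/
def node (j : RelIdx P Q E) (m : ℤ) : A :=
  j.pos * intProd (fun m => j.letter x v h m * j.y) m

/-- The axis of the relator. -/
def axis (j : RelIdx P Q E) (i : ℤ) : (A ⧸ P) ⊕ (A ⧸ Q) :=
  if i % 2 = 0 then Sum.inr ((j.node x v h (i / 2) : A) : A ⧸ Q)
  else Sum.inl ((j.node x v h (i / 2) : A) : A ⧸ P)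

/-- The conjugate of the relator. -/
def relator (N : ℕ) (j : RelIdx P Q E) : A :=
  j.pos * intProd (fun m => j.letter x v h m * j.y) N * j.pos⁻¹

theorem axis_even (j : RelIdx P Q E) (m : ℤ) :
    j.axis x v h (2 * m) = Sum.inr ((j.node x v h m : A) : A ⧸ Q) := by
  simp [axis]

theorem axis_odd (j : RelIdx P Q E) (m : ℤ) :
    j.axis x v h (2 * m + 1) = Sum.inl ((j.node x v h m : A) : A ⧸ P) := by
  rw [axis, if_neg (by lia), show (2 * m + 1) / 2 = m by lia]

theorem node_succ (j : RelIdx P Q E) (m : ℤ) :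
    j.node x v h (m + 1) = j.node x v h m * j.letter x v h m * j.y := by
  simp only [node, intProd_succ, mul_assoc]

theorem node_smul (g : A) (j : RelIdx P Q E) (m : ℤ) :
    (g • j).node x v h m = g * j.node x v h m := mul_assoc _ _ _

theorem axis_smul (g : A) (j : RelIdx P Q E) (i : ℤ) :
    (g • j).axis x v h i = g • j.axis x v h i := by
  unfold axis
  split_ifs <;> rw [node_smul] <;> rfl

theorem relator_smul (g : A) (j : RelIdx P Q E) :
    (g • j).relator x v h N = g * j.relator x v h N * g⁻¹ := by
  change g * j.pos * _ * (g * j.pos)⁻¹ = _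
  rw [relator, mul_inv_rev]
  simp only [mul_assoc]
  rfl

theorem axis_even' (j : RelIdx P Q E) (m : ℤ) :
    j.axis x v h (2 * m + 2) = Sum.inr ((j.node x v h m * j.letter x v h m : A) : A ⧸ Q) := by
  rw [show 2 * m + 2 = 2 * (m + 1) by ring, axis_even, Sum.inr.injEq, eq_comm,
    QuotientGroup.eq, node_succ, inv_mul_cancel_left]
  exact j.y_mem

end RelIdx

namespace RelSys

open RelIdx

variable {x v h} (R : RelSys P Q N x v h)

include R

theorem letter_memP (j : RelIdx P Q E) (m : ℤ) : j.letter x v h m ∈ P :=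
  P.mul_mem (P.mul_mem (R.v_memP _ _) (R.x_mem _)) (R.h_memP _ _)

theorem letter_not_memQ (j : RelIdx P Q E) (m : ℤ) : j.letter x v h m ∉ Q := by
  rw [letter, Q.mul_mem_cancel_right (R.h_memQ _ _), Q.mul_mem_cancel_left (R.v_memQ _ _)]
  exact R.x_not_mem _

theorem letter_period (j : RelIdx P Q E) (m : ℤ) :
    j.letter x v h (m + N) = j.letter x v h m := by
  simp only [letter, R.v_period, R.h_period]

theorem axis_odd' (j : RelIdx P Q E) (m : ℤ) :
    j.axis x v h (2 * m + 1) = Sum.inl ((j.node x v h m * j.letter x v h m : A) : A ⧸ P) := by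
  rw [axis_odd, Sum.inl.injEq, QuotientGroup.eq, inv_mul_cancel_left]
  exact R.letter_memP j m

theorem isLine (j : RelIdx P Q E) : IsLine (bsGraph P Q) (j.axis x v h) := by
  intro i
  obtain ⟨m, rfl | rfl⟩ : ∃ m, i = 2 * m ∨ i = 2 * m + 1 := ⟨i / 2, by lia⟩
  · refine ⟨?_, ?_⟩
    · rw [axis_even, axis_odd]
      exact (bsGraph_adj _).symm
    · rw [axis_even, axis_even', ne_eq, Sum.inr.injEq, QuotientGroup.eq, inv_mul_cancel_left]
      exact R.letter_not_memQ j m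
  · refine ⟨?_, ?_⟩
    · rw [R.axis_odd', add_assoc, one_add_one_eq_two, axis_even']
      exact bsGraph_adj _
    · rw [R.axis_odd', show 2 * m + 1 + 2 = 2 * (m + 1) + 1 by ring, axis_odd, node_succ, ne_eq,
        Sum.inl.injEq, QuotientGroup.eq, inv_mul_cancel_left]
      exact j.y_not_mem

theorem node_add_mul (j : RelIdx P Q E) (m k : ℤ) :
    j.node x v h (m + N * k) = j.relator x v h N ^ k * j.node x v h m := by
  rw [node, intProd_add_mul_period _ _ (fun m => by rw [R.letter_period]), node, relator,
    conj_zpow]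
  group

theorem axis_add_mul (j : RelIdx P Q E) (i k : ℤ) :
    j.axis x v h (i + 2 * N * k) = j.relator x v h N ^ k • j.axis x v h i := by
  obtain ⟨m, rfl | rfl⟩ : ∃ m, i = 2 * m ∨ i = 2 * m + 1 := ⟨i / 2, by lia⟩
  · rw [show 2 * m + 2 * N * k = 2 * (m + N * k) by ring, axis_even, axis_even, R.node_add_mul]
    rfl
  · rw [show 2 * m + 1 + 2 * N * k = 2 * (m + N * k) + 1 by ring, axis_odd, axis_odd,
      R.node_add_mul]
    rfl

/-- Two axes sharing, in the same direction, the three vertices around a vertex of type `P`. -/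
theorem match_same {j j' : RelIdx P Q E} {m m' : ℤ}
    (h0 : j.axis x v h (2 * m) = j'.axis x v h (2 * m'))
    (h1 : j.axis x v h (2 * m + 1) = j'.axis x v h (2 * m' + 1))
    (h2 : j.axis x v h (2 * m + 2) = j'.axis x v h (2 * m' + 2)) :
    j.dat = j'.dat ∧
    j'.node x v h m' = j.node x v h m * (v j.dat m * (v j.dat m')⁻¹) ∧
    j'.node x v h m' * j'.letter x v h m' =
      j.node x v h m * j.letter x v h m * ((h j.dat m)⁻¹ * h j.dat m') := by
  have h1' := h1
  rw [axis_even, axis_even, Sum.inr.injEq, QuotientGroup.eq] at h0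
  rw [axis_odd, axis_odd, Sum.inl.injEq, QuotientGroup.eq] at h1
  rw [R.axis_odd', R.axis_odd', Sum.inl.injEq, QuotientGroup.eq] at h1'
  rw [axis_even', axis_even', Sum.inr.injEq, QuotientGroup.eq] at h2
  obtain ⟨c, hc⟩ : ∃ c, j'.node x v h m' = j.node x v h m * c := ⟨_, (mul_inv_cancel_left _ _).symm⟩
  obtain ⟨f, hf⟩ : ∃ f, j'.node x v h m' * j'.letter x v h m' =
    j.node x v h m * j.letter x v h m * f := ⟨_, (mul_inv_cancel_left _ _).symm⟩
  rw [hf, inv_mul_cancel_left] at h1' h2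
  rw [hc, inv_mul_cancel_left] at h0 h1
  have key : c * j'.letter x v h m' = j.letter x v h m * f := by
    rw [hc] at hf
    simpa only [mul_assoc, mul_left_cancel_iff] using hf
  have hd : j.dat = j'.dat := by
    refine R.coset _ _ ((v j'.dat m')⁻¹ * c⁻¹ * v j.dat m) (h j.dat m * f * (h j'.dat m')⁻¹)
      ?_ ?_ ?_ ?_ ?_
    · exact P.mul_mem (P.mul_mem (P.inv_mem (R.v_memP _ _)) (P.inv_mem h1)) (R.v_memP _ _)
    · exact Q.mul_mem (Q.mul_mem (Q.inv_mem (R.v_memQ _ _)) (Q.inv_mem h0)) (R.v_memQ _ _)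
    · exact P.mul_mem (P.mul_mem (R.h_memP _ _) h1') (P.inv_mem (R.h_memP _ _))
    · exact Q.mul_mem (Q.mul_mem (R.h_memQ _ _) h2) (Q.inv_mem (R.h_memQ _ _))
    · have : (v j'.dat m')⁻¹ * c⁻¹ * v j.dat m * x j.dat * (h j.dat m * f * (h j'.dat m')⁻¹) =
          (v j'.dat m')⁻¹ * c⁻¹ * (j.letter x v h m * f) * (h j'.dat m')⁻¹ := by
        simp only [letter, mul_assoc]
      rw [this, ← key, letter]
      group
  refine ⟨hd, ?_⟩
  simp only [letter, ← hd] at key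
  have hx : (x j.dat)⁻¹ * ((v j.dat m)⁻¹ * c * v j.dat m') * x j.dat =
      h j.dat m * f * (h j.dat m')⁻¹ := by
    have : (x j.dat)⁻¹ * ((v j.dat m)⁻¹ * c * v j.dat m') * x j.dat =
      (x j.dat)⁻¹ * (v j.dat m)⁻¹ * (c * (v j.dat m' * x j.dat * h j.dat m')) *
        (h j.dat m')⁻¹ := by group
    rw [this, key]
    group
  have h3 := R.malP _ (R.x_mem j.dat) (R.x_not_mem j.dat) ((v j.dat m)⁻¹ * c * v j.dat m')
    (P.mul_mem (P.mul_mem (P.inv_mem (R.v_memP _ _)) h1) (R.v_memP _ _))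
    (Q.mul_mem (Q.mul_mem (Q.inv_mem (R.v_memQ _ _)) h0) (R.v_memQ _ _)) (by
      rw [hx]
      exact Q.mul_mem (Q.mul_mem (R.h_memQ _ _) h2) (Q.inv_mem (R.h_memQ _ _)))
  rw [h3, mul_one, inv_mul_cancel] at hx
  have hc' : c = v j.dat m * (v j.dat m')⁻¹ := by
    rw [eq_mul_inv_iff_mul_eq, ← mul_one (v j.dat m), ← h3]
    group
  have hf' : f = (h j.dat m)⁻¹ * h j.dat m' := by
    rw [eq_inv_mul_iff_mul_eq, ← one_mul (h j.dat m'), hx]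
    group
  rw [← hf', ← hc']
  exact ⟨hc, hf⟩

theorem eq_of_match_same {j j' : RelIdx P Q E} {m m' : ℤ}
    (hs : ∀ t : ℕ, t ≤ 6 → j.axis x v h (2 * m + t) = j'.axis x v h (2 * m' + t))
    (hm : ∀ t : ℕ, t ≤ 2 → ¬ (N : ℤ) ∣ m + t) (hm' : ∀ t : ℕ, t ≤ 2 → ¬ (N : ℤ) ∣ m' + t) :
    j.relator x v h N = j'.relator x v h N ∧
      Set.range (j.axis x v h) = Set.range (j'.axis x v h) := by
  have key : ∀ t : ℕ, t ≤ 2 → j.dat = j'.dat ∧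
      j'.node x v h (m' + t) = j.node x v h (m + t) ∧
      j'.node x v h (m' + t) * j'.letter x v h (m' + t) = j.node x v h (m + t) *
        j.letter x v h (m + t) * ((h j.dat (m + t))⁻¹ * h j.dat (m' + t)) := by
    intro t ht
    obtain ⟨h1, h2, h3⟩ := R.match_same (j := j) (j' := j') (m := m + t) (m' := m' + t)
      (by have := hs (2 * t) (by lia); push_cast at this; rwa [mul_add, mul_add])
      (by have := hs (2 * t + 1) (by lia); push_cast at this
          rwa [mul_add, mul_add, add_assoc, add_assoc])
      (by have := hs (2 * t + 2) (by lia); push_cast at this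
          rwa [mul_add, mul_add, add_assoc, add_assoc])
    rw [R.v_one _ _ (hm t ht), R.v_one _ _ (hm' t ht), inv_one, mul_one, mul_one] at h2
    exact ⟨h1, h2, h3⟩
  have hy : ∀ t : ℕ, t ≤ 1 → (h j.dat (m + t))⁻¹ * h j.dat (m' + t) = j.y * j'.y⁻¹ := by
    intro t ht
    obtain ⟨-, h1, h2⟩ := key t (by lia)
    obtain ⟨-, h3, -⟩ := key (t + 1) (by lia)
    push_cast at h3
    rw [← add_assoc, ← add_assoc, node_succ, node_succ, h2, mul_assoc _ _ j'.y,
      mul_right_inj] at h3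
    rw [← h3]
    group
  obtain ⟨hd, hn, -⟩ := key 0 (by lia)
  have e0 := hy 0 (by lia)
  have e1 := hy 1 (by lia)
  simp only [Nat.cast_zero, add_zero, Nat.cast_one] at e0 e1 hn
  have hdvd : (N : ℤ) ∣ m' - m := by
    refine R.sidon j.dat m m' (hm 1 (by lia)) (hm' 1 (by lia)) ?_
    rw [← e0, inv_mul_eq_iff_eq_mul] at e1
    rw [e1]
    group
  obtain ⟨k, hk⟩ := hdvd
  obtain rfl : m' = m + N * k := by lia
  have hper : ∀ k : ℤ, h j.dat (m + N * k) = h j.dat m := by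
    intro k
    induction k using Int.induction_on with
    | zero => simp
    | succ n ih => rw [mul_add, mul_one, ← add_assoc, R.h_period, ih]
    | pred n ih => rw [← ih, ← R.h_period]; congr 1; ring
  rw [hper, inv_mul_cancel, eq_comm, mul_inv_eq_one] at e0
  rw [R.node_add_mul] at hn
  have hj : j.pos = j'.relator x v h N ^ k * j'.pos := by
    rw [node, node, ← mul_assoc] at hn
    have : (fun m => j'.letter x v h m * j'.y) = fun m => j.letter x v h m * j.y := by
      funext m
      rw [e0, letter, letter, hd]
    rw [this, mul_left_inj] at hn
    rw [hn]
  have hj2 : j = j'.relator x v h N ^ k • j' := by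
    rcases j with ⟨g, e, y, _, _⟩
    rcases j' with ⟨g', e', y', _, _⟩
    subst hd e0
    change _ = RelIdx.mk _ _ _ _ _
    congr
  refine ⟨?_, ?_⟩
  · rw [hj2, relator_smul]
    group
  · ext w
    constructor
    · rintro ⟨i, rfl⟩
      refine ⟨i + 2 * N * k, ?_⟩
      rw [R.axis_add_mul, ← axis_smul, ← hj2]
    · rintro ⟨i, rfl⟩
      refine ⟨i + 2 * N * (-k), ?_⟩
      rw [hj2, axis_smul, ← R.axis_add_mul]
      congr 1; ring

/-- Two axes sharing, in opposite directions, the three vertices around a vertex of type `P`. -/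
theorem match_rev {j j' : RelIdx P Q E} {m n : ℤ}
    (h0 : j.axis x v h (2 * m) = j'.axis x v h (2 * n + 2))
    (h1 : j.axis x v h (2 * m + 1) = j'.axis x v h (2 * n + 1))
    (h2 : j.axis x v h (2 * m + 2) = j'.axis x v h (2 * n)) :
    ∃ c f, c ∈ P ∧ c ∈ Q ∧ f ∈ P ∧ f ∈ Q ∧
      j'.node x v h n * j'.letter x v h n = j.node x v h m * c ∧
      j'.node x v h n = j.node x v h m * j.letter x v h m * f := by
  have h1' := h1
  rw [axis_even, axis_even', Sum.inr.injEq, QuotientGroup.eq] at h0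
  rw [axis_odd, R.axis_odd', Sum.inl.injEq, QuotientGroup.eq] at h1
  rw [R.axis_odd', axis_odd, Sum.inl.injEq, QuotientGroup.eq] at h1'
  rw [axis_even', axis_even, Sum.inr.injEq, QuotientGroup.eq] at h2
  exact ⟨_, _, h1, h0, h1', h2, (mul_inv_cancel_left _ _).symm, (mul_inv_cancel_left _ _).symm⟩

theorem not_match_rev_even {j j' : RelIdx P Q E} {m n : ℤ}
    (hs : ∀ t : ℕ, t ≤ 6 → j.axis x v h (2 * m + t) = j'.axis x v h (2 * n + 2 - t))
    (hn : ¬ (N : ℤ) ∣ n) (hn' : ¬ (N : ℤ) ∣ n - 1) : False := by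
  have key : ∀ t : ℕ, t ≤ 2 → ∃ c f, c ∈ P ∧ c ∈ Q ∧ f ∈ P ∧ f ∈ Q ∧
      j'.node x v h (n - t) * j'.letter x v h (n - t) = j.node x v h (m + t) * c ∧
      j'.node x v h (n - t) = j.node x v h (m + t) * j.letter x v h (m + t) * f := by
    intro t ht
    refine R.match_rev ?_ ?_ ?_
    · have := hs (2 * t) (by lia)
      push_cast at this
      convert this using 2 <;> ring
    · have := hs (2 * t + 1) (by lia)
      push_cast at this
      convert this using 2 <;> ring
    · have := hs (2 * t + 2) (by lia)
      push_cast at this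
      convert this using 2 <;> ring
  obtain ⟨c0, f0, -, c0Q, f0P, f0Q, e0, e0'⟩ := key 0 (by lia)
  obtain ⟨c1, f1, c1P, c1Q, f1P, f1Q, e1, e1'⟩ := key 1 (by lia)
  obtain ⟨c2, f2, c2P, c2Q, -, -, e2, -⟩ := key 2 (by lia)
  simp only [Nat.cast_zero, add_zero, sub_zero, Nat.cast_one, Nat.cast_ofNat] at *
  have s1 : j.y * c1 = f0 * j'.y⁻¹ := by
    have := node_succ x v h j' (n - 1)
    rw [sub_add_cancel, e1, node_succ, e0'] at this
    rw [eq_mul_inv_iff_mul_eq]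
    simpa only [mul_assoc, mul_left_cancel_iff, eq_comm] using this
  have s2 : j.y * c2 = f1 * j'.y⁻¹ := by
    have := node_succ x v h j' (n - 2)
    rw [show n - 2 + 1 = n - 1 by ring, e2, show m + 2 = m + 1 + 1 by ring, node_succ _ _ _ j
        (m + 1),
      e1'] at this
    rw [eq_mul_inv_iff_mul_eq]
    simpa only [mul_assoc, mul_left_cancel_iff, eq_comm] using this
  have hf : f0 = f1 := by
    have h1 : (j.y⁻¹)⁻¹ * (c1 * c2⁻¹) * j.y⁻¹ = f0 * f1⁻¹ := by
      have : (j.y⁻¹)⁻¹ * (c1 * c2⁻¹) * j.y⁻¹ = (j.y * c1) * (j.y * c2)⁻¹ := by group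
      rw [this, s1, s2]
      group
    have h2 := R.malQ j.y⁻¹ (Q.inv_mem j.y_mem) (fun h => j.y_not_mem (by simpa using P.inv_mem h))
      (c1 * c2⁻¹) (P.mul_mem c1P (P.inv_mem c2P)) (Q.mul_mem c1Q (Q.inv_mem c2Q))
      (by rw [h1]; exact P.mul_mem f0P (P.inv_mem f1P))
    rw [h2, mul_one, inv_inv, mul_inv_cancel, eq_comm, mul_inv_eq_one] at h1
    exact h1
  subst hf
  rw [e0'] at e0
  rw [e1'] at e1
  simp only [letter, R.v_one _ _ hn, R.v_one _ _ hn', one_mul, mul_assoc, mul_left_cancel_iff]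
    at e0 e1
  have h1 : ((x j.dat)⁻¹)⁻¹ * (h j.dat m * (h j.dat (m + 1))⁻¹) * (x j.dat)⁻¹ =
      (v j.dat m)⁻¹ * c0 * (h j'.dat n)⁻¹ * h j'.dat (n - 1) * c1⁻¹ * v j.dat (m + 1) := by
    rw [← e0, ← e1]
    group
  have h2 := R.malP (x j.dat)⁻¹ (P.inv_mem (R.x_mem _))
    (fun h => R.x_not_mem j.dat (by simpa using Q.inv_mem h))
    (h j.dat m * (h j.dat (m + 1))⁻¹) (P.mul_mem (R.h_memP _ _) (P.inv_mem (R.h_memP _ _)))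
    (Q.mul_mem (R.h_memQ _ _) (Q.inv_mem (R.h_memQ _ _))) (by
      rw [h1]
      exact Q.mul_mem (Q.mul_mem (Q.mul_mem (Q.mul_mem (Q.mul_mem (Q.inv_mem (R.v_memQ _ _)) c0Q)
        (Q.inv_mem (R.h_memQ _ _))) (R.h_memQ _ _)) (Q.inv_mem c1Q)) (R.v_memQ _ _))
  exact R.h_ne _ _ (mul_inv_eq_one.1 h2)

theorem exists_unique_dvd (z : ℤ) : ∃ a : ℤ, ∀ s, 0 ≤ s → s ≤ 20 → (N : ℤ) ∣ z + s → s = a := by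
  have hN := R.large
  by_cases h : ∃ a, 0 ≤ a ∧ a ≤ 20 ∧ (N : ℤ) ∣ z + a
  · obtain ⟨a, h0, h1, h2⟩ := h
    refine ⟨a, fun s hs hs' hd => ?_⟩
    have h3 := dvd_sub hd h2
    rw [show z + s - (z + a) = s - a by ring] at h3
    have := Int.eq_zero_of_abs_lt_dvd h3 (by rw [abs_lt]; lia)
    lia
  · exact ⟨0, fun s hs hs' hd => (h ⟨s, hs, hs', hd⟩).elim⟩

omit R in
theorem axis_parity {j j' : RelIdx P Q E} {m k : ℤ}
    (hk : j.axis x v h (2 * m) = j'.axis x v h k) : ∃ l, k = 2 * l := by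
  obtain ⟨l, rfl | rfl⟩ : ∃ l, k = 2 * l ∨ k = 2 * l + 1 := ⟨k / 2, by lia⟩
  · exact ⟨l, rfl⟩
  · rw [axis_even, axis_odd] at hk
    exact (Sum.inr_ne_inl hk).elim

theorem not_match_rev {j j' : RelIdx P Q E} {i k : ℤ}
    (hs : ∀ t : ℕ, t ≤ 11 → j.axis x v h (i + t) = j'.axis x v h (k - t)) : False := by
  obtain ⟨m, d, hm, hd⟩ : ∃ (m : ℤ) (d : ℕ), 2 * m = i + d ∧ d ≤ 1 :=
    ⟨(i + 1) / 2, (i % 2).toNat, by lia, by lia⟩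
  have hs' : ∀ t : ℕ, t ≤ 10 → j.axis x v h (2 * m + t) = j'.axis x v h (k - d - t) := by
    intro t ht
    have := hs (d + t) (by lia)
    push_cast at this
    rwa [← add_assoc, ← hm, ← sub_sub] at this
  obtain ⟨l, hl⟩ := axis_parity (by simpa using hs' 0 (by lia))
  rw [hl] at hs'
  obtain ⟨a, ha⟩ := R.exists_unique_dvd (l - 4)
  obtain ⟨s, hs2, h1, h2⟩ : ∃ s : ℕ, s ≤ 2 ∧ ¬ (N : ℤ) ∣ l - 1 - s ∧ ¬ (N : ℤ) ∣ l - 1 - s - 1 := by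
    have key : ∀ s : ℕ, s ≤ 3 → (3 - s : ℤ) ≠ a → ¬ (N : ℤ) ∣ l - 1 - s := by
      intro s hs hsa hd
      refine hsa (ha _ (by lia) (by lia) ?_)
      rwa [show l - 4 + (3 - s : ℤ) = l - 1 - s by ring]
    rcases eq_or_ne a 3 with h | h
    · exact ⟨1, by lia, key 1 (by lia) (by lia), by simpa [sub_sub] using key 2 (by lia) (by lia)⟩
    · rcases eq_or_ne a 2 with h' | h'
      · exact ⟨2, by lia, key 2 (by lia) (by lia), by simpa [sub_sub] using key 3 (by lia) (by lia)⟩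
      · exact ⟨0, by lia, key 0 (by lia) (by lia), by simpa [sub_sub] using key 1 (by lia) (by lia)⟩
  refine R.not_match_rev_even (j := j) (j' := j') (m := m + s) (n := l - 1 - s) ?_ h1 h2
  intro t ht
  have := hs' (2 * s + t) (by lia)
  push_cast at this
  convert this using 2 <;> ring

theorem overlap_eq {j j' : RelIdx P Q E} {i k : ℤ}
    (hs : ∀ t : ℕ, t ≤ 20 → j.axis x v h (i + t) = j'.axis x v h (k + t)) :
    j.relator x v h N = j'.relator x v h N ∧
      Set.range (j.axis x v h) = Set.range (j'.axis x v h) := by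
  obtain ⟨m, d, hm, hd⟩ : ∃ (m : ℤ) (d : ℕ), 2 * m = i + d ∧ d ≤ 1 :=
    ⟨(i + 1) / 2, (i % 2).toNat, by lia, by lia⟩
  have hs' : ∀ t : ℕ, t ≤ 19 → j.axis x v h (2 * m + t) = j'.axis x v h (k + d + t) := by
    intro t ht
    have := hs (d + t) (by lia)
    push_cast at this
    rwa [← add_assoc, ← hm, ← add_assoc] at this
  obtain ⟨l, hl⟩ := axis_parity (by simpa using hs' 0 (by lia))
  rw [hl] at hs'
  obtain ⟨a, ha⟩ := R.exists_unique_dvd m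
  obtain ⟨b, hb⟩ := R.exists_unique_dvd l
  obtain ⟨s, hs6, hsa, hsb⟩ : ∃ s : ℕ, s ≤ 6 ∧ (∀ t : ℕ, t ≤ 2 → (s + t : ℤ) ≠ a) ∧
      ∀ t : ℕ, t ≤ 2 → (s + t : ℤ) ≠ b := by
    by_cases h0 : (0 ≤ a ∧ a ≤ 2) ∨ (0 ≤ b ∧ b ≤ 2)
    · by_cases h3 : (3 ≤ a ∧ a ≤ 5) ∨ (3 ≤ b ∧ b ≤ 5)
      · exact ⟨6, by lia, by lia, by lia⟩
      · exact ⟨3, by lia, by lia, by lia⟩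
    · exact ⟨0, by lia, by lia, by lia⟩
  refine R.eq_of_match_same (m := m + s) (m' := l + s) (fun t ht => ?_) (fun t ht hd => ?_)
    (fun t ht hd => ?_)
  · have := hs' (2 * s + t) (by lia)
    push_cast at this
    convert this using 2 <;> ring
  · exact hsa t ht (ha _ (by lia) (by lia) (by rwa [← add_assoc]))
  · exact hsb t ht (hb _ (by lia) (by lia) (by rwa [← add_assoc]))

theorem rotFamily :
    RotFamily (J := RelIdx P Q E) (bsGraph P Q) (fun j => j.relator x v h N)
      (fun j => j.axis x v h) (2 * N) 20 where
  tree := R.amalgam.isTree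
  act := bsGraph_act
  line := R.isLine
  r_smul g j := relator_smul x v h g j
  l_smul g j i := axis_smul x v h g j i
  r_line j i := by
    have := R.axis_add_mul j i 1
    rw [zpow_one, mul_one] at this
    exact this.symm
  overlap j j' i i' hi hi' hii := by
    obtain ⟨k, hk | hk⟩ := (R.isLine j).matching R.amalgam.isTree (R.isLine j') hi hi' (by lia)
    · obtain ⟨h1, h2⟩ := R.overlap_eq (j := j) (j' := j') (i := i) (k := k)
        (fun t ht => hk t (by lia))
      exact ⟨by rw [h1], h2⟩
    · exact (R.not_match_rev (j := j) (j' := j') (i := i) (k := k)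
        (fun t ht => hk t (by lia))).elim
  one_le := by norm_num
  lt_tau := by have := R.large; lia

end RelSys

section Geometry

variable {V : Type*} {G : SimpleGraph V} {m : ℤ → V}

theorem dist_eq_of_line_separates (hT : G.IsTree) (hm : IsLine G m) {p q : V} (T : ℕ) (a : ℤ)
    (hs : ∀ i, a ≤ i → i < a + (T + 1) → p ∈ side G (m (i + 1)) (m i) ∧
      q ∈ side G (m i) (m (i + 1))) :
    G.dist p q = G.dist p (m a) + (T + 1) + G.dist (m (a + (T + 1))) q := by
  induction T generalizing p a with
  | zero =>
    obtain ⟨h1, h2⟩ := hs a le_rfl (by lia)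
    simpa using dist_eq_of_separates hT (hm.adj a) h1 h2
  | succ T ih =>
    obtain ⟨h1, h2⟩ := hs a le_rfl (by lia)
    rw [dist_eq_of_separates hT (hm.adj a) h1 h2, ih (a + 1) (fun i hi hi' =>
      ⟨hm.mem_side_of_le hT hi, (hs i (by lia) (by push_cast; lia)).2⟩)]
    rw [SimpleGraph.dist_self, show a + 1 + ((T : ℤ) + 1) = a + (((T + 1 : ℕ) : ℤ) + 1) by
      push_cast; ring]
    ring

theorem dist_line (hT : G.IsTree) (hm : IsLine G m) (a : ℤ) (T : ℕ) :
    G.dist (m a) (m (a + T)) = T := by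
  rcases T with _ | T
  · simp
  · have := dist_eq_of_line_separates hT hm (p := m a) (q := m (a + (T + 1))) T a
      (fun i hi hi' => ⟨hm.mem_side_of_le hT hi, hm.mem_side_of_lt hT hi'⟩)
    push_cast
    simpa using this

theorem dist_add_of_line (hT : G.IsTree) (hm : IsLine G m) {p : V} (b : ℤ) (T : ℕ)
    (hs : ∀ i, b ≤ i → i < b + T → p ∈ side G (m (i + 1)) (m i)) :
    G.dist p (m (b + T)) = G.dist p (m b) + T := by
  rcases T with _ | T
  · simp
  · push_cast at hs
    have := dist_eq_of_line_separates hT hm (p := p) (q := m (b + (T + 1))) T b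
      (fun i hi hi' => ⟨hs i hi hi', hm.mem_side_of_lt hT hi'⟩)
    push_cast
    simpa using this

/-- Along a line, a vertex is ahead of the edges before some point and behind the later ones. -/
theorem exists_split (hT : G.IsTree) (hm : IsLine G m) (p : V) (a : ℤ) (T : ℕ) :
    ∃ b, a ≤ b ∧ b ≤ a + T ∧ (∀ i, i < b → a < b → p ∈ side G (m i) (m (i + 1))) ∧
      ∀ i, b ≤ i → i < a + T → p ∈ side G (m (i + 1)) (m i) := by
  obtain ⟨b, ⟨h1, h2, h3⟩, hmax⟩ := Int.exists_greatest_of_bdd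
    (P := fun b => a ≤ b ∧ b ≤ a + T ∧ (a < b → p ∈ side G (m (b - 1)) (m b)))
    ⟨a + T, fun z hz => hz.2.1⟩ ⟨a, le_rfl, by lia, fun h => (lt_irrefl _ h).elim⟩
  refine ⟨b, h1, h2, fun i hi hab => ?_, fun i hi hi' => ?_⟩
  · have := hm.side_subset_of_le hT (show i ≤ b - 1 by lia)
    rw [sub_add_cancel] at this
    exact this (h3 hab)
  · refine (not_mem_side_iff hT (hm.adj i)).1 fun h => ?_
    have := hmax (i + 1) ⟨by lia, by lia, fun _ => by rwa [add_sub_cancel_right]⟩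
    lia

/-- An edge on the geodesic from `p` to `q` is determined by its distance from `p`. -/
theorem edge_unique (hT : G.IsTree) {p q u u' z z' : V} (hu : G.Adj u u') (hz : G.Adj z z')
    (hup : p ∈ side G u' u) (huq : q ∈ side G u u') (hzp : p ∈ side G z' z)
    (hzq : q ∈ side G z z') (hd : G.dist p u = G.dist p z) : u = z ∧ u' = z' := by
  have h1 := dist_eq_of_separates hT hu hup huq
  have h2 := dist_eq_of_separates hT hz hzp hzq
  rcases mem_side_or hT hu z with h | h
  · have := dist_eq_of_separates hT hu hup h
    lia
  rcases mem_side_or hT hu z' with h' | h'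
  · obtain ⟨rfl, rfl⟩ := crossing hT hu hz h h'
    exact ⟨rfl, rfl⟩
  · have := dist_eq_of_separates hT hu h' huq
    lia

theorem exists_next (hT : G.IsTree) {p w : V} (hne : p ≠ w) :
    ∃ p', G.Adj p p' ∧ w ∈ side G p p' ∧ G.dist p w = 1 + G.dist p' w := by
  obtain ⟨W, hW⟩ := hT.connected.exists_walk_length_eq_dist p w
  cases W with
  | nil => exact (hne rfl).elim
  | @cons _ p' _ hadj W =>
    rw [SimpleGraph.Walk.length_cons] at hW
    have hle := SimpleGraph.dist_le W
    have hmem : w ∈ side G p p' := by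
      rcases mem_side_or hT hadj w with h | h
      · exact h
      · have := dist_eq_of_separates hT hadj.symm (mem_side _ _) h
        lia
    refine ⟨p', hadj, hmem, ?_⟩
    have := dist_eq_of_separates hT hadj (mem_side _ _) hmem
    simpa using this

variable {A : Type*} [Group A] [MulAction A V]

theorem fixes_next (hT : G.IsTree)
    (hact : ∀ (g : A) (v w : V), G.Adj v w → G.Adj (g • v) (g • w)) {c : A} {p p' w : V}
    (hp : c • p = p) (hw : c • w = w) (hadj : G.Adj p p') (h : w ∈ side G p p') : c • p' = p' := by
  have h1 := smul_mem_side hact c h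
  rw [hp, hw] at h1
  have h2 := hact c _ _ hadj
  rw [hp] at h2
  exact (edge_unique hT hadj h2 (mem_side _ _) h (mem_side _ _) h1 rfl).2.symm

end Geometry

section RelGroup

variable {A E : Type*} [Group A]

/-- The subgroup generated by all conjugates of the relators. -/
def relGroup (P Q : Subgroup A) (N : ℕ) (x : E → A) (v h : E → ℤ → A) : Subgroup A :=
  Subgroup.closure (Set.range fun j : RelIdx P Q E => j.relator x v h N)

instance relGroup_normal (P Q : Subgroup A) (N : ℕ) (x : E → A) (v h : E → ℤ → A) :
    (relGroup P Q N x v h).Normal := by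
  constructor
  intro n hn g
  unfold relGroup at hn ⊢
  induction hn using Subgroup.closure_induction with
  | mem a ha =>
    obtain ⟨j, rfl⟩ := ha
    refine Subgroup.subset_closure ⟨g • j, ?_⟩
    exact RelIdx.relator_smul x v h g j
  | one => simp
  | mul a b _ _ ha hb =>
    rw [show g * (a * b) * g⁻¹ = (g * a * g⁻¹) * (g * b * g⁻¹) by group]
    exact Subgroup.mul_mem _ ha hb
  | inv a _ ha =>
    rw [show g * a⁻¹ * g⁻¹ = (g * a * g⁻¹)⁻¹ by group]
    exact Subgroup.inv_mem _ ha

end RelGroup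

namespace RelSys

open RelIdx

variable {A E : Type*} [Group A] {P Q : Subgroup A} {N : ℕ} {x : E → A} {v h : E → ℤ → A}
  (R : RelSys P Q N x v h)

include R

theorem eq_one_of_fixes_three {c : A} {p p₁ p₂ : (A ⧸ P) ⊕ (A ⧸ Q)} (hadj : (bsGraph P Q).Adj p p₁)
    (hadj' : (bsGraph P Q).Adj p₁ p₂) (hne : p ≠ p₂) (hp : c • p = p) (hp₁ : c • p₁ = p₁)
    (hp₂ : c • p₂ = p₂) : c = 1 := by
  have hl : ∀ g : A, c • (Sum.inl (g : A ⧸ P) : (A ⧸ P) ⊕ (A ⧸ Q)) = Sum.inl (g : A ⧸ P) →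
      g⁻¹ * c * g ∈ P := by
    intro g hg
    have := Sum.inl_injective hg
    change ((c * g : A) : A ⧸ P) = g at this
    rw [eq_comm, QuotientGroup.eq, ← mul_assoc] at this
    exact this
  have hr : ∀ g : A, c • (Sum.inr (g : A ⧸ Q) : (A ⧸ P) ⊕ (A ⧸ Q)) = Sum.inr (g : A ⧸ Q) →
      g⁻¹ * c * g ∈ Q := by
    intro g hg
    have := Sum.inr_injective hg
    change ((c * g : A) : A ⧸ Q) = g at this
    rw [eq_comm, QuotientGroup.eq, ← mul_assoc] at this
    exact this
  obtain ⟨g, ⟨rfl, rfl⟩ | ⟨rfl, rfl⟩⟩ := hadj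
  · obtain ⟨k, ⟨h1, rfl⟩ | ⟨h1, rfl⟩⟩ := hadj'
    · exact (Sum.inr_ne_inl h1).elim
    rw [Sum.inr.injEq, QuotientGroup.eq] at h1
    rw [ne_eq, Sum.inl.injEq, QuotientGroup.eq] at hne
    have := R.malQ _ h1 hne _ (hl g hp) (hr g hp₁) (by convert hl k hp₂ using 1; group)
    rw [mul_assoc, inv_mul_eq_one, eq_comm, mul_eq_right] at this
    exact this
  · obtain ⟨k, ⟨h1, rfl⟩ | ⟨h1, rfl⟩⟩ := hadj'
    · rw [Sum.inl.injEq, QuotientGroup.eq] at h1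
      rw [ne_eq, Sum.inr.injEq, QuotientGroup.eq] at hne
      have := R.malP _ h1 hne _ (hl g hp₁) (hr g hp) (by convert hr k hp₂ using 1; group)
      rw [mul_assoc, inv_mul_eq_one, eq_comm, mul_eq_right] at this
      exact this
    · exact (Sum.inl_ne_inr h1).elim

theorem eq_of_fixes {c : A} (hc : c ≠ 1) {p w : (A ⧸ P) ⊕ (A ⧸ Q)} (hp : c • p = p)
    (hw : c • w = w) (hpw : p.isLeft = w.isLeft) : p = w := by
  have hT := R.amalgam.isTree
  by_contra hne
  obtain ⟨p₁, h1, h1', d1⟩ := exists_next hT hne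
  have hne1 : p₁ ≠ w := by
    rintro rfl
    obtain ⟨g, ⟨rfl, rfl⟩ | ⟨rfl, rfl⟩⟩ := h1 <;> simp at hpw
  obtain ⟨p₂, h2, h2', d2⟩ := exists_next hT hne1
  have f1 := fixes_next hT bsGraph_act hp hw h1 h1'
  have f2 := fixes_next hT bsGraph_act f1 hw h2 h2'
  exact hc (R.eq_one_of_fixes_three h1 h2 (by rintro rfl; lia) hp f1 f2)

theorem le_dist {n : A} (hn : n ∈ relGroup P Q N x v h)
    (hn1 : n ≠ 1) (p : (A ⧸ P) ⊕ (A ⧸ Q)) : 2 * N - 80 ≤ (bsGraph P Q).dist p (n • p) := by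
  obtain ⟨j, m, a, hm, hs⟩ := R.rotFamily.longSep p hn hn1
  have hN := R.large
  have hline : IsLine (bsGraph P Q) m := by
    rcases hm with rfl | rfl
    · exact R.isLine j
    · exact (R.isLine j).rev
  have := dist_eq_of_line_separates R.amalgam.isTree hline (2 * N - 81) a
    (fun i hi hi' => hs i hi (by lia))
  lia

theorem exists_smul_eq {c : A} (hc : c ≠ 1) {p w : (A ⧸ P) ⊕ (A ⧸ Q)} (hp : c • p = p)
    (hpw : p.isLeft = w.isLeft) {n₀ : A} (hn₀ : n₀ ∈ relGroup P Q N x v h) (hw : c • w = n₀ • w) :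
    ∃ n ∈ relGroup P Q N x v h, w = n • p := by
  classical
  have hT := R.amalgam.isTree
  have hN := R.large
  have hdist := fun (g : A) a b => dist_smul hT (bsGraph_act (P := P) (Q := Q)) g a b
  have tri := fun a b c => hT.connected.dist_triangle (u := a) (v := b) (w := c)
  have hex : ∃ d, ∃ n ∈ relGroup P Q N x v h, (bsGraph P Q).dist p (n • w) = d :=
    ⟨_, 1, Subgroup.one_mem _, rfl⟩
  obtain ⟨n, hn, hnd⟩ := Nat.find_spec hex
  have hmin : ∀ n' ∈ relGroup P Q N x v h,
      (bsGraph P Q).dist p (n • w) ≤ (bsGraph P Q).dist p (n' • n • w) := by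
    intro n' hn'
    rw [hnd]
    exact Nat.find_min' hex ⟨n' * n, Subgroup.mul_mem _ hn' hn, by rw [mul_smul]⟩
  clear hnd
  have hleft : ∀ (g : A) (u : (A ⧸ P) ⊕ (A ⧸ Q)), (g • u).isLeft = u.isLeft := by
    rintro g (u | u) <;> rfl
  obtain ⟨n₁, hn₁, hw₁⟩ : ∃ n₁ ∈ relGroup P Q N x v h, c • n • w = n₁ • n • w := by
    refine ⟨c * n * c⁻¹ * n₀ * n⁻¹, Subgroup.mul_mem _ (Subgroup.mul_mem _
      ((relGroup_normal P Q N x v h).conj_mem n hn c) hn₀) (Subgroup.inv_mem _ hn), ?_⟩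
    have : c • n • w = (c * n * c⁻¹) • c • w := by simp [mul_smul]
    rw [this, hw]
    simp [mul_smul]
  have hpw' : p.isLeft = (n • w).isLeft := by rw [hleft, hpw]
  by_cases h1 : n₁ = 1
  · rw [h1, one_smul] at hw₁
    refine ⟨n⁻¹, Subgroup.inv_mem _ hn, ?_⟩
    rw [R.eq_of_fixes hc hp hw₁ hpw', inv_smul_smul]
  exfalso
  generalize n • w = z at hmin hw₁
  obtain ⟨j, m, a, hm, hs⟩ := R.rotFamily.longSep z hn₁ h1
  rw [← hw₁] at hs
  have hline : IsLine (bsGraph P Q) m := by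
    rcases hm with rfl | rfl
    · exact R.isLine j
    · exact (R.isLine j).rev
  obtain ⟨ρ, hρ, hρm⟩ : ∃ ρ ∈ relGroup P Q N x v h, ∀ i, ρ • m i = m (i + 2 * N) := by
    have hr : j.relator x v h N ∈ relGroup P Q N x v h := Subgroup.subset_closure ⟨j, rfl⟩
    rcases hm with rfl | rfl
    · exact ⟨_, hr, R.rotFamily.r_line j⟩
    · refine ⟨_, Subgroup.inv_mem _ hr, fun i => ?_⟩
      rw [inv_smul_eq_iff, R.rotFamily.r_line j, neg_add, neg_add_cancel_right]
  have hcz : (bsGraph P Q).dist p (c • z) = (bsGraph P Q).dist p z := by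
    conv_lhs => rw [← hp]
    exact hdist _ _ _
  obtain ⟨b, hab, hbT, hb1, hb2⟩ := exists_split hT hline p a (2 * N - 80)
  have claim1 : a < b → b - a ≤ N := by
    intro hlt
    obtain ⟨k, rfl⟩ : ∃ k : ℕ, b = a + (k + 1) := ⟨(b - a - 1).toNat, by lia⟩
    have e1 := dist_eq_of_line_separates hT hline (p := z) (q := p) k a
      (fun i hi hi' => ⟨(hs i hi (by lia)).1, hb1 i hi' hlt⟩)
    have e2 := tri p (m (a + (k + 1))) (ρ • z)
    have e3 := tri (m (a + (k + 1))) (m (a + 2 * N)) (ρ • z)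
    have e4 := dist_line hT hline (a + (k + 1)) (2 * N - (k + 1))
    rw [show a + ((k : ℤ) + 1) + ((2 * N - (k + 1) : ℕ) : ℤ) = a + 2 * N by lia] at e4
    rw [e4, ← hρm, hdist] at e3
    have e5 := hmin ρ hρ
    rw [SimpleGraph.dist_comm] at e1
    rw [SimpleGraph.dist_comm (u := m a)] at e3
    rw [SimpleGraph.dist_comm (u := p) (v := m (a + (k + 1)))] at e2
    lia
  have claim2 : b < a + (2 * N - 80) → a + (2 * N - 80) - b ≤ N := by
    intro hlt
    obtain ⟨k, hk⟩ : ∃ k : ℕ, a + (2 * N - 80) = b + (k + 1) :=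
      ⟨(a + (2 * N - 80) - b - 1).toNat, by lia⟩
    have e1 := dist_eq_of_line_separates hT hline (p := p) (q := c • z) k b
      (fun i hi hi' => ⟨hb2 i hi (by lia), (hs i (by lia) (by lia)).2⟩)
    have e2 := tri p (m b) (ρ⁻¹ • c • z)
    have e3 := tri (m b) (m (a - 80)) (ρ⁻¹ • c • z)
    have e4 := dist_line hT hline (a - 80) (b - a + 80).toNat
    rw [show a - 80 + ((b - a + 80).toNat : ℤ) = b by lia] at e4
    rw [SimpleGraph.dist_comm (u := m b) (v := m (a - 80)), e4] at e3
    have e6 : m (a - 80) = ρ⁻¹ • m (b + (k + 1)) := by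
      rw [eq_inv_smul_iff, hρm]
      congr 1; lia
    rw [e6, hdist] at e3
    have e5 := hmin (ρ⁻¹ * n₁) (Subgroup.mul_mem _ (Subgroup.inv_mem _ hρ) hn₁)
    rw [mul_smul, ← hw₁] at e5
    lia
  have hba : 100 ≤ b - a := by lia
  have hbT : 100 ≤ a + (2 * N - 80) - b := by lia
  have hrev : ∀ t : ℕ, t ≤ 99 → m (b + t) = c • m (b - t) ∧
      m (b + t + 1) = c • m (b - t - 1) := by
    intro t ht
    have hadj := (hline.adj (b - t - 1)).symm
    rw [sub_add_cancel] at hadj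
    have hp1 : p ∈ side (bsGraph P Q) (m (b - t - 1)) (m (b - t)) := by
      have := hb1 (b - t - 1) (by lia) (by lia)
      rwa [sub_add_cancel] at this
    have hz1 := (hs (b - t - 1) (by lia) (by lia)).1
    rw [sub_add_cancel] at hz1
    refine edge_unique hT (hline.adj (b + t)) (bsGraph_act c _ _ hadj) (p := p) (q := c • z)
      (hb2 _ (by lia) (by lia)) (hs _ (by lia) (by lia)).2 ?_ (smul_mem_side bsGraph_act c hz1) ?_
    · have := smul_mem_side bsGraph_act c hp1
      rwa [hp] at this
    · rw [dist_add_of_line hT hline b t (fun i hi hi' => hb2 i hi (by lia))]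
      conv_rhs => rw [← hp]
      rw [hdist]
      have := dist_add_of_line hT hline.rev (p := p) (-b) t (fun i hi hi' => by
        have := hb1 (-(i + 1)) (by lia) (by lia)
        rwa [show -(i + 1) + 1 = -i by ring] at this)
      rw [neg_neg, show -(-b + (t : ℤ)) = b - t by ring] at this
      exact this.symm
  rcases hm with rfl | rfl
  · refine R.not_match_rev (j := j) (j' := c • j) (i := b) (k := b) fun t ht => ?_
    exact (hrev t (by lia)).1.trans (axis_smul x v h c j _).symm
  · refine R.not_match_rev (j := c • j) (j' := j) (i := -b) (k := -b) fun t ht => ?_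
    rw [axis_smul]
    have := (hrev t (by lia)).1
    beta_reduce at this
    rw [show -(b + (t : ℤ)) = -b - t by ring, show -(b - (t : ℤ)) = -b + t by ring] at this
    exact this.symm

end RelSys

/-- A sequence is injective and its consecutive quotients are distinct. -/
def SidonSeq {G : Type*} [Group G] {N : ℕ} (h : Fin N → G) : Prop :=
  Function.Injective h ∧ ∀ (a b : ℕ) (ha : a + 1 < N) (hb : b + 1 < N),
    h ⟨a + 1, ha⟩ * (h ⟨a, by lia⟩)⁻¹ = h ⟨b + 1, hb⟩ * (h ⟨b, by lia⟩)⁻¹ → a = b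

section Extend

variable {A E : Type*} [Group A] {P Q : Subgroup A} {N : ℕ} {x : E → A} {v h : E → ℤ → A}

theorem disp_mul (hT : (bsGraph P Q).IsTree) (p : (A ⧸ P) ⊕ (A ⧸ Q)) (a b : A) :
    (bsGraph P Q).dist p ((a * b) • p) ≤
      (bsGraph P Q).dist p (a • p) + (bsGraph P Q).dist p (b • p) := by
  refine (hT.connected.dist_triangle (v := a • p)).trans ?_
  rw [mul_smul, dist_smul hT bsGraph_act]

theorem disp_of_memP {a : A} (ha : a ∈ P) :
    (bsGraph P Q).dist (Sum.inl ((1 : A) : A ⧸ P)) (a • Sum.inl ((1 : A) : A ⧸ P)) = 0 := by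
  have : a • (Sum.inl ((1 : A) : A ⧸ P) : (A ⧸ P) ⊕ (A ⧸ Q)) = Sum.inl ((1 : A) : A ⧸ P) := by
    change Sum.inl (((a * 1 : A)) : A ⧸ P) = _
    rw [Sum.inl.injEq, eq_comm, QuotientGroup.eq]
    simpa using ha
  rw [this, SimpleGraph.dist_self]

theorem disp_of_memQ (hT : (bsGraph P Q).IsTree) {a : A} (ha : a ∈ Q) :
    (bsGraph P Q).dist (Sum.inl ((1 : A) : A ⧸ P)) (a • Sum.inl ((1 : A) : A ⧸ P)) ≤ 2 := by
  have h1 := bsGraph_adj (P := P) (Q := Q) 1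
  have h2 := bsGraph_act a _ _ h1.symm
  have : a • (Sum.inr ((1 : A) : A ⧸ Q) : (A ⧸ P) ⊕ (A ⧸ Q)) = Sum.inr ((1 : A) : A ⧸ Q) := by
    change Sum.inr (((a * 1 : A)) : A ⧸ Q) = _
    rw [Sum.inr.injEq, eq_comm, QuotientGroup.eq]
    simpa using ha
  rw [this] at h2
  refine (hT.connected.dist_triangle (v := Sum.inr ((1 : A) : A ⧸ Q))).trans ?_
  rw [SimpleGraph.dist_eq_one_iff_adj.2 h1, SimpleGraph.dist_eq_one_iff_adj.2 h2]

theorem RelSys.eq_one_of_disp (R : RelSys P Q N x v h) {n : A} (hn : n ∈ relGroup P Q N x v h)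
    (hd : (bsGraph P Q).dist (Sum.inl ((1 : A) : A ⧸ P)) (n • Sum.inl ((1 : A) : A ⧸ P)) ≤ 100) :
    n = 1 := by
  by_contra h1
  have := R.le_dist hn h1 (Sum.inl ((1 : A) : A ⧸ P))
  have := R.large
  lia

theorem RelSys.malnormal_map_inl (R : RelSys P Q N x v h) :
    Malnormal (P.map (QuotientGroup.mk' (relGroup P Q N x v h))) := by
  intro g hg y hy hgy
  obtain ⟨a, rfl⟩ := QuotientGroup.mk'_surjective _ g
  obtain ⟨c, hc, rfl⟩ := hy
  obtain ⟨c', hc', he⟩ := hgy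
  by_contra hc1
  have hne : c ≠ 1 := by
    rintro rfl
    exact hc1 (map_one _)
  rw [← map_inv, ← map_mul, ← map_mul, QuotientGroup.mk'_apply, QuotientGroup.mk'_apply, eq_comm,
    QuotientGroup.eq] at he
  have hfix : c • (Sum.inl ((1 : A) : A ⧸ P) : (A ⧸ P) ⊕ (A ⧸ Q)) = Sum.inl ((1 : A) : A ⧸ P) := by
    change Sum.inl (((c * 1 : A)) : A ⧸ P) = _
    rw [Sum.inl.injEq, eq_comm, QuotientGroup.eq]
    simpa using hc
  obtain ⟨n, hn, hw⟩ := R.exists_smul_eq hne (w := Sum.inl (a : A ⧸ P)) hfix rfl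
    ((relGroup_normal P Q N x v h).conj_mem _ (Subgroup.inv_mem _ he) (c * a)) (by
      change Sum.inl (((c * a : A)) : A ⧸ P) = Sum.inl (((_ * a : A)) : A ⧸ P)
      rw [Sum.inl.injEq, QuotientGroup.eq]
      have : (c * a)⁻¹ * (c * a * ((a⁻¹ * c * a)⁻¹ * c')⁻¹ * (c * a)⁻¹ * a) = c'⁻¹ := by group
      rw [this]
      exact P.inv_mem hc')
  change Sum.inl (a : A ⧸ P) = Sum.inl (((n * 1 : A)) : A ⧸ P) at hw
  rw [Sum.inl.injEq, eq_comm, QuotientGroup.eq, mul_one] at hw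
  refine hg ⟨_, hw, ?_⟩
  rw [map_mul, QuotientGroup.mk'_apply, QuotientGroup.mk'_apply,
    (QuotientGroup.eq_one_iff _).2 (Subgroup.inv_mem _ hn), one_mul]

theorem RelSys.malnormal_map_inr (R : RelSys P Q N x v h) :
    Malnormal (Q.map (QuotientGroup.mk' (relGroup P Q N x v h))) := by
  intro g hg y hy hgy
  obtain ⟨a, rfl⟩ := QuotientGroup.mk'_surjective _ g
  obtain ⟨c, hc, rfl⟩ := hy
  obtain ⟨c', hc', he⟩ := hgy
  by_contra hc1
  have hne : c ≠ 1 := by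
    rintro rfl
    exact hc1 (map_one _)
  rw [← map_inv, ← map_mul, ← map_mul, QuotientGroup.mk'_apply, QuotientGroup.mk'_apply, eq_comm,
    QuotientGroup.eq] at he
  have hfix : c • (Sum.inr ((1 : A) : A ⧸ Q) : (A ⧸ P) ⊕ (A ⧸ Q)) = Sum.inr ((1 : A) : A ⧸ Q) := by
    change Sum.inr (((c * 1 : A)) : A ⧸ Q) = _
    rw [Sum.inr.injEq, eq_comm, QuotientGroup.eq]
    simpa using hc
  obtain ⟨n, hn, hw⟩ := R.exists_smul_eq hne (w := Sum.inr (a : A ⧸ Q)) hfix rfl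
    ((relGroup_normal P Q N x v h).conj_mem _ (Subgroup.inv_mem _ he) (c * a)) (by
      change Sum.inr (((c * a : A)) : A ⧸ Q) = Sum.inr (((_ * a : A)) : A ⧸ Q)
      rw [Sum.inr.injEq, QuotientGroup.eq]
      have : (c * a)⁻¹ * (c * a * ((a⁻¹ * c * a)⁻¹ * c')⁻¹ * (c * a)⁻¹ * a) = c'⁻¹ := by group
      rw [this]
      exact Q.inv_mem hc')
  change Sum.inr (a : A ⧸ Q) = Sum.inr (((n * 1 : A)) : A ⧸ Q) at hw
  rw [Sum.inr.injEq, eq_comm, QuotientGroup.eq, mul_one] at hw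
  refine hg ⟨_, hw, ?_⟩
  rw [map_mul, QuotientGroup.mk'_apply, QuotientGroup.mk'_apply,
    (QuotientGroup.eq_one_iff _).2 (Subgroup.inv_mem _ hn), one_mul]

end Extend

section Residue

variable {G : Type*} {N : ℕ}

/-- The periodic extension of a finite sequence. -/
def periodic (hN : 0 < N) (h : Fin N → G) (m : ℤ) : G :=
  h ⟨(m % N).toNat, by
    have := Int.emod_nonneg m (show (N : ℤ) ≠ 0 by lia)
    have := Int.emod_lt_of_pos m (show (0 : ℤ) < N by lia)
    lia⟩

theorem periodic_add (hN : 0 < N) (h : Fin N → G) (m : ℤ) :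
    periodic hN h (m + N) = periodic hN h m := by
  simp [periodic]

theorem periodic_natCast (hN : 0 < N) (h : Fin N → G) (j : Fin N) :
    periodic hN h ((j : ℕ) : ℤ) = h j := by
  have : (((j : ℕ) : ℤ) % N).toNat = j := by
    rw [Int.emod_eq_of_lt (by lia) (by have := j.2; lia)]
    simp
  simp [periodic, this]

theorem emod_add_one {m : ℤ} (hN : 0 < N) (hm : ¬ (N : ℤ) ∣ m + 1) :
    (m + 1) % N = m % N + 1 ∧ m % N + 1 < N := by
  have h0 := Int.emod_nonneg m (show (N : ℤ) ≠ 0 by lia)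
  have h1 := Int.emod_lt_of_pos m (show (0 : ℤ) < N by lia)
  have h2 : m % N + 1 ≠ N := fun h => hm ((Int.dvd_iff_emod_eq_zero).2 (by
    rw [← Int.emod_add_emod, h, Int.emod_self]))
  refine ⟨?_, by lia⟩
  rw [← Int.emod_add_emod, Int.emod_eq_of_lt (by lia) (by lia)]

theorem SidonSeq.periodic_ne [Group G] {h : Fin N → G} (hs : SidonSeq h) (hN : 1 < N) (m : ℤ) :
    periodic (by lia) h m ≠ periodic (by lia) h (m + 1) := by
  intro he
  have h0 := Int.emod_nonneg m (show (N : ℤ) ≠ 0 by lia)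
  have h1 := Int.emod_nonneg (m + 1) (show (N : ℤ) ≠ 0 by lia)
  have := Fin.mk.inj_iff.1 (hs.1 he)
  have h2 : m % N = (m + 1) % N := by lia
  have h3 : (N : ℤ) ∣ m + 1 - m := Int.ModEq.dvd h2
  rw [add_sub_cancel_left] at h3
  have := Int.le_of_dvd one_pos h3
  lia

theorem SidonSeq.periodic_sidon [Group G] {h : Fin N → G} (hs : SidonSeq h) (hN : 0 < N)
    {m m' : ℤ} (hm : ¬ (N : ℤ) ∣ m + 1) (hm' : ¬ (N : ℤ) ∣ m' + 1)
    (he : periodic hN h (m + 1) * (periodic hN h m)⁻¹ =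
      periodic hN h (m' + 1) * (periodic hN h m')⁻¹) : (N : ℤ) ∣ m' - m := by
  obtain ⟨h1, h2⟩ := emod_add_one hN hm
  obtain ⟨h1', h2'⟩ := emod_add_one hN hm'
  have h0 := Int.emod_nonneg m (show (N : ℤ) ≠ 0 by lia)
  have h0' := Int.emod_nonneg m' (show (N : ℤ) ≠ 0 by lia)
  have e : ((m + 1) % N).toNat = (m % N).toNat + 1 := by lia
  have e' : ((m' + 1) % N).toNat = (m' % N).toNat + 1 := by lia
  have := hs.2 (m % N).toNat (m' % N).toNat (by lia) (by lia) (by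
    simpa only [periodic, e, e'] using he)
  exact Int.ModEq.dvd (show m % N = m' % N by lia)

theorem prod_map_range_head {G : Type*} [Monoid G] (w : G) (F : ℕ → G) (n : ℕ) :
    ((List.range (n + 1)).map fun j => (if j = 0 then w else 1) * F j).prod =
      w * ((List.range (n + 1)).map F).prod := by
  induction n with
  | zero => simp
  | succ n ih =>
    rw [List.range_succ, List.map_append, List.prod_append, ih, List.map_append, List.prod_append]
    simp [mul_assoc]

theorem ofFn_eq_map_range {G : Type*} (F : ℕ → G) (n : ℕ) :
    (List.ofFn fun j : Fin n => F j) = (List.range n).map F := by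
  apply List.ext_getElem <;> simp

end Residue

/-- Adjoining to an amalgam the relations `∏ (x * h j * y) = u`, for all `y` in one factor
outside the amalgamated subgroup. -/
theorem exists_extension {H P L : Type u} [Group H] [Group P] [Group L] (φ : H →* P) (ψ : H →* L)
    (hφ : Function.Injective φ) (hψ : Function.Injective ψ) (mφ : Malnormal φ.range)
    (mψ : Malnormal ψ.range) {N : ℕ} (hN : 1000 ≤ N) {E : Type*} (x : E → P) (h : E → Fin N → H)
    (w : E → H) (hx : ∀ e, x e ∉ φ.range) (hs : ∀ e, SidonSeq (h e))
    (hc : ∀ e e' c c', φ c * x e * φ c' = x e' → e = e') :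
    ∃ (L' : Type u) (_ : Group L') (f : P →* L') (g : L →* L'), Function.Injective f ∧
      Function.Injective g ∧ (∀ c, f (φ c) = g (ψ c)) ∧
      (∀ a b, f a = g b → ∃ c, a = φ c ∧ b = ψ c) ∧ Malnormal f.range ∧ Malnormal g.range ∧
      f.range ⊔ g.range = ⊤ ∧
      (∀ a a' c c', a ∉ φ.range → c ∉ ψ.range → c' ∉ ψ.range → g c * f a * g c' ≠ f a') ∧
      ∀ e y, y ∉ ψ.range →
        (List.ofFn fun j => f (x e) * f (φ (h e j)) * g y).prod = f (φ (w e)) := by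
  obtain ⟨A, _, f, g, hf, hg, hfg, hinter, hA⟩ := exists_isAmalgam φ ψ hφ hψ
  have hN0 : 0 < N := by lia
  have memP : ∀ c, f (φ c) ∈ f.range := fun c => ⟨_, rfl⟩
  have memQ : ∀ c, f (φ c) ∈ g.range := fun c => ⟨ψ c, (hfg c).symm⟩
  have outP : ∀ a, f a ∈ g.range → a ∈ φ.range := by
    rintro a ⟨b, hb⟩
    obtain ⟨c, rfl, -⟩ := hinter a b hb.symm
    exact ⟨c, rfl⟩
  have outQ : ∀ b, g b ∈ f.range → b ∈ ψ.range := by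
    rintro b ⟨a, ha⟩
    obtain ⟨c, -, rfl⟩ := hinter a b ha
    exact ⟨c, rfl⟩
  set v : E → ℤ → A := fun e m => if (N : ℤ) ∣ m then (f (φ (w e)))⁻¹ else 1 with hv
  set k : E → ℤ → A := fun e m => f (φ (periodic hN0 (h e) m)) with hk
  have R : RelSys f.range g.range N (fun e => f (x e)) v k := by
    refine ⟨hA, ?_, ?_, fun e => ⟨_, rfl⟩, fun e he => hx e (outP _ he), ?_, ?_, fun e m => memP _,
      fun e m => memQ _, ?_, ?_, ?_, ?_, ?_, ?_, hN⟩
    · rintro _ ⟨p, rfl⟩ hp _ ⟨c, rfl⟩ hcQ hpc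
      rw [← map_inv, ← map_mul, ← map_mul] at hpc
      rw [mφ p (fun ⟨d, hd⟩ => hp (hd ▸ memQ d)) c (outP _ hcQ) (outP _ hpc), map_one]
    · rintro _ ⟨q, rfl⟩ hq _ hcP ⟨c, rfl⟩ hqc
      rw [← map_inv, ← map_mul, ← map_mul] at hqc
      rw [mψ q (fun ⟨d, hd⟩ => hq (hd ▸ hfg d ▸ memP d)) c (outQ _ hcP) (outQ _ hqc), map_one]
    · intro e m
      simp only [hv]
      split_ifs
      · exact inv_mem (memP _)
      · exact one_mem _
    · intro e m
      simp only [hv]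
      split_ifs
      · exact inv_mem (memQ _)
      · exact one_mem _
    · intro e m
      simp [hv]
    · intro e m
      simp only [hk, periodic_add]
    · intro e m hm
      simp [hv, hm]
    · intro e m he
      exact (hs e).periodic_ne (by lia) m (hφ (hf he))
    · intro e m m' hm hm' he
      refine (hs e).periodic_sidon hN0 hm hm' (hφ (hf ?_))
      simpa only [hk, map_mul, map_inv] using he
    · rintro e e' _ _ ⟨c, rfl⟩ hcQ ⟨c', rfl⟩ hcQ' he
      obtain ⟨d, rfl⟩ := outP _ hcQ
      obtain ⟨d', rfl⟩ := outP _ hcQ'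
      exact hc e e' d d' (hf (by simpa only [map_mul] using he))
  have hT := hA.isTree
  set K := relGroup f.range g.range N (fun e => f (x e)) v k with hK
  have key : ∀ a b : A, QuotientGroup.mk' K a = QuotientGroup.mk' K b →
      (bsGraph f.range g.range).dist (Sum.inl ((1 : A) : A ⧸ f.range))
        ((a⁻¹ * b) • Sum.inl ((1 : A) : A ⧸ f.range)) ≤ 100 → a = b := by
    intro a b hab hd
    rw [QuotientGroup.mk'_apply, QuotientGroup.mk'_apply, QuotientGroup.eq] at hab
    exact inv_mul_eq_one.1 (R.eq_one_of_disp hab hd)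
  refine ⟨A ⧸ K, inferInstance, (QuotientGroup.mk' K).comp f, (QuotientGroup.mk' K).comp g,
    fun a b hab => hf (key _ _ hab ?_), fun a b hab => hg (key _ _ hab ?_), fun c => ?_,
    fun a b hab => hinter a b (key _ _ hab ?_), ?_, ?_, ?_, fun a a' c c' ha hc hc' he => ?_,
    fun e y hy => ?_⟩
  · rw [disp_of_memP (mul_mem (inv_mem (show f a ∈ f.range from ⟨a, rfl⟩)) ⟨b, rfl⟩)]
    lia
  · exact (disp_of_memQ hT (mul_mem (inv_mem (show g a ∈ g.range from ⟨a, rfl⟩)) ⟨b, rfl⟩)).trans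
      (by lia)
  · simp [hfg]
  · refine (disp_mul hT _ _ _).trans ?_
    have h1 := disp_of_memP (Q := g.range) (inv_mem (show f a ∈ f.range from ⟨a, rfl⟩))
    have h2 := disp_of_memQ hT (show g b ∈ g.range from ⟨b, rfl⟩)
    lia
  · rw [MonoidHom.range_comp]
    exact R.malnormal_map_inl
  · rw [MonoidHom.range_comp]
    exact R.malnormal_map_inr
  · rw [MonoidHom.range_comp, MonoidHom.range_comp, ← Subgroup.map_sup, hA.gen,
      Subgroup.map_top_of_surjective _ (QuotientGroup.mk'_surjective _)]
  · have h1 : g c * f a * g c' = f a' := by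
      refine key _ _ (by simpa using he) ?_
      have e1 := disp_mul hT (Sum.inl ((1 : A) : A ⧸ f.range)) ((g c * f a * g c')⁻¹) (f a')
      have e2 := disp_mul hT (Sum.inl ((1 : A) : A ⧸ f.range)) ((g c')⁻¹ * (f a)⁻¹) (g c)⁻¹
      have e3 := disp_mul hT (Sum.inl ((1 : A) : A ⧸ f.range)) (g c')⁻¹ (f a)⁻¹
      have d1 := disp_of_memP (Q := g.range) (show f a' ∈ f.range from ⟨a', rfl⟩)
      have d2 := disp_of_memP (Q := g.range) (inv_mem (show f a ∈ f.range from ⟨a, rfl⟩))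
      have d3 := disp_of_memQ hT (inv_mem (show g c ∈ g.range from ⟨c, rfl⟩))
      have d4 := disp_of_memQ hT (inv_mem (show g c' ∈ g.range from ⟨c', rfl⟩))
      rw [show (g c * f a * g c')⁻¹ = (g c')⁻¹ * (f a)⁻¹ * (g c)⁻¹ by group] at e1 ⊢
      lia
    have h2 : AltWord f.range g.range false (1 * g c * f a * g c') :=
      .right (.left (.right .nil ⟨c, rfl⟩ fun h => hc (outQ _ h)) ⟨a, rfl⟩ fun h => ha (outP _ h))
        ⟨c', rfl⟩ fun h => hc' (outQ _ h)
    refine hA.not_mem _ h2 ?_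
    rw [one_mul, h1]
    exact ⟨a', rfl⟩
  · obtain ⟨n, rfl⟩ : ∃ n, N = n + 1 := ⟨N - 1, by lia⟩
    let j : RelIdx f.range g.range E := ⟨1, e, g y, ⟨y, rfl⟩, fun h => hy (outQ _ h)⟩
    have hj : j.relator (fun e => f (x e)) v k (n + 1) ∈ K := Subgroup.subset_closure ⟨j, rfl⟩
    have hj' : j.relator (fun e => f (x e)) v k (n + 1) = (f (φ (w e)))⁻¹ *
        ((List.range (n + 1)).map fun i : ℕ => f (x e) * k e (i : ℤ) * g y).prod := by
      rw [← prod_map_range_head, RelIdx.relator, intProd_natCast]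
      simp only [j, one_mul, inv_one, mul_one]
      congr 1
      refine List.map_congr_left fun i hi => ?_
      rw [List.mem_range] at hi
      have : ((n + 1 : ℕ) : ℤ) ∣ (i : ℤ) ↔ i = 0 := by
        rw [Int.natCast_dvd_natCast]
        exact ⟨fun h => Nat.eq_zero_of_dvd_of_lt h hi, fun h => h ▸ dvd_zero _⟩
      simp only [RelIdx.letter, hv, this, mul_assoc]
    rw [hj'] at hj
    have h3 : QuotientGroup.mk' K ((List.range (n + 1)).map
        fun i : ℕ => f (x e) * k e (i : ℤ) * g y).prod = QuotientGroup.mk' K (f (φ (w e))) := by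
      rw [eq_comm, QuotientGroup.mk'_apply, QuotientGroup.mk'_apply, QuotientGroup.eq]
      exact hj
    rw [← ofFn_eq_map_range, map_list_prod, List.map_ofFn] at h3
    refine Eq.trans ?_ h3
    congr 2
    funext i
    simp [hk, periodic_natCast]

section Limit

variable {X : ℕ → Type u} [∀ k, Group (X k)] (g : ∀ k, X k →* X (k + 1))

/-- The composite transition maps of a sequence of groups. -/
noncomputable def transition (i : ℕ) : ∀ j, i ≤ j → X i →* X j :=
  fun _ h => Nat.leRec (motive := fun j _ => X i →* X j) (MonoidHom.id _)
    (fun j _ φ => (g j).comp φ) h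

theorem transition_self (i : ℕ) : transition g i i le_rfl = MonoidHom.id _ :=
  Nat.leRec_self _ _

theorem transition_succ (i j : ℕ) (h : i ≤ j) :
    transition g i (j + 1) (h.trans j.le_succ) = (g j).comp (transition g i j h) :=
  Nat.leRec_succ _ _ _

theorem transition_trans (i j k : ℕ) (hij : i ≤ j) (hjk : j ≤ k) :
    (transition g j k hjk).comp (transition g i j hij) = transition g i k (hij.trans hjk) := by
  induction k, hjk using Nat.le_induction with
  | base => rw [transition_self, MonoidHom.id_comp]
  | succ k hjk ih =>
    rw [transition_succ g j k hjk, transition_succ g i k (hij.trans hjk), ← ih,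
        MonoidHom.comp_assoc]

theorem transition_injective (hg : ∀ k, Function.Injective (g k)) (i j : ℕ) (h : i ≤ j) :
    Function.Injective (transition g i j h) := by
  induction j, h using Nat.le_induction with
  | base =>
    rw [transition_self]
    exact Function.injective_id
  | succ j h ih =>
    rw [transition_succ g i j h]
    exact (hg j).comp ih

/-- The union of an increasing sequence of groups. -/
theorem exists_limit (hg : ∀ k, Function.Injective (g k)) :
    ∃ (K : Type u) (_ : Group K) (j : ∀ k, X k →* K), (∀ k, Function.Injective (j k)) ∧
      (∀ k, (j (k + 1)).comp (g k) = j k) ∧ ∀ z, ∃ k x, j k x = z := by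
  have : DirectedSystem X (transition g · · ·) :=
    ⟨fun i x => by rw [transition_self]; rfl,
     fun {k} {j} {i} hij hjk x => by rw [← transition_trans g i j k hij hjk]; rfl⟩
  refine ⟨DirectLimit X (transition g), inferInstance,
    fun k => MonoidHom.mk' (fun x => ⟦⟨k, x⟩⟧) fun a b => (DirectLimit.mul_def _ _ _).symm,
    fun k => DirectLimit.mk_injective _ (transition_injective g hg) k, fun k => ?_, fun z => ?_⟩
  · ext x
    have := DirectLimit.mk_apply (f := transition g) k (k + 1) x k.le_succ
    rw [transition_succ g k k le_rfl, transition_self] at this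
    exact this
  · obtain ⟨k, x, rfl⟩ := DirectLimit.exists_eq_mk _ z
    exact ⟨k, x, rfl⟩

end Limit

theorem countable_closure {G : Type*} [Group G] {s : Set G} (hs : s.Countable) :
    Countable (Subgroup.closure s) := by
  have := hs.to_subtype
  have : Countable (FreeGroup s) := by
    unfold FreeGroup
    infer_instance
  have : (Subgroup.closure s : Set G) = Set.range (FreeGroup.lift ((↑) : s → G)) := by
    rw [← MonoidHom.coe_range, FreeGroup.range_lift_eq_closure, Subtype.range_coe]
  have h2 : (Subgroup.closure s : Set G).Countable := this ▸ Set.countable_range _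
  exact h2.to_subtype

theorem countable_of_sup_eq_top {P L K : Type*} [Group P] [Group L] [Group K] [Countable P]
    [Countable L] (f : P →* K) (g : L →* K) (h : f.range ⊔ g.range = ⊤) : Countable K := by
  rw [Subgroup.sup_eq_closure] at h
  have := countable_closure (s := (f.range : Set K) ∪ g.range)
    ((Set.countable_range f).union (Set.countable_range g))
  rw [h] at this
  exact (Subgroup.topEquiv (G := K)).symm.toEquiv.countable_iff.2 this

theorem _root_.Malnormal.eq_one_of_mul_eq {G : Type*} [Group G] {K : Subgroup G} (hK : Malnormal K)
    {g y z : G} (hg : g ∉ K) (hy : y ∈ K) (hz : z ∈ K) (h : y * g = g * z) : y = 1 :=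
  hK g hg y hy (by rwa [mul_assoc, h, inv_mul_cancel_left])

theorem malnormal_of_mul_eq {G : Type*} [Group G] {K : Subgroup G}
    (h : ∀ g y z : G, g ∉ K → y ∈ K → z ∈ K → y * g = g * z → y = 1) : Malnormal K :=
  fun g hg y hy hz => h g y _ hg hy hz (by group)

/-- A countable group containing a given one as a malnormal subgroup. -/
structure Over (H : Type) [Group H] where
  carrier : Type
  [grp : Group carrier]
  [ctb : Countable carrier]
  incl : H →* carrier
  inj : Function.Injective incl
  mal : Malnormal incl.range

attribute [instance] Over.grp Over.ctb

/-- The integers, over a trivial group. -/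
def Over.base (H : Type) [Group H] (h : ∀ a : H, a = 1) : Over H where
  carrier := Multiplicative ℤ
  incl := 1
  inj a b _ := by rw [h a, h b]
  mal := by
    rintro g - y ⟨a, rfl⟩ -
    rfl

theorem Over.exists_next {G : Type} [Group G] [Countable G] {H P : Subgroup G} (hHP : H ≤ P)
    (mH : Malnormal H) {N : ℕ} (hN : 1000 ≤ N) (D : Set (G × (Fin N → G) × G))
    (hD : ∀ d ∈ D, d.1 ∈ P ∧ d.1 ∉ H ∧ (∀ j, d.2.1 j ∈ H) ∧ d.2.2 ∈ H ∧ SidonSeq d.2.1)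
    (hcos : ∀ d ∈ D, ∀ d' ∈ D, ∀ c ∈ H, ∀ c' ∈ H, c * d.1 * c' = d'.1 → d = d') (L : Over H) :
    ∃ (L' : Over P) (g : L.carrier →* L'.carrier), Function.Injective g ∧
      (∀ c, L'.incl (Subgroup.inclusion hHP c) = g (L.incl c)) ∧
      (∀ a b, L'.incl a = g b → ∃ c, a = Subgroup.inclusion hHP c ∧ b = L.incl c) ∧
      Malnormal g.range ∧
      (∀ (a a' : P) (c c' : L.carrier), (a : G) ∉ H → c ∉ L.incl.range → c' ∉ L.incl.range →
        g c * L'.incl a * g c' ≠ L'.incl a') ∧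
      ∀ d ∈ D, ∀ (x : P) (h : Fin N → P) (w : P), (x : G) = d.1 → (∀ j, (h j : G) = d.2.1 j) →
        (w : G) = d.2.2 → ∀ y, y ∉ L.incl.range →
          (List.ofFn fun j => L'.incl x * L'.incl (h j) * g y).prod = L'.incl w := by
  have hr : ∀ a : P, a ∈ (Subgroup.inclusion hHP).range ↔ (a : G) ∈ H := by
    intro a
    constructor
    · rintro ⟨b, rfl⟩
      exact b.2
    · exact fun ha => ⟨⟨a, ha⟩, rfl⟩
  obtain ⟨L', _, f, g, hf, hg, hc, hi, mf, mg, hsup, hs5, hrel⟩ :=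
    exists_extension (Subgroup.inclusion hHP) L.incl (Subgroup.inclusion_injective _) L.inj
      (malnormal_of_mul_eq fun a y z ha hy hz h => by
        rw [hr] at ha hy hz
        exact Subtype.ext (mH.eq_one_of_mul_eq ha hy hz (congrArg Subtype.val h)))
      L.mal hN (E := D) (fun d => ⟨d.1.1, (hD d.1 d.2).1⟩)
      (fun d j => ⟨d.1.2.1 j, (hD d.1 d.2).2.2.1 j⟩) (fun d => ⟨d.1.2.2, (hD d.1 d.2).2.2.2.1⟩)
      (fun d => by
        rw [hr]
        exact (hD d.1 d.2).2.1)
      (fun d => by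
        obtain ⟨h1, h2⟩ := (hD d.1 d.2).2.2.2.2
        exact ⟨fun a b hab => h1 (congrArg Subtype.val hab),
          fun a b ha hb hab => h2 a b ha hb (congrArg Subtype.val hab)⟩)
      (fun d d' c c' h => Subtype.ext
        (hcos d.1 d.2 d'.1 d'.2 c c.2 c' c'.2 (congrArg Subtype.val h)))
  have := countable_of_sup_eq_top f g hsup
  refine ⟨⟨L', f, hf, mf⟩, g, hg, hc, hi, mg, fun a a' c c' ha hc hc' =>
    hs5 a a' c c' (by rwa [hr]) hc hc', fun d hd x h w hx hh hw y hy => ?_⟩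
  have := hrel ⟨d, hd⟩ y hy
  have e1 : x = ⟨d.1, (hD d hd).1⟩ := Subtype.ext hx
  have e2 : h = fun j => Subgroup.inclusion hHP ⟨d.2.1 j, (hD d hd).2.2.1 j⟩ :=
    funext fun j => Subtype.ext (hh j)
  have e3 : w = Subgroup.inclusion hHP ⟨d.2.2, (hD d hd).2.2.2.1⟩ := Subtype.ext hw
  rw [e1, e2, e3]
  exact this

/-- Extending a countable group with a filtration by malnormal subgroups. -/
theorem exists_step {G : Type} [Group G] [Countable G] (H : ℕ → Subgroup G) (H0 : H 0 = ⊥)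
    (hmono : Monotone H) (hH : ∀ a, ∃ k, a ∈ H k) (mH : ∀ k, Malnormal (H k)) {N : ℕ}
    (hN : 1000 ≤ N) (D : ℕ → Set (G × (Fin N → G) × G))
    (hD : ∀ k, ∀ d ∈ D k, d.1 ∈ H (k + 1) ∧ d.1 ∉ H k ∧ (∀ j, d.2.1 j ∈ H k) ∧ d.2.2 ∈ H k ∧
      SidonSeq d.2.1)
    (hcos : ∀ k, ∀ d ∈ D k, ∀ d' ∈ D k, ∀ c ∈ H k, ∀ c' ∈ H k, c * d.1 * c' = d'.1 → d = d') :
    ∃ (K : Type) (_ : Group K) (ι : G →* K) (L : ℕ → Subgroup K), Countable K ∧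
      Function.Injective ι ∧ Monotone L ∧ (∀ z, ∃ k, z ∈ L k) ∧ (∀ k a, ι a ∈ L k ↔ a ∈ H k) ∧
      (∀ k, Malnormal (L k)) ∧ Malnormal ι.range ∧
      (∀ k, ∀ c ∈ L k, ∀ c' ∈ L k, c ∉ ι.range → c' ∉ ι.range → ∀ a ∈ H (k + 1), a ∉ H k →
        ∀ a', c * ι a * c' ≠ ι a') ∧
      (∀ k, ∀ d ∈ D k, ∀ y ∈ L k, y ∉ ι.range →
        (List.ofFn fun j => ι d.1 * ι (d.2.1 j) * y).prod = ι d.2.2) ∧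
      (ι.range : Set K)ᶜ.Infinite := by
  have hsucc : ∀ k, H k ≤ H (k + 1) := fun k => hmono k.le_succ
  obtain ⟨S, q, hS0, hq, hc, hi, mq, hs5, hrel⟩ : ∃ (S : ∀ k, Over (H k))
      (q : ∀ k, (S k).carrier →* (S (k + 1)).carrier), Infinite (S 0).carrier ∧
      (∀ k, Function.Injective (q k)) ∧
      (∀ k c, (S (k + 1)).incl (Subgroup.inclusion (hsucc k) c) = q k ((S k).incl c)) ∧
      (∀ k a b, (S (k + 1)).incl a = q k b →
        ∃ c, a = Subgroup.inclusion (hsucc k) c ∧ b = (S k).incl c) ∧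
      (∀ k, Malnormal (q k).range) ∧
      (∀ k (a a' : H (k + 1)) (c c' : (S k).carrier), (a : G) ∉ H k → c ∉ (S k).incl.range →
        c' ∉ (S k).incl.range → q k c * (S (k + 1)).incl a * q k c' ≠ (S (k + 1)).incl a') ∧
      ∀ k, ∀ d ∈ D k, ∀ (x : H (k + 1)) (h : Fin N → H (k + 1)) (w : H (k + 1)), (x : G) = d.1 →
        (∀ j, (h j : G) = d.2.1 j) → (w : G) = d.2.2 → ∀ y, y ∉ (S k).incl.range →
          (List.ofFn fun j => (S (k + 1)).incl x * (S (k + 1)).incl (h j) * q k y).prod =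
            (S (k + 1)).incl w := by
    choose next g hg hc hi mg hs5 hrel using fun k (S : Over (H k)) =>
      Over.exists_next (hsucc k) (mH k) hN (D k) (hD k) (hcos k) S
    have htriv : ∀ a : H 0, a = 1 := fun a => Subtype.ext (Subgroup.mem_bot.1 (H0 ▸ a.2))
    let S : ∀ k, Over (H k) := fun k =>
      Nat.rec (motive := fun k => Over (H k)) (Over.base _ htriv) (fun k S => next k S) k
    exact ⟨S, fun k => g k (S k), inferInstanceAs (Infinite (Multiplicative ℤ)),
      fun k => hg k (S k), fun k => hc k (S k), fun k => hi k (S k), fun k => mg k (S k),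
      fun k => hs5 k (S k), fun k => hrel k (S k)⟩
  obtain ⟨K, _, j, hj, hjc, hjs⟩ := exists_limit q hq
  have hjc' : ∀ k b, j (k + 1) (q k b) = j k b := fun k b => DFunLike.congr_fun (hjc k) b
  have hmonoL : Monotone fun k => (j k).range := by
    refine monotone_nat_of_le_succ fun k => ?_
    rintro _ ⟨b, rfl⟩
    exact ⟨q k b, hjc' k b⟩
  have hcompat : ∀ (a : G) (k m : ℕ) (hk : a ∈ H k) (hkm : k ≤ m),
      j m ((S m).incl ⟨a, hmono hkm hk⟩) = j k ((S k).incl ⟨a, hk⟩) := by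
    intro a k m hk hkm
    induction m, hkm using Nat.le_induction with
    | base => rfl
    | succ m hkm ih => rw [← ih, ← hjc' m, ← hc m]; rfl
  choose lv hlv using hH
  have hι' : ∀ a k (hk : a ∈ H k), j (lv a) ((S (lv a)).incl ⟨a, hlv a⟩) = j k
      ((S k).incl ⟨a, hk⟩) := by
    intro a k hk
    rw [← hcompat a (lv a) _ (hlv a) (le_max_left (lv a) k),
      ← hcompat a k _ hk (le_max_right (lv a) k)]
  let ι : G →* K := MonoidHom.mk' (fun a => j (lv a) ((S (lv a)).incl ⟨a, hlv a⟩)) fun a b => by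
    have ha := hmono (le_max_left (lv a) (lv b)) (hlv a)
    have hb := hmono (le_max_right (lv a) (lv b)) (hlv b)
    rw [hι' a _ ha, hι' b _ hb, hι' (a * b) _ (mul_mem ha hb), ← map_mul, ← map_mul]
    rfl
  have hι : ∀ k (a : H k), ι a = j k ((S k).incl a) := fun k a => hι' a k a.2
  have hmem : ∀ k a, ι a ∈ (j k).range ↔ a ∈ H k := by
    intro k a
    constructor
    · intro h
      have desc : ∀ m, k ≤ m → a ∈ H m → a ∈ H k := by
        intro m hm
        induction m, hm using Nat.le_induction with
        | base => exact id
        | succ m hm ih =>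
          intro ha
          obtain ⟨b, hb⟩ := hmonoL hm h
          rw [hι (m + 1) ⟨a, ha⟩, ← hjc' m] at hb
          obtain ⟨c, hc1, -⟩ := hi m _ _ (hj _ hb.symm)
          have hca : a = c := congrArg Subtype.val hc1
          exact ih (hca ▸ c.2)
      exact desc _ (le_max_left k (lv a)) (hmono (le_max_right _ _) (hlv a))
    · exact fun h => ⟨_, (hι k ⟨a, h⟩).symm⟩
  have hout : ∀ k b, j k b ∉ ι.range ↔ b ∉ (S k).incl.range := by
    intro k b
    rw [not_iff_not]
    constructor
    · rintro ⟨a, ha⟩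
      have hk := (hmem k a).1 ⟨b, ha.symm⟩
      rw [hι k ⟨a, hk⟩] at ha
      exact ⟨_, hj k ha⟩
    · rintro ⟨a, rfl⟩
      exact ⟨a, hι k a⟩
  have hrange : ∀ z : K, ∃ k, ∀ m, k ≤ m → z ∈ (j m).range := fun z => by
    obtain ⟨k, b, rfl⟩ := hjs z
    exact ⟨k, fun m hm => hmonoL hm ⟨b, rfl⟩⟩
  refine ⟨K, inferInstance, ι, fun k => (j k).range, ?_, ?_, hmonoL, fun z => ?_, hmem,
    fun k => malnormal_of_mul_eq fun g y z hg hy hz h => ?_,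
    malnormal_of_mul_eq ?_, ?_, ?_, ?_⟩
  · have : Function.Surjective fun p : Σ k, (S k).carrier => j p.1 p.2 := fun z => by
      obtain ⟨k, b, h⟩ := hjs z
      exact ⟨⟨k, b⟩, h⟩
    exact this.countable
  · intro a b hab
    have ha := hmono (le_max_left (lv a) (lv b)) (hlv a)
    have hb := hmono (le_max_right (lv a) (lv b)) (hlv b)
    have := (hι _ ⟨a, ha⟩).symm.trans (hab.trans (hι _ ⟨b, hb⟩))
    exact congrArg Subtype.val ((S _).inj (hj _ this))
  · obtain ⟨k, b, h⟩ := hjs z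
    exact ⟨k, b, h⟩
  · by_contra hy1
    have desc : ∀ m, k ≤ m → g ∈ (j m).range → g ∈ (j k).range := by
      intro m hm
      induction m, hm using Nat.le_induction with
      | base => exact id
      | succ m hm ih =>
        rintro ⟨b, rfl⟩
        obtain ⟨y', hy'⟩ := hmonoL hm hy
        obtain ⟨z', hz'⟩ := hmonoL hm hz
        by_cases hb : b ∈ (q m).range
        · obtain ⟨b', rfl⟩ := hb
          exact ih ⟨b', (hjc' m b').symm⟩
        · refine (hy1 ?_).elim
          rw [← hy', ← hz', ← hjc' m, ← hjc' m, ← map_mul, ← map_mul] at h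
          rw [← hy', ← hjc' m, (mq m).eq_one_of_mul_eq hb ⟨y', rfl⟩ ⟨z', rfl⟩ (hj _ h), map_one]
    obtain ⟨m, hm⟩ := hrange g
    exact hg (desc _ (le_max_left k m) (hm _ (le_max_right k m)))
  · rintro g _ _ hg ⟨a, rfl⟩ ⟨b, rfl⟩ h
    obtain ⟨m, hm⟩ := hrange g
    have hma := hmono (le_max_left (max (lv a) (lv b)) m)
    have ha := hma (hmono (le_max_left (lv a) (lv b)) (hlv a))
    have hb := hma (hmono (le_max_right (lv a) (lv b)) (hlv b))
    obtain ⟨g, rfl⟩ := hm _ (le_max_right (max (lv a) (lv b)) m)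
    rw [hι _ ⟨a, ha⟩, hι _ ⟨b, hb⟩, ← map_mul, ← map_mul] at h
    rw [hι _ ⟨a, ha⟩, (S _).mal.eq_one_of_mul_eq ((hout _ _).1 hg) ⟨_, rfl⟩ ⟨_, rfl⟩ (hj _ h),
      map_one]
  · rintro k _ ⟨c, rfl⟩ _ ⟨c', rfl⟩ hcι hcι' a ha hak a' h
    have h1 : a' ∈ H (k + 1) := by
      refine (hmem (k + 1) a').1 (h ▸ mul_mem (mul_mem ?_ ((hmem _ _).2 ha)) ?_)
      · exact hmonoL k.le_succ ⟨c, rfl⟩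
      · exact hmonoL k.le_succ ⟨c', rfl⟩
    rw [hι _ ⟨a, ha⟩, hι _ ⟨a', h1⟩, ← hjc' k, ← hjc' k, ← map_mul, ← map_mul] at h
    exact hs5 k ⟨a, ha⟩ ⟨a', h1⟩ c c' hak ((hout k c).1 hcι) ((hout k c').1 hcι') (hj _ h)
  · rintro k d hd _ ⟨y, rfl⟩ hy
    obtain ⟨h1, -, h2, h3, -⟩ := hD k d hd
    have := hrel k d hd ⟨d.1, h1⟩ (fun i => ⟨d.2.1 i, hsucc k (h2 i)⟩) ⟨d.2.2, hsucc k h3⟩ rfl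
      (fun _ => rfl) rfl y ((hout k y).1 hy)
    have := congrArg (j (k + 1)) this
    rw [map_list_prod, List.map_ofFn, ← hι] at this
    refine Eq.trans ?_ this
    congr 2
    funext i
    simp only [Function.comp, map_mul, hjc', ← hι]
  · have h1 : ∀ b, b ≠ 1 → j 0 b ∈ (ι.range : Set K)ᶜ := by
      intro b hb
      refine (hout 0 b).2 ?_
      rintro ⟨a, rfl⟩
      refine hb ?_
      rw [show a = 1 from Subtype.ext (Subgroup.mem_bot.1 (H0 ▸ a.2)), map_one]
    have h2 : ({1}ᶜ : Set (S 0).carrier).Infinite := (Set.finite_singleton _).infinite_compl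
    exact (h2.image ((hj 0).injOn)).mono (by
      rintro _ ⟨b, hb, rfl⟩
      exact h1 b hb)

section Tower

variable {W : Type}

/-- Names for group elements: `none` for the identity, and countably many names on each level. -/
abbrev Name (W : Type) := Option (W × ℕ)

/-- The level of a name. -/
def level (a : Name W) : WithBot W := a.elim ⊥ fun p => p.1

@[simp] theorem level_none : level (none : Name W) = ⊥ := rfl

@[simp] theorem level_some (p : W × ℕ) : level (some p : Name W) = p.1 := rfl

theorem level_eq_bot {a : Name W} : level a = ⊥ ↔ a = none := by
  cases a <;> simp

variable [LinearOrder W]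

/-- A naming of the elements of a group, compatible with the group operations. -/
structure Named {G : Type} [Group G] (nm : G → Name W) : Prop where
  inj : Function.Injective nm
  one : nm 1 = none
  mul : ∀ a b, level (nm (a * b)) ≤ max (level (nm a)) (level (nm b))
  inv : ∀ a, level (nm a⁻¹) ≤ level (nm a)

/-- The levels below `β` met by the subgroups of a filtration. -/
def levels {G : Type} [Group G] (nm : G → Name W) (β : W) (L : ℕ → Subgroup G) (k : ℕ) : Set W :=
  {γ | γ < β ∧ ∃ a ∈ L k, level (nm a) = γ}

variable {N : ℕ}

/-- The requirements on the filtration attached to level `β`. -/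
structure TowerAt {G : Type} [Group G] (τ : W → W → (ℕ → Set W) → ℕ × (Fin N → Name W) × Name W)
    (nm : G → Name W) (L : W → ℕ → Subgroup G) (β : W) : Prop where
  le : ∀ k, ∀ a ∈ L β k, level (nm a) ≤ β
  mono : Monotone (L β)
  union : ∀ a, level (nm a) ≤ β → ∃ k, a ∈ L β k
  coh : ∀ γ, γ < β → ∃ k₀, ∀ k, k₀ ≤ k → L γ k ≤ L β k
  fin : ∀ k, (levels nm β (L β) k).Finite
  sync : ∀ k γ, γ ∈ levels nm β (L β) k → ∀ b, level (nm b) ≤ γ → (b ∈ L β k ↔ b ∈ L γ k)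
  mal : ∀ k g y z, level (nm g) ≤ β → g ∉ L β k → y ∈ L β k → z ∈ L β k → y * g = g * z → y = 1
  malLt : ∀ g y z, level (nm g) = β → level (nm y) < β → level (nm z) < β → y * g = g * z → y = 1
  sep : ∀ k, ∀ c ∈ L β k, ∀ c' ∈ L β k, level (nm c) = β → level (nm c') = β →
    ∀ a ∈ L β (k + 1), a ∉ L β k → level (nm a) < β → ∀ a', level (nm a') < β → c * a * c' ≠ a'
  rel : ∀ k γ, γ ∈ levels nm β (L β) (k + 1) → γ ∉ levels nm β (L β) k →
    ∀ (x : G) (h : Fin N → G) (u : G), x ∈ L β (k + 1) → (∀ j, h j ∈ L β k) → u ∈ L β k →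
      (∀ j, level (nm (h j)) < β) → level (nm u) < β → SidonSeq h →
      nm x = some (γ, (τ β γ (levels nm β (L β))).1) →
      (∀ j, nm (h j) = (τ β γ (levels nm β (L β))).2.1 j) →
      nm u = (τ β γ (levels nm β (L β))).2.2 →
      ∀ y ∈ L β k, level (nm y) = β → (List.ofFn fun j => x * h j * y).prod = u

theorem SidonSeq.of_map {G G' : Type*} [Group G] [Group G'] (j : G' →* G) {h : Fin N → G'}
    (hs : SidonSeq fun i => j (h i)) : SidonSeq h :=
  ⟨fun a b hab => hs.1 (congrArg j hab), fun a b ha hb hab => hs.2 a b ha hb (by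
    simpa only [map_mul, map_inv] using congrArg j hab)⟩

variable {G G' : Type} [Group G] [Group G']
  {τ : W → W → (ℕ → Set W) → ℕ × (Fin N → Name W) × Name W}

theorem TowerAt.map {nm : G → Name W} {nm' : G' → Name W} {L : W → ℕ → Subgroup G}
    {L' : W → ℕ → Subgroup G'} {β : W} (T : TowerAt τ nm' L' β) (j : G' →* G)
    (hj : Function.Injective j) (hnm : ∀ a, nm (j a) = nm' a)
    (hsurj : ∀ b, level (nm b) ≤ β → ∃ a, j a = b)
    (hL : ∀ γ, γ ≤ β → ∀ k, L γ k = (L' γ k).map j) : TowerAt τ nm L β := by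
  have hL' : ∀ γ, γ ≤ β → ∀ k a, j a ∈ L γ k ↔ a ∈ L' γ k := fun γ hγ k a => by
    rw [hL γ hγ k, Subgroup.mem_map_iff_mem hj]
  have hlt : ∀ b, level (nm b) < β → ∃ a, j a = b := fun b hb => hsurj b hb.le
  have hle : ∀ k, ∀ a ∈ L β k, level (nm a) ≤ β := by
    intro k a ha
    rw [hL β le_rfl k] at ha
    obtain ⟨a, ha, rfl⟩ := ha
    rw [hnm]
    exact T.le k a ha
  have hlev : levels nm β (L β) = levels nm' β (L' β) := by
    funext k
    ext γ
    refine and_congr_right fun hγ => ⟨?_, ?_⟩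
    · rintro ⟨a, ha, h⟩
      obtain ⟨a, rfl⟩ := hsurj a (hle k a ha)
      exact ⟨a, (hL' β le_rfl k a).1 ha, hnm a ▸ h⟩
    · rintro ⟨a, ha, h⟩
      exact ⟨j a, (hL' β le_rfl k a).2 ha, (hnm a).symm ▸ h⟩
  refine ⟨hle, fun k m hkm => ?_, fun a ha => ?_, fun γ hγ => ?_, fun k => ?_,
    fun k γ hγ b hb => ?_, fun k g y z hg hgk hy hz h => ?_, fun g y z hg hy hz h => ?_,
    fun k c hc c' hc' hcl hcl' a ha hak hal a' ha' h => ?_,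
    fun k γ hγ hγ' x h u hx hh hu hhl hul hs hxn hhn hun y hy hyl => ?_⟩
  · rw [hL β le_rfl k, hL β le_rfl m]
    exact Subgroup.map_mono (T.mono hkm)
  · obtain ⟨a, rfl⟩ := hsurj a ha
    obtain ⟨k, hk⟩ := T.union a (hnm a ▸ ha)
    exact ⟨k, (hL' β le_rfl k a).2 hk⟩
  · obtain ⟨k₀, hk₀⟩ := T.coh γ hγ
    refine ⟨k₀, fun k hk => ?_⟩
    rw [hL β le_rfl k, hL γ hγ.le k]
    exact Subgroup.map_mono (hk₀ k hk)
  · rw [hlev]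
    exact T.fin k
  · have hγβ := hγ.1.le
    rw [hlev] at hγ
    obtain ⟨b, rfl⟩ := hsurj b (hb.trans (WithBot.coe_le_coe.2 hγβ))
    rw [hL' β le_rfl, hL' γ hγβ]
    exact T.sync k γ hγ b (hnm b ▸ hb)
  · obtain ⟨g, rfl⟩ := hsurj g hg
    obtain ⟨y, rfl⟩ := hsurj y (hle k y hy)
    obtain ⟨z, rfl⟩ := hsurj z (hle k z hz)
    rw [hL' β le_rfl] at hgk hy hz
    rw [hnm] at hg
    rw [← map_mul, ← map_mul] at h
    rw [T.mal k g y z hg hgk hy hz (hj h), map_one]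
  · obtain ⟨g, rfl⟩ := hsurj g hg.le
    obtain ⟨y, rfl⟩ := hlt y hy
    obtain ⟨z, rfl⟩ := hlt z hz
    rw [hnm] at hg hy hz
    rw [← map_mul, ← map_mul] at h
    rw [T.malLt g y z hg hy hz (hj h), map_one]
  · obtain ⟨c, rfl⟩ := hsurj c hcl.le
    obtain ⟨c', rfl⟩ := hsurj c' hcl'.le
    obtain ⟨a, rfl⟩ := hlt a hal
    obtain ⟨a', rfl⟩ := hlt a' ha'
    rw [hL' β le_rfl] at hc hc' ha hak
    rw [hnm] at hcl hcl' hal ha'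
    rw [← map_mul, ← map_mul] at h
    exact T.sep k c hc c' hc' hcl hcl' a ha hak hal a' ha' (hj h)
  · rw [hlev] at hγ hγ' hxn hhn hun
    obtain ⟨x, rfl⟩ := hsurj x (hle _ x hx)
    obtain ⟨u, rfl⟩ := hlt u hul
    obtain ⟨y, rfl⟩ := hsurj y hyl.le
    choose h' hh' using fun i => hlt (h i) (hhl i)
    obtain rfl : (fun i => j (h' i)) = h := funext hh'
    simp only [hL' β le_rfl, hnm] at hx hh hu hhl hul hxn hhn hun hy hyl
    rw [← T.rel k γ hγ hγ' x h' u hx hh hu hhl hul (hs.of_map j) hxn hhn hun y hy hyl,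
      map_list_prod, List.map_ofFn]
    congr 2
    funext i
    simp

end Tower

theorem exists_slow_sequence (c : ℕ → ℕ) : ∃ i : ℕ → ℕ,
    (∀ k, i (k + 1) = i k ∨ i (k + 1) = i k + 1 ∧ c (i k) ≤ k + 1) ∧ ∀ n, ∃ k, n ≤ i k := by
  let i : ℕ → ℕ := fun k => Nat.rec 0 (fun k n => if c n ≤ k + 1 then n + 1 else n) k
  have hi : ∀ k, i (k + 1) = if c (i k) ≤ k + 1 then i k + 1 else i k := fun k => rfl
  have hmono : Monotone i := monotone_nat_of_le_succ fun k => by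
    rw [hi]
    split_ifs <;> lia
  refine ⟨i, fun k => ?_, fun n => ?_⟩
  · rw [hi]
    split_ifs with h
    · exact Or.inr ⟨rfl, h⟩
    · exact Or.inl rfl
  · induction n with
    | zero => exact ⟨0, Nat.zero_le _⟩
    | succ n ih =>
      obtain ⟨k, hk⟩ := ih
      have h1 := hk.trans (hmono (le_max_left k (c n)))
      rcases h1.eq_or_lt with h | h
      · refine ⟨max k (c n) + 1, ?_⟩
        rw [hi, ← h, if_pos ((le_max_right k (c n)).trans (Nat.le_succ _))]
      · exact ⟨_, h⟩

section Level

variable {W : Type} [LinearOrder W] {N : ℕ} {G : Type} [Group G]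
  {τ : W → W → (ℕ → Set W) → ℕ × (Fin N → Name W) × Name W} {nm : G → Name W}

theorem Named.level_eq_bot (hnm : Named nm) {a : G} : level (nm a) = ⊥ ↔ a = 1 := by
  rw [TreeSide.level_eq_bot, ← hnm.one, hnm.inj.eq_iff]

theorem Named.level_inv (hnm : Named nm) (a : G) : level (nm a⁻¹) = level (nm a) :=
  le_antisymm (hnm.inv a) (by simpa using hnm.inv a⁻¹)

/-- Coherent filtrations below a level amalgamate into one filtration. -/
theorem exists_filtration {α : W} [Countable (Set.Iio α)] (hnm : Named nm)
    (hrange : ∀ a, level (nm a) < α) {L : W → ℕ → Subgroup G}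
    (T : ∀ γ, γ < α → TowerAt τ nm L γ) :
    ∃ H : ℕ → Subgroup G, H 0 = ⊥ ∧ Monotone H ∧ (∀ a, ∃ k, a ∈ H k) ∧
      (∀ γ, γ < α → ∃ k₀, ∀ k, k₀ ≤ k → L γ k ≤ H k) ∧ (∀ k, (levels nm α H k).Finite) ∧
      (∀ k γ, γ ∈ levels nm α H k → ∀ b, level (nm b) ≤ γ → (b ∈ H k ↔ b ∈ L γ k)) ∧
      ∀ k, Malnormal (H k) := by
  rcases isEmpty_or_nonempty (Set.Iio α) with hα | hα
  · have h1 : ∀ a : G, a = 1 := fun a => by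
      rw [← hnm.level_eq_bot]
      have := hrange a
      rcases h : level (nm a) with _ | γ
      · rfl
      · rw [h] at this
        exact hα.elim ⟨γ, WithBot.coe_lt_coe.1 this⟩
    have h2 : ∀ γ, ¬ γ < α := fun γ hγ => hα.elim ⟨γ, hγ⟩
    refine ⟨fun _ => ⊥, rfl, monotone_const, fun a => ⟨0, h1 a⟩, fun γ hγ => (h2 γ hγ).elim,
      fun k => ?_, fun k γ hγ => (h2 γ hγ.1).elim, fun k g hg y hy _ => h1 y⟩
    exact Set.Finite.subset Set.finite_empty fun γ hγ => h2 γ hγ.1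
  obtain ⟨e, he⟩ := exists_surjective_nat (Set.Iio α)
  set γ := partialSups e with hγ
  have hstep : ∀ i, ∃ c, ∀ k, c ≤ k → L (γ i) k ≤ L (γ (i + 1)) k := by
    intro i
    rcases (γ.monotone i.le_succ).eq_or_lt with h | h
    · exact ⟨0, fun k _ => by rw [Nat.succ_eq_add_one] at h; rw [h]⟩
    · exact (T _ (γ (i + 1)).2).coh _ h
  choose c hc using hstep
  obtain ⟨i, hi, hiu⟩ := exists_slow_sequence c
  set ρ : ℕ → W := fun k => γ (i k) with hρ
  have hρα : ∀ k, ρ k < α := fun k => (γ (i k)).2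
  have hρc : ∀ ξ, ξ < α → ∃ k, ξ ≤ ρ k := by
    intro ξ hξ
    obtain ⟨n, hn⟩ := he ⟨ξ, hξ⟩
    obtain ⟨k, hk⟩ := hiu n
    have h1 : e n ≤ γ (i k) := (le_partialSups e n).trans (γ.monotone hk)
    rw [hn] at h1
    exact ⟨k, h1⟩
  have hstep : ∀ k m, k + 1 ≤ m → L (ρ k) m ≤ L (ρ (k + 1)) m := by
    intro k m hm
    rcases hi k with h | ⟨h, h'⟩
    · simp only [hρ, h, le_refl]
    · simp only [hρ, h]
      exact hc _ _ (h'.trans hm)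
  have hle : ∀ k m m', k ≤ m → m ≤ m' → L (ρ k) m' ≤ L (ρ m) m' := by
    intro k m m' hkm
    induction m, hkm using Nat.le_induction with
    | base => exact fun _ => le_rfl
    | succ m hkm ih => exact fun h => (ih (by lia)).trans (hstep m m' h)
  set H : ℕ → Subgroup G := fun k => if k = 0 then ⊥ else L (ρ k) k with hH
  have hHk : ∀ k, k ≠ 0 → H k = L (ρ k) k := fun k hk => if_neg hk
  have hH0 : H 0 = ⊥ := if_pos rfl
  have hmono : Monotone H := by
    refine monotone_nat_of_le_succ fun k => ?_
    by_cases hk : k = 0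
    · rw [hk, hH0]
      exact bot_le
    · rw [hHk k hk, hHk _ k.succ_ne_zero]
      exact ((T _ (hρα k)).mono k.le_succ).trans (hstep k _ le_rfl)
  have hcoh : ∀ γ, γ < α → ∃ k₀, ∀ k, k₀ ≤ k → L γ k ≤ H k := by
    intro γ hγ
    obtain ⟨k₁, hk₁⟩ := hρc γ hγ
    have h2 : ∃ k₀, ∀ k, k₀ ≤ k → L γ k ≤ L (ρ k₁) k := by
      rcases hk₁.eq_or_lt with h | h
      · exact ⟨0, fun k _ => by rw [h]⟩
      · exact (T _ (hρα k₁)).coh γ h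
    obtain ⟨k₀, hk₀⟩ := h2
    refine ⟨k₀ + k₁ + 1, fun k hk => ?_⟩
    rw [hHk k (by lia)]
    exact (hk₀ k (by lia)).trans (hle k₁ k k (by lia) le_rfl)
  refine ⟨H, hH0, hmono, fun a => ?_, hcoh, fun k => ?_, fun k δ hδ b hb => ?_,
    fun k => malnormal_of_mul_eq fun g y z hg hy hz h => ?_⟩
  · have h1 : ∃ δ, δ < α ∧ level (nm a) ≤ δ := by
      have := hrange a
      rcases h : level (nm a) with _ | δ
      · exact ⟨ρ 0, hρα 0, bot_le⟩
      · rw [h] at this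
        exact ⟨δ, WithBot.coe_lt_coe.1 this, le_rfl⟩
    obtain ⟨δ, hδ, hδa⟩ := h1
    obtain ⟨k, hk⟩ := (T δ hδ).union a hδa
    obtain ⟨k₀, hk₀⟩ := hcoh δ hδ
    exact ⟨max k k₀, hk₀ _ (le_max_right _ _) ((T δ hδ).mono (le_max_left k k₀) hk)⟩
  · by_cases hk : k = 0
    · refine Set.Finite.subset Set.finite_empty ?_
      rintro δ ⟨-, a, ha, h⟩
      rw [hk, hH0, Subgroup.mem_bot] at ha
      rw [ha, hnm.one] at h
      exact (WithBot.bot_ne_coe h).elim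
    · refine (((T _ (hρα k)).fin k).insert (ρ k)).subset ?_
      rintro δ ⟨-, a, ha, h⟩
      rw [hHk k hk] at ha
      have := (T _ (hρα k)).le k a ha
      rw [h, WithBot.coe_le_coe] at this
      rcases this.eq_or_lt with h1 | h1
      · exact Or.inl h1
      · exact Or.inr ⟨h1, a, ha, h⟩
  · obtain ⟨-, a, ha, h⟩ := hδ
    by_cases hk : k = 0
    · rw [hk, hH0, Subgroup.mem_bot] at ha
      rw [ha, hnm.one] at h
      exact (WithBot.bot_ne_coe h).elim
    rw [hHk k hk] at ha ⊢
    have := (T _ (hρα k)).le k a ha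
    rw [h, WithBot.coe_le_coe] at this
    rcases this.eq_or_lt with h1 | h1
    · rw [h1]
    · exact (T _ (hρα k)).sync k δ ⟨h1, a, ha, h⟩ b hb
  · by_cases hk : k = 0
    · rwa [hk, hH0, Subgroup.mem_bot] at hy
    rw [hHk k hk] at hg hy hz
    by_cases hgl : level (nm g) ≤ ρ k
    · exact (T _ (hρα k)).mal k g y z hgl hg hy hz h
    · rw [not_le] at hgl
      have hgα := hrange g
      rcases hl : level (nm g) with _ | δ
      · rw [hl] at hgl
        exact (not_lt_bot hgl).elim
      · change level (nm g) = (δ : WithBot W) at hl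
        rw [hl] at hgl hgα
        exact (T δ (WithBot.coe_lt_coe.1 hgα)).malLt g y z hl
          (((T _ (hρα k)).le k y hy).trans_lt hgl) (((T _ (hρα k)).le k z hz).trans_lt hgl) h

theorem eq_and_lt_of_ultra {X : Type*} [LinearOrder X] {c c' x x' : X} (h1 : c ≠ x) (h2 : c ≠ x')
    (h3 : c' ≠ x) (h4 : c' ≠ x') (h5 : x ≠ x') (hx : x ≤ max (max c x') c')
    (hx' : x' ≤ max (max c x) c') (hc : c ≤ max (max x' c') x) (hc' : c' ≤ max (max x c) x') :
    c = c' ∧ x < c ∧ x' < c := by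
  grind

end Level

section NextLevel

variable {W : Type} [LinearOrder W] {N : ℕ} {G : Type} [Group G]
  {τ : W → W → (ℕ → Set W) → ℕ × (Fin N → Name W) × Name W} {nm : G → Name W}

/-- The relations imposed at step `k` of the construction of level `α`. -/
def relData (τ : W → W → (ℕ → Set W) → ℕ × (Fin N → Name W) × Name W) (nm : G → Name W) (α : W)
    (H : ℕ → Subgroup G) (k : ℕ) : Set (G × (Fin N → G) × G) :=
  {d | ∃ γ ∈ levels nm α H (k + 1), γ ∉ levels nm α H k ∧ d.1 ∈ H (k + 1) ∧ (∀ j, d.2.1 j ∈ H k) ∧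
    d.2.2 ∈ H k ∧ SidonSeq d.2.1 ∧ nm d.1 = some (γ, (τ α γ (levels nm α H)).1) ∧
    (∀ j, nm (d.2.1 j) = (τ α γ (levels nm α H)).2.1 j) ∧
    nm d.2.2 = (τ α γ (levels nm α H)).2.2}

theorem Named.level_mul_mul (hnm : Named nm) (a b c : G) :
    level (nm (a * b * c)) ≤ max (max (level (nm a)) (level (nm b))) (level (nm c)) :=
  (hnm.mul _ _).trans (max_le_max_right _ (hnm.mul _ _))

theorem relData_coset {α : W} (hnm : Named nm) {L : W → ℕ → Subgroup G}
    (T : ∀ γ, γ < α → TowerAt τ nm L γ) {H : ℕ → Subgroup G} (hmono : Monotone H)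
    (sync : ∀ k γ, γ ∈ levels nm α H k → ∀ b, level (nm b) ≤ γ → (b ∈ H k ↔ b ∈ L γ k))
    (hrange : ∀ a, level (nm a) < α) (k : ℕ) {d d' : G × (Fin N → G) × G}
    (hd : d ∈ relData τ nm α H k) (hd' : d' ∈ relData τ nm α H k) {c c' : G} (hc : c ∈ H k)
    (hc' : c' ∈ H k) (h : c * d.1 * c' = d'.1) : d = d' := by
  obtain ⟨x, q, u⟩ := d
  obtain ⟨x', q', u'⟩ := d'
  obtain ⟨γ, -, hγ, hx, -, -, -, hxn, hqn, hun⟩ := hd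
  obtain ⟨γ', -, hγ', -, -, -, -, hxn', hqn', hun'⟩ := hd'
  dsimp only at *
  by_cases hγγ : γ = γ'
  · subst hγγ
    rw [hnm.inj (hxn.trans hxn'.symm), hnm.inj (hun.trans hun'.symm),
      show q = q' from funext fun j => hnm.inj ((hqn j).trans (hqn' j).symm)]
  have lx : level (nm x) = γ := by rw [hxn]; rfl
  have lx' : level (nm x') = γ' := by rw [hxn']; rfl
  have ne : ∀ e ∈ H k, ∀ δ, δ ∉ levels nm α H k → δ < α → level (nm e) ≠ δ :=
    fun e he δ hδ hδα h => hδ ⟨hδα, e, he, h⟩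
  have hγα : γ < α := WithBot.coe_lt_coe.1 (lx ▸ hrange x)
  have hγα' : γ' < α := WithBot.coe_lt_coe.1 (lx' ▸ hrange x')
  obtain ⟨e1, e2, e3⟩ := eq_and_lt_of_ultra (ne c hc γ hγ hγα) (ne c hc γ' hγ' hγα')
    (ne c' hc' γ hγ hγα) (ne c' hc' γ' hγ' hγα') (fun h => hγγ (WithBot.coe_injective h))
    (by
      have := hnm.level_mul_mul c⁻¹ x' c'⁻¹
      rwa [← h, show c⁻¹ * (c * x * c') * c'⁻¹ = x by group, hnm.level_inv, hnm.level_inv, h, lx,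
        lx'] at this)
    (by
      have := hnm.level_mul_mul c x c'
      rwa [h, lx, lx'] at this)
    (by
      have := hnm.level_mul_mul x' c'⁻¹ x⁻¹
      rwa [← h, show c * x * c' * c'⁻¹ * x⁻¹ = c by group, hnm.level_inv, hnm.level_inv, h, lx,
        lx'] at this)
    (by
      have := hnm.level_mul_mul x⁻¹ c⁻¹ x'
      rwa [← h, show x⁻¹ * c⁻¹ * (c * x * c') = c' by group, hnm.level_inv, hnm.level_inv, h, lx,
        lx'] at this)
  rcases hl : level (nm c) with _ | l
  · rw [hl] at e2
    exact (not_lt_bot e2).elim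
  change level (nm c) = (l : WithBot W) at hl
  have hlα : l < α := WithBot.coe_lt_coe.1 (hl ▸ hrange c)
  have sk := sync k l ⟨hlα, c, hc, hl⟩
  have sk' := sync (k + 1) l ⟨hlα, c, hmono k.le_succ hc, hl⟩
  rw [hl] at e1 e2 e3
  refine ((T l hlα).sep k c ((sk c hl.le).1 hc) c' ((sk c' e1.symm.le).1 hc') hl e1.symm x
    ((sk' x (lx ▸ e2.le)).1 hx) (fun hxk => ?_) (lx ▸ e2) x' (lx' ▸ e3) h).elim
  exact ne x ((sk x (lx ▸ e2.le)).2 hxk) γ hγ hγα lx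

/-- Adding one level to a tower. -/
theorem exists_next_level (hN : 1000 ≤ N) {α : W} [Countable (Set.Iio α)] (hnm : Named nm)
    (hrange : ∀ p, (∃ a, nm a = p) ↔ level p < α) {L : W → ℕ → Subgroup G}
    (T : ∀ γ, γ < α → TowerAt τ nm L γ) :
    ∃ (K : Type) (_ : Group K) (ι : G →* K) (nm' : K → Name W) (L' : W → ℕ → Subgroup K),
      (∀ a, nm' (ι a) = nm a) ∧ Named nm' ∧ (∀ p, (∃ a, nm' a = p) ↔ level p ≤ α) ∧
      (∀ γ, γ < α → ∀ k, L' γ k = (L γ k).map ι) ∧ ∀ γ, γ ≤ α → TowerAt τ nm' L' γ := by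
  have hlt : ∀ a, level (nm a) < α := fun a => (hrange _).1 ⟨a, rfl⟩
  obtain ⟨H, H0, hmono, hH, hcoh, hfin, hsync, hmal⟩ := exists_filtration hnm hlt T
  have hG : Countable G := by
    have : {p : Name W | level p < α}.Countable := by
      have : {p : Name W | level p < α} ⊆ insert none (some '' (Set.Iio α ×ˢ Set.univ)) := by
        rintro (_ | p) hp
        · exact Or.inl rfl
        · exact Or.inr ⟨p, ⟨WithBot.coe_lt_coe.1 hp, trivial⟩, rfl⟩
      exact ((((Set.to_countable _).prod (Set.to_countable _)).image _).insert _).mono this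
    have := this.to_subtype
    exact (show Function.Injective fun a => (⟨nm a, hlt a⟩ : {p : Name W | level p < α}) from
      fun a b h => hnm.inj (congrArg Subtype.val h)).countable
  set F := levels nm α H with hF
  obtain ⟨K, _, ι, LK, hK, hι, LKmono, LKunion, LKH, LKmal, ιmal, LKsep, LKrel, hinf⟩ :=
    exists_step H H0 hmono hH hmal hN (relData τ nm α H) (by
      rintro k ⟨x, q, u⟩ ⟨γ, hγ, hγ', hx, hq, hu, hs, hxn, -, -⟩
      exact ⟨hx, fun h => hγ' ⟨hγ.1, x, h, by rw [hxn]; rfl⟩, hq, hu, hs⟩)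
      (fun k d hd d' hd' c hc c' hc' h => relData_coset hnm T hmono hsync hlt k hd hd' hc hc' h)
  have := hinf.to_subtype
  obtain ⟨φ⟩ := nonempty_equiv_of_countable (α := ↥(ι.range : Set K)ᶜ) (β := ℕ)
  classical
  let nm' : K → Name W := fun z =>
    if h : z ∈ ι.range then nm h.choose else some (α, φ ⟨z, h⟩)
  have hnι : ∀ a, nm' (ι a) = nm a := fun a => by
    have h : ι a ∈ ι.range := ⟨a, rfl⟩
    simp only [nm', dif_pos h]
    rw [hι h.choose_spec]
  have hnout : ∀ z (h : z ∉ ι.range), nm' z = some (α, φ ⟨z, h⟩) := fun z h => dif_neg h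
  have hlout : ∀ z, z ∉ ι.range → level (nm' z) = α := fun z h => by rw [hnout z h]; rfl
  have hlin : ∀ z, level (nm' z) < α → ∃ a, ι a = z := fun z h => by
    by_contra h'
    rw [hlout z h'] at h
    exact lt_irrefl _ h
  have hleα : ∀ z, level (nm' z) ≤ α := fun z => by
    by_cases h : z ∈ ι.range
    · obtain ⟨a, rfl⟩ := h
      rw [hnι]
      exact (hlt a).le
    · exact (hlout z h).le
  have hlα : ∀ z, level (nm' z) = α → z ∉ ι.range := by
    rintro _ h ⟨a, rfl⟩
    rw [hnι] at h
    exact (hlt a).ne h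
  let L' : W → ℕ → Subgroup K := fun γ k => if γ < α then (L γ k).map ι else LK k
  have hL' : ∀ γ, γ < α → ∀ k, L' γ k = (L γ k).map ι := fun γ hγ k => if_pos hγ
  have hL'α : L' α = LK := funext fun k => if_neg (lt_irrefl α)
  have hlev : levels nm' α LK = F := by
    funext k
    ext γ
    refine and_congr_right fun hγ => ⟨?_, ?_⟩
    · rintro ⟨z, hz, h⟩
      obtain ⟨a, rfl⟩ := hlin z (h ▸ WithBot.coe_lt_coe.2 hγ)
      exact ⟨a, (LKH k a).1 hz, hnι a ▸ h⟩
    · rintro ⟨a, ha, h⟩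
      exact ⟨ι a, (LKH k a).2 ha, (hnι a).symm ▸ h⟩
  refine ⟨K, inferInstance, ι, nm', L', hnι, ⟨fun z z' h => ?_, ?_, fun z z' => ?_, fun z => ?_⟩,
    fun p => ⟨?_, fun hp => ?_⟩, hL', fun γ hγ => ?_⟩
  · by_cases hz : z ∈ ι.range
    · obtain ⟨a, rfl⟩ := hz
      obtain ⟨a', rfl⟩ := hlin z' (by rw [← h, hnι]; exact hlt a)
      rw [hnι, hnι] at h
      rw [hnm.inj h]
    · have hz' : z' ∉ ι.range := hlα _ (h ▸ hlout z hz)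
      rw [hnout z hz, hnout z' hz', Option.some.injEq, Prod.mk.injEq] at h
      exact congrArg Subtype.val (φ.injective h.2)
  · rw [← map_one ι, hnι, hnm.one]
  · by_cases hz : z ∈ ι.range
    · by_cases hz' : z' ∈ ι.range
      · obtain ⟨a, rfl⟩ := hz
        obtain ⟨a', rfl⟩ := hz'
        rw [← map_mul, hnι, hnι, hnι]
        exact hnm.mul a a'
      · rw [hlout z' hz']
        exact (hleα _).trans (le_max_right _ _)
    · rw [hlout z hz]
      exact (hleα _).trans (le_max_left _ _)
  · by_cases hz : z ∈ ι.range
    · obtain ⟨a, rfl⟩ := hz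
      rw [← map_inv, hnι, hnι]
      exact hnm.inv a
    · rw [hlout z hz]
      exact hleα _
  · rintro ⟨z, rfl⟩
    exact hleα z
  · rcases hp.lt_or_eq with h | h
    · obtain ⟨a, rfl⟩ := (hrange p).2 h
      exact ⟨ι a, hnι a⟩
    · rcases p with _ | ⟨β, n⟩
      · exact (WithBot.bot_ne_coe h).elim
      · obtain rfl : β = α := WithBot.coe_injective h
        refine ⟨(φ.symm n).1, ?_⟩
        rw [hnout _ (φ.symm n).2]
        exact congrArg (fun m => some (β, m)) (φ.apply_symm_apply n)
  · rcases hγ.lt_or_eq with hγ | rfl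
    · refine (T γ hγ).map ι hι hnι (fun b hb => hlin b (hb.trans_lt (WithBot.coe_lt_coe.2 hγ)))
        fun δ hδ k => hL' δ (hδ.trans_lt hγ) k
    refine ⟨fun k a ha => hleα a, hL'α ▸ LKmono, fun a _ => hL'α ▸ LKunion a, fun δ hδ => ?_,
      fun k => ?_, fun k δ hδ b hb => ?_, fun k g y z hg hgk hy hz h => ?_,
      fun g y z hg hy hz h => ?_, fun k c hc c' hc' hcl hcl' a ha hak hal a' ha' h => ?_,
      fun k δ hδ hδ' x h u hx hh hu hhl hul hs hxn hhn hun y hy hyl => ?_⟩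
    · obtain ⟨k₀, hk₀⟩ := hcoh δ hδ
      refine ⟨k₀, fun k hk => ?_⟩
      rw [hL' δ hδ, hL'α]
      rintro _ ⟨a, ha, rfl⟩
      exact (LKH k a).2 (hk₀ k hk ha)
    · rw [hL'α, hlev]
      exact hfin k
    · rw [hL'α, hlev] at hδ
      obtain ⟨b, rfl⟩ := hlin b (hb.trans_lt (WithBot.coe_lt_coe.2 hδ.1))
      rw [hL'α, LKH, hL' δ hδ.1, Subgroup.mem_map_iff_mem hι]
      exact hsync k δ hδ b (hnι b ▸ hb)
    · rw [hL'α] at hgk hy hz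
      exact (LKmal k).eq_one_of_mul_eq hgk hy hz h
    · obtain ⟨y, rfl⟩ := hlin y hy
      obtain ⟨z, rfl⟩ := hlin z hz
      exact ιmal.eq_one_of_mul_eq (hlα g hg) ⟨y, rfl⟩ ⟨z, rfl⟩ h
    · obtain ⟨a, rfl⟩ := hlin a hal
      obtain ⟨a', rfl⟩ := hlin a' ha'
      rw [hL'α] at hc hc' ha hak
      rw [LKH] at ha hak
      exact LKsep k c hc c' hc' (hlα c hcl) (hlα c' hcl') a ha hak a' h
    · rw [hL'α] at hx hh hu hy
      rw [hL'α, hlev] at hδ hδ' hxn hhn hun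
      obtain ⟨x, rfl⟩ := hlin x (by rw [hxn]; exact WithBot.coe_lt_coe.2 hδ.1)
      obtain ⟨u, rfl⟩ := hlin u hul
      choose h' hh' using fun i => hlin (h i) (hhl i)
      obtain rfl : (fun i => ι (h' i)) = h := funext hh'
      simp only [LKH, hnι] at hx hh hu hxn hhn hun
      exact LKrel k (x, h', u) ⟨δ, hδ, hδ', hx, hh, hu, hs.of_map ι, hxn, hhn, hun⟩ y hy
        (hlα y hyl)

end NextLevel

section Assembly

/-- Transfinite recursion with existential choices: a predicate on functions which is local can be
realised everywhere as soon as it can be realised one step further. -/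
theorem exists_transfinite {W D : Type*} [LinearOrder W] [WellFoundedLT W] [Nonempty D]
    (P : W → (W → D) → Prop)
    (hloc : ∀ α F F', (∀ β, β ≤ α → F β = F' β) → P α F → P α F')
    (hstep : ∀ α F, (∀ β, β < α → P β F) → ∃ F', (∀ β, β < α → F' β = F β) ∧ P α F') :
    ∃ F : W → D, ∀ α, P α F := by
  classical
  obtain ⟨d₀⟩ := ‹Nonempty D›
  let ext : ∀ α : W, (∀ β, β < α → D) → W → D := fun α f β => if h : β < α then f β h else d₀
  let rec' : ∀ α : W, (∀ β, β < α → D) → D := fun α f =>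
    if h : ∃ F', (∀ β, β < α → F' β = ext α f β) ∧ P α F' then h.choose α else d₀
  let F : W → D := (wellFounded_lt (α := W)).fix rec'
  have hF : ∀ α, F α = rec' α fun β _ => F β := fun α => WellFounded.fix_eq _ _ _
  have hext : ∀ α β, β < α → ext α (fun β _ => F β) β = F β := fun α β h => dif_pos h
  refine ⟨F, fun α => ?_⟩
  induction α using (wellFounded_lt (α := W)).induction with
  | _ α ih =>
    have h : ∃ F', (∀ β, β < α → F' β = ext α (fun β _ => F β) β) ∧ P α F' :=
      hstep α _ fun β hβ => hloc β F _ (fun γ hγ => (hext α γ (hγ.trans_lt hβ)).symm) (ih β hβ)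
    refine hloc α h.choose F (fun β hβ => ?_) h.choose_spec.2
    rcases hβ.lt_or_eq with hβ | rfl
    · rw [h.choose_spec.1 β hβ, hext α β hβ]
    · rw [hF β]
      change _ = dite _ _ _
      rw [dif_pos h]

variable {W : Type} [LinearOrder W] {N : ℕ}

/-- The names whose level belongs to `S`, together with the name of the identity. -/
def names (S : Set W) : Set (Name W) := {p | ∀ γ : W, level p = γ → γ ∈ S}

theorem mem_names_Iic {α : W} {p : Name W} : p ∈ names (Set.Iic α) ↔ level p ≤ α := by
  rcases p with _ | p
  · exact ⟨fun _ => bot_le, fun _ γ h => (WithBot.bot_ne_coe h).elim⟩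
  · exact ⟨fun h => WithBot.coe_le_coe.2 (h p.1 rfl),
      fun h γ hγ => WithBot.coe_le_coe.1 (hγ ▸ h : (γ : WithBot W) ≤ α)⟩

theorem mem_names_Iio {α : W} {p : Name W} : p ∈ names (Set.Iio α) ↔ level p < α := by
  rcases p with _ | p
  · exact ⟨fun _ => WithBot.bot_lt_coe _, fun _ γ h => (WithBot.bot_ne_coe h).elim⟩
  · exact ⟨fun h => WithBot.coe_lt_coe.2 (h p.1 rfl),
      fun h γ hγ => WithBot.coe_lt_coe.1 (hγ ▸ h : (γ : WithBot W) < α)⟩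

/-- Raw data attached to a level: a multiplication of names and a filtration. -/
abbrev LevelData (W : Type) := (Name W → Name W → Name W) × (ℕ → Set (Name W))

/-- The multiplication of names given by the data of all levels. -/
def mulOf (F : W → LevelData W) (p q : Name W) : Name W :=
  (max (level p) (level q)).recBotCoe none fun γ => (F γ).1 p q

theorem mulOf_of_eq {F : W → LevelData W} {p q : Name W} {γ : W}
    (h : max (level p) (level q) = γ) : mulOf F p q = (F γ).1 p q := by
  rw [mulOf, h]
  rfl

theorem mulOf_of_bot {F : W → LevelData W} {p q : Name W}
    (h : max (level p) (level q) = ⊥) : mulOf F p q = none := by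
  rw [mulOf, h]
  rfl

theorem mulOf_congr {F F' : W → LevelData W} {p q : Name W}
    (h : ∀ γ : W, γ ≤ max (level p) (level q) → F γ = F' γ) : mulOf F p q = mulOf F' p q := by
  rcases hm : max (level p) (level q) with _ | γ
  · rw [mulOf_of_bot hm, mulOf_of_bot hm]
  · rw [mulOf_of_eq hm, mulOf_of_eq hm, h γ hm.ge]

/-- The data `F` describe a tower of groups on the levels in `S`. -/
def Realizes (τ : W → W → (ℕ → Set W) → ℕ × (Fin N → Name W) × Name W) (F : W → LevelData W)
    (S : Set W) : Prop :=
  ∃ (G : Type) (_ : Group G) (nm : G → Name W) (L : W → ℕ → Subgroup G), Named nm ∧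
    (∀ p, (∃ a, nm a = p) ↔ p ∈ names S) ∧ (∀ a b, nm (a * b) = mulOf F (nm a) (nm b)) ∧
    (∀ γ ∈ S, ∀ k, (F γ).2 k = nm '' L γ k) ∧ ∀ γ ∈ S, TowerAt τ nm L γ

variable {τ : W → W → (ℕ → Set W) → ℕ × (Fin N → Name W) × Name W}

theorem Realizes.congr {F F' : W → LevelData W} {α : W} (hF : ∀ β, β ≤ α → F β = F' β)
    (h : Realizes τ F (Set.Iic α)) : Realizes τ F' (Set.Iic α) := by
  obtain ⟨G, _, nm, L, hnm, hr, hm, hL, hT⟩ := h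
  have hle : ∀ a, level (nm a) ≤ α := fun a => mem_names_Iic.1 ((hr _).1 ⟨a, rfl⟩)
  refine ⟨G, inferInstance, nm, L, hnm, hr, fun a b => ?_, fun γ hγ k => ?_, hT⟩
  · rw [hm, mulOf_congr fun γ hγ => hF γ ?_]
    exact WithBot.coe_le_coe.1 (hγ.trans (max_le (hle a) (hle b)))
  · rw [← hF γ hγ, hL γ hγ]

theorem Realizes.empty (F : W → LevelData W) : Realizes τ F ∅ := by
  refine ⟨PUnit, inferInstance, fun _ => none, fun _ _ => ⊤,
    ⟨fun _ _ _ => rfl, rfl, fun _ _ => by simp, fun _ => le_rfl⟩, fun p => ⟨?_, fun hp => ?_⟩,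
    fun _ _ => (mulOf_of_bot (by simp)).symm, fun _ h => (Set.notMem_empty _ h).elim,
    fun _ h => (Set.notMem_empty _ h).elim⟩
  · rintro ⟨-, rfl⟩
    exact fun γ h => (WithBot.bot_ne_coe h).elim
  · rcases p with _ | p
    · exact ⟨PUnit.unit, rfl⟩
    · exact (Set.notMem_empty _ (hp p.1 rfl)).elim

/-- Gluing the towers below the elements of a nonempty lower set. -/
theorem Realizes.glue {F : W → LevelData W} {S : Set W} (hS : IsLowerSet S)
    (h : ∀ γ ∈ S, Realizes τ F (Set.Iic γ)) : Realizes τ F S := by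
  classical
  rcases S.eq_empty_or_nonempty with rfl | ⟨s₀, hs₀⟩
  · exact Realizes.empty F
  replace h : ∀ γ : S, Realizes τ F (Set.Iic γ.1) := fun γ => h γ.1 γ.2
  choose G' hG nm' L' hnm hr hm hL hT using h
  have bound : ∀ p : names S, ∃ γ : S, level p.1 ≤ γ.1 := fun ⟨p, hp⟩ => by
    rcases p with _ | p
    · exact ⟨⟨s₀, hs₀⟩, bot_le⟩
    · exact ⟨⟨p.1, hp p.1 rfl⟩, le_rfl⟩
  have lift : ∀ (γ : S) (p : Name W), level p ≤ γ.1 → ∃ a, nm' γ a = p := fun γ p h =>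
    (hr γ p).2 (mem_names_Iic.2 h)
  have hle : ∀ (γ : S) a, level (nm' γ a) ≤ γ.1 := fun γ a => mem_names_Iic.1 ((hr γ _).1 ⟨a, rfl⟩)
  have hmem : ∀ (γ : S) a, nm' γ a ∈ names S := fun γ a δ h =>
    hS (WithBot.coe_le_coe.1 (h ▸ hle γ a)) γ.2
  have lift3 : ∀ p q r : names S, ∃ (γ : S) (a b c : G' γ),
      nm' γ a = p.1 ∧ nm' γ b = q.1 ∧ nm' γ c = r.1 := fun p q r => by
    obtain ⟨γ₁, h₁⟩ := bound p
    obtain ⟨γ₂, h₂⟩ := bound q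
    obtain ⟨γ₃, h₃⟩ := bound r
    have hcoe : ∀ {δ δ' : S}, δ ≤ δ' → (δ.1 : WithBot W) ≤ δ'.1 := fun h => WithBot.coe_le_coe.2 h
    obtain ⟨a, ha⟩ := lift (max (max γ₁ γ₂) γ₃) p.1
      (h₁.trans (hcoe ((le_max_left _ _).trans (le_max_left _ _))))
    obtain ⟨b, hb⟩ := lift (max (max γ₁ γ₂) γ₃) q.1
      (h₂.trans (hcoe ((le_max_right _ _).trans (le_max_left _ _))))
    obtain ⟨c, hc⟩ := lift (max (max γ₁ γ₂) γ₃) r.1 (h₃.trans (hcoe (le_max_right _ _)))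
    exact ⟨_, a, b, c, ha, hb, hc⟩
  have hnone : (none : Name W) ∈ names S := fun γ h => (WithBot.bot_ne_coe h).elim
  have hmul : ∀ p q : names S, mulOf F p.1 q.1 ∈ names S := fun p q => by
    obtain ⟨γ, a, b, -, ha, hb, -⟩ := lift3 p q q
    rw [← ha, ← hb, ← hm]
    exact hmem γ _
  have hinv : ∀ p : names S, ∃ q : names S, mulOf F q.1 p.1 = none ∧ level q.1 ≤ level p.1 :=
    fun p => by
      obtain ⟨γ, a, -, -, ha, -, -⟩ := lift3 p p p
      refine ⟨⟨nm' γ a⁻¹, hmem γ _⟩, ?_, ?_⟩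
      · rw [← ha, ← hm, inv_mul_cancel, (hnm γ).one]
      · rw [← ha]
        exact (hnm γ).inv a
  choose inv hinv hinvl using hinv
  let _ : Mul (names S) := ⟨fun p q => ⟨mulOf F p.1 q.1, hmul p q⟩⟩
  let _ : One (names S) := ⟨⟨none, hnone⟩⟩
  let _ : Inv (names S) := ⟨inv⟩
  let _ : Group (names S) := Group.ofLeftAxioms
    (fun p q r => by
      obtain ⟨γ, a, b, c, ha, hb, hc⟩ := lift3 p q r
      refine Subtype.ext ?_
      change mulOf F (mulOf F p.1 q.1) r.1 = mulOf F p.1 (mulOf F q.1 r.1)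
      rw [← ha, ← hb, ← hc, ← hm, ← hm, ← hm, ← hm, mul_assoc])
    (fun p => by
      obtain ⟨γ, a, -, -, ha, -, -⟩ := lift3 p p p
      refine Subtype.ext ?_
      change mulOf F none p.1 = p.1
      rw [← ha, ← (hnm γ).one, ← hm, one_mul])
    (fun p => Subtype.ext (hinv p))
  let j : ∀ γ : S, G' γ →* names S := fun γ =>
    MonoidHom.mk' (fun a => ⟨nm' γ a, hmem γ a⟩) fun a b => Subtype.ext (hm γ a b)
  have hj : ∀ γ a, (j γ a).1 = nm' γ a := fun γ a => rfl
  have hjinj : ∀ γ, Function.Injective (j γ) := fun γ a b h =>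
    (hnm γ).inj (congrArg Subtype.val h)
  let L : W → ℕ → Subgroup (names S) := fun γ k =>
    if h : γ ∈ S then (L' ⟨γ, h⟩ γ k).map (j ⟨γ, h⟩) else ⊥
  have memL : ∀ γ : S, ∀ δ, δ ≤ γ.1 → ∀ k p, p ∈ (L' γ δ k).map (j γ) ↔ p.1 ∈ (F δ).2 k := by
    intro γ δ hδ k p
    rw [hL γ δ hδ k]
    exact ⟨fun ⟨a, ha, h⟩ => ⟨a, ha, congrArg Subtype.val h⟩,
      fun ⟨a, ha, h⟩ => ⟨a, ha, Subtype.ext h⟩⟩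
  have hLeq : ∀ γ : S, ∀ δ, δ ≤ γ.1 → ∀ k, L δ k = (L' γ δ k).map (j γ) := by
    intro γ δ hδ k
    ext p
    have hδS : δ ∈ S := hS hδ γ.2
    rw [memL γ δ hδ k p, ← memL ⟨δ, hδS⟩ δ le_rfl k p]
    simp only [L, dif_pos hδS]
  refine ⟨names S, inferInstance, Subtype.val, L, ⟨Subtype.val_injective, rfl, fun p q => ?_,
    hinvl⟩, fun p => ⟨fun ⟨a, ha⟩ => ha ▸ a.2, fun hp => ⟨⟨p, hp⟩, rfl⟩⟩, fun _ _ => rfl,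
    fun γ hγ k => ?_, fun γ hγ => ?_⟩
  · obtain ⟨γ, a, b, -, ha, hb, -⟩ := lift3 p q q
    change level (mulOf F p.1 q.1) ≤ _
    rw [← ha, ← hb, ← hm]
    exact (hnm γ).mul a b
  · rw [hLeq ⟨γ, hγ⟩ γ le_rfl, hL ⟨γ, hγ⟩ γ (Set.mem_Iic.2 le_rfl) k]
    ext p
    constructor
    · rintro ⟨a, ha, h⟩
      exact ⟨j ⟨γ, hγ⟩ a, ⟨a, ha, rfl⟩, h⟩
    · rintro ⟨q, ⟨a, ha, h'⟩, h⟩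
      exact ⟨a, ha, (congrArg Subtype.val h').trans h⟩
  · refine (hT ⟨γ, hγ⟩ γ (Set.mem_Iic.2 le_rfl)).map (j ⟨γ, hγ⟩) (hjinj _) (fun a => rfl)
      (fun b hb => ?_) fun δ hδ k => hLeq ⟨γ, hγ⟩ δ hδ k
    obtain ⟨a, ha⟩ := lift ⟨γ, hγ⟩ b.1 hb
    exact ⟨a, Subtype.ext ha⟩

/-- Extending a tower by one level. -/
theorem Realizes.next (hN : 1000 ≤ N) {F : W → LevelData W} {α : W} [Countable (Set.Iio α)]
    (h : Realizes τ F (Set.Iio α)) :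
    ∃ F' : W → LevelData W, (∀ β, β < α → F' β = F β) ∧ Realizes τ F' (Set.Iic α) := by
  classical
  obtain ⟨G, _, nm, L, hnm, hr, hm, hL, hT⟩ := h
  obtain ⟨K, _, ι, nm', L', hι, hnm', hr', hL', hT'⟩ :=
    exists_next_level hN hnm (fun p => (hr p).trans mem_names_Iio) hT
  let d : LevelData W := (fun p q => nm' (Function.invFun nm' p * Function.invFun nm' q),
    fun k => nm' '' L' α k)
  have hF : ∀ β, β < α → Function.update F α d β = F β := fun β hβ =>
    Function.update_of_ne hβ.ne _ _
  have hlin : ∀ z, level (nm' z) < α → ∃ a, ι a = z := fun z hz => by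
    obtain ⟨a, ha⟩ := (hr _).2 (mem_names_Iio.2 hz)
    exact ⟨a, hnm'.inj ((hι a).trans ha)⟩
  refine ⟨Function.update F α d, hF, K, inferInstance, nm', L', hnm',
    fun p => (hr' p).trans mem_names_Iic.symm, fun a b => ?_, fun γ hγ k => ?_, hT'⟩
  · have hmax : max (level (nm' a)) (level (nm' b)) ≤ α :=
      max_le ((hr' _).1 ⟨a, rfl⟩) ((hr' _).1 ⟨b, rfl⟩)
    rcases hmax.lt_or_eq with h | h
    · obtain ⟨a, rfl⟩ := hlin a ((le_max_left _ _).trans_lt h)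
      obtain ⟨b, rfl⟩ := hlin b ((le_max_right _ _).trans_lt h)
      rw [← map_mul, hι, hm, mulOf_congr fun γ hγ => (hF γ ?_).symm, hι, hι]
      rw [hι, hι] at h
      exact WithBot.coe_lt_coe.1 (hγ.trans_lt h)
    · rw [mulOf_of_eq h, Function.update_self]
      change _ = nm' (_ * _)
      rw [Function.leftInverse_invFun hnm'.inj a, Function.leftInverse_invFun hnm'.inj b]
  · rcases (Set.mem_Iic.1 hγ).lt_or_eq with h | rfl
    · rw [hF γ h, hL γ h, hL' γ h, Subgroup.coe_map, Set.image_image]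
      simp only [hι]
    · rw [Function.update_self]

/-- A tower of groups on all levels. -/
theorem exists_tower [WellFoundedLT W] [∀ α : W, Countable (Set.Iio α)] (hN : 1000 ≤ N)
    (τ : W → W → (ℕ → Set W) → ℕ × (Fin N → Name W) × Name W) :
    ∃ (G : Type) (_ : Group G) (nm : G → Name W) (L : W → ℕ → Subgroup G), Named nm ∧
      Function.Surjective nm ∧ ∀ γ, TowerAt τ nm L γ := by
  obtain ⟨F, hF⟩ := exists_transfinite (D := LevelData W) (fun α F => Realizes τ F (Set.Iic α))
    (fun α F F' h hF => hF.congr h)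
    (fun α F h => (Realizes.glue (isLowerSet_Iio α) h).next hN)
  obtain ⟨G, _, nm, L, hnm, hr, -, -, hT⟩ := Realizes.glue isLowerSet_univ fun γ _ => hF γ
  exact ⟨G, inferInstance, nm, L, hnm, fun p => (hr p).2 fun γ _ => trivial,
    fun γ => hT γ trivial⟩

end Assembly

section Club

open Cardinal

theorem exists_fiber_not_countable {X ι : Type*} [Countable ι] {A : Set X} (hA : ¬ A.Countable)
    (p : X → ι → Prop) (hp : ∀ x ∈ A, ∃ i, p x i) : ∃ i, ¬ {x ∈ A | p x i}.Countable := by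
  by_contra! h
  refine hA ((Set.countable_iUnion h).mono fun x hx => ?_)
  obtain ⟨i, hi⟩ := hp x hx
  exact Set.mem_iUnion.2 ⟨i, hx, hi⟩

/-- All but countably many members of a set of reals split from the others, uncountably often, at
infinitely many places. -/
theorem countable_not_splitting {W : Type*} (r : W → ℕ → Bool) (hr : Function.Injective r)
    (A : Set W) :
    {α ∈ A | ∃ m, ∀ d, m ≤ d →
      {β ∈ A | (∀ i < d, r β i = r α i) ∧ r β d ≠ r α d}.Countable}.Countable := by
  by_contra h
  obtain ⟨m, hm⟩ := exists_fiber_not_countable h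
    (fun α m => ∀ d, m ≤ d → {β ∈ A | (∀ i < d, r β i = r α i) ∧ r β d ≠ r α d}.Countable)
    fun α hα => hα.2
  obtain ⟨t, ht⟩ := exists_fiber_not_countable hm
    (fun α (t : Fin m → Bool) => ∀ i : Fin m, r α i = t i) fun α _ => ⟨fun i => r α i, fun _ => rfl⟩
  obtain ⟨α, hα⟩ : {x ∈ _ | _}.Nonempty := Set.nonempty_iff_ne_empty.2 fun h =>
    ht (h ▸ Set.countable_empty)
  refine ht (((Set.countable_iUnion fun d => hα.1.2 (m + d) (Nat.le_add_right m d)).insert α).mono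
    fun β hβ => ?_)
  by_cases hαβ : β = α
  · exact Or.inl hαβ
  refine Or.inr (Set.mem_iUnion.2 ?_)
  have hne : r β ≠ r α := fun h => hαβ (hr h)
  have hm : m ≤ PiNat.firstDiff (r β) (r α) := by
    by_contra! h
    exact PiNat.apply_firstDiff_ne hne ((hβ.2 ⟨_, h⟩).trans (hα.2 ⟨_, h⟩).symm)
  obtain ⟨d, hd⟩ := Nat.exists_eq_add_of_le hm
  exact ⟨d, hβ.1.1.1, fun i hi => PiNat.apply_eq_of_lt_firstDiff (hd ▸ hi),
    hd ▸ PiNat.apply_firstDiff_ne hne⟩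

variable {W : Type} [LinearOrder W] [∀ α : W, Countable (Set.Iio α)]

theorem countable_Iic_of_Iio (a : W) : (Set.Iic a).Countable := by
  rw [← Set.Iio_insert]
  exact (Set.to_countable (Set.Iio a)).insert a

theorem exists_gt_of_not_countable {A : Set W} (hA : ¬ A.Countable) (η : W) : ∃ a ∈ A, η < a := by
  by_contra! h
  exact hA ((countable_Iic_of_Iio η).mono h)

variable [Uncountable W]

theorem exists_strict_bound {C : Set W} (hC : C.Countable) : ∃ b, ∀ a ∈ C, a < b := by
  by_contra! h
  refine Set.not_countable_univ (α := W)
    ((hC.biUnion fun a _ => countable_Iic_of_Iio a).mono fun b _ => ?_)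
  obtain ⟨a, ha, hb⟩ := h b
  exact Set.mem_biUnion ha hb

/-- A set meeting, beyond every bound, the closure points of every function. -/
def Stationary (A : Set W) : Prop :=
  ∀ (η : W) (f : W → W), ∃ δ ∈ A, η < δ ∧ ∀ a, a < δ → f a < δ

theorem stationary_of_iUnion {A : ℕ → Set W} (hA : Stationary (⋃ i, A i)) :
    ∃ i, Stationary (A i) := by
  by_contra! h
  unfold Stationary at h
  push Not at h
  choose η f hf using h
  obtain ⟨b, hb⟩ := exists_strict_bound (Set.countable_range η)
  have : ∀ a : W, ∃ c, ∀ i, f i a < c := fun a => by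
    obtain ⟨c, hc⟩ := exists_strict_bound (Set.countable_range fun i => f i a)
    exact ⟨c, fun i => hc _ ⟨i, rfl⟩⟩
  choose g hg using this
  obtain ⟨δ, hδ, hbδ, hgδ⟩ := hA b g
  obtain ⟨i, hi⟩ := Set.mem_iUnion.1 hδ
  obtain ⟨a, ha, h⟩ := hf i δ hi ((hb _ ⟨i, rfl⟩).trans hbδ)
  exact (((hg a i).trans (hgδ a ha)).trans_le h).false

theorem exists_capture {T : Type} {s : W → T} (hs : ∀ t, Stationary {δ | s δ = t})
    {r : W → ℕ → Bool} (hr : Function.Injective r) {A : Set W} (hA : ¬ A.Countable) (t : T)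
    (η₀ : W) : ∃ δ, η₀ < δ ∧ s δ = t ∧ ∃ α ∈ A, δ < α ∧ ∀ m, ∃ d, m ≤ d ∧ ∀ η, η < δ →
      ∃ β ∈ A, η < β ∧ β < δ ∧ (∀ i < d, r β i = r α i) ∧ r β d ≠ r α d := by
  let D : (Σ d : ℕ, Fin (d + 1) → Bool) → Set W := fun q =>
    {β ∈ A | (∀ i (h : i < q.1), r β i = q.2 ⟨i, by lia⟩) ∧ r β q.1 ≠ q.2 ⟨q.1, by lia⟩}
  have : ∀ η : W, ∃ b, ∀ q, ¬ (D q).Countable → ∃ β ∈ D q, η < β ∧ β < b := fun η => by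
    have : ∀ q : {q // ¬ (D q).Countable}, ∃ β ∈ D q.1, η < β := fun q =>
      exists_gt_of_not_countable q.2 η
    choose β hβ hη using this
    obtain ⟨b, hb⟩ := exists_strict_bound (Set.countable_range β)
    exact ⟨b, fun q hq => ⟨β ⟨q, hq⟩, hβ _, hη _, hb _ ⟨_, rfl⟩⟩⟩
  choose f hf using this
  obtain ⟨δ, hδ, hηδ, hfδ⟩ := hs t η₀ f
  obtain ⟨α, ⟨hαA, hα⟩, hδα⟩ := exists_gt_of_not_countable
    (fun h => hA (Set.Countable.mono (Set.subset_sdiff_union A _)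
      (h.union (countable_not_splitting r hr A)))) δ
  refine ⟨δ, hηδ, hδ, α, hαA, hδα, fun m => ?_⟩
  have : ∃ d, m ≤ d ∧ ¬ {β ∈ A | (∀ i < d, r β i = r α i) ∧ r β d ≠ r α d}.Countable := by
    by_contra! h
    exact hα ⟨hαA, m, h⟩
  obtain ⟨d, hmd, hd⟩ := this
  refine ⟨d, hmd, fun η hη => ?_⟩
  obtain ⟨β, hβ, h1, h2⟩ := hf η ⟨d, fun i => r α i⟩ hd
  exact ⟨β, hβ.1, h1, h2.trans (hfδ η hη), hβ.2.1, hβ.2.2⟩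

variable [WellFoundedLT W]

theorem stationary_univ : Stationary (Set.univ : Set W) := by
  intro η f
  have : ∀ a : W, ∃ b, a < b ∧ ∀ c, c ≤ a → f c < b := fun a => by
    obtain ⟨b, hb⟩ := exists_strict_bound (((countable_Iic_of_Iio a).image f).insert a)
    exact ⟨b, hb a (Set.mem_insert _ _), fun c hc => hb _ (Set.mem_insert_of_mem _ ⟨c, hc, rfl⟩)⟩
  choose g hg hgf using this
  have hne : {b | ∀ n : ℕ, g^[n] η < b}.Nonempty := by
    obtain ⟨b, hb⟩ := exists_strict_bound (Set.countable_range fun n : ℕ => g^[n] η)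
    exact ⟨b, fun n => hb _ ⟨n, rfl⟩⟩
  refine ⟨wellFounded_lt.min _ hne, trivial, wellFounded_lt.min_mem _ hne 0, fun a ha => ?_⟩
  obtain ⟨n, hn⟩ : ∃ n : ℕ, a ≤ g^[n] η := by
    by_contra! h
    exact wellFounded_lt.not_lt_min {b | ∀ n : ℕ, g^[n] η < b} h ha
  refine (hgf _ a hn).trans ?_
  rw [← Function.iterate_succ_apply' g n η]
  exact wellFounded_lt.min_mem _ hne (n + 1)

/-- Ulam's theorem, as a colouring all of whose colour classes are stationary. -/
theorem exists_stationary_coloring {T : Type} [Nonempty T] (hT : #T ≤ aleph 1) :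
    ∃ s : W → T, ∀ t, Stationary {δ | s δ = t} := by
  classical
  have : ∀ δ : W, ∃ e : W → ℕ, Set.InjOn e (Set.Iio δ) := fun δ =>
    Set.countable_iff_exists_injOn.1 (Set.to_countable _)
  choose e he using this
  have : ∀ ξ : W, ∃ i, Stationary {δ | ξ < δ ∧ e δ ξ = i} := fun ξ => by
    refine stationary_of_iUnion fun η f => ?_
    obtain ⟨δ, -, h, hf⟩ := stationary_univ (max η ξ) f
    exact ⟨δ, Set.mem_iUnion.2 ⟨_, (le_max_right _ _).trans_lt h, rfl⟩,
      (le_max_left _ _).trans_lt h, hf⟩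
  choose i hi using this
  obtain ⟨i₀, hi₀⟩ := exists_fiber_not_countable (Set.not_countable_univ (α := W))
    (fun ξ n => i ξ = n) fun ξ _ => ⟨_, rfl⟩
  set E := {ξ ∈ (Set.univ : Set W) | i ξ = i₀} with hE
  have hcard : #T ≤ #E := by
    refine hT.trans ?_
    rw [← succ_aleph0, Order.succ_le_iff, ← not_le]
    exact fun h => hi₀ (mk_le_aleph0_iff.1 h)
  obtain ⟨φ⟩ := hcard
  let g : W → T := fun ξ => if h : ξ ∈ E then Function.invFun φ ⟨ξ, h⟩ else Classical.arbitrary T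
  have hg : ∀ t, ∃ ξ ∈ E, g ξ = t := fun t => ⟨(φ t).1, (φ t).2, by
    simp only [g, dif_pos (φ t).2]
    exact Function.leftInverse_invFun φ.injective t⟩
  let s : W → T := fun δ =>
    if h : ∃ ξ, ξ ∈ E ∧ ξ < δ ∧ e δ ξ = i₀ then g h.choose else Classical.arbitrary T
  refine ⟨s, fun t η f => ?_⟩
  obtain ⟨ξ, hξ, hgξ⟩ := hg t
  obtain ⟨δ, ⟨hξδ, hδ⟩, hηδ, hf⟩ := hi ξ η f
  rw [hξ.2] at hδ
  have h : ∃ ξ, ξ ∈ E ∧ ξ < δ ∧ e δ ξ = i₀ := ⟨ξ, hξ, hξδ, hδ⟩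
  refine ⟨δ, ?_, hηδ, hf⟩
  change dite _ _ _ = t
  rw [dif_pos h, ← hgξ]
  exact congrArg g (he δ h.choose_spec.2.1 hξδ (h.choose_spec.2.2.trans hδ.symm))

end Club

section Final

open Cardinal

variable {G : Type} [Group G] {N : ℕ}

/-- Every element is a product of boundedly many elements from any given uncountable set. -/
def UncountablyBounded (N : ℕ) (G : Type) [Group G] : Prop :=
  ∀ Y : Set G, ¬ Y.Countable → ∀ g : G, ∃ x ∈ Y, ∃ y ∈ Y, ∃ h : Fin N → G, (∀ j, h j ∈ Y) ∧
    (List.ofFn fun j => x * h j * y).prod = g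

theorem UncountablyBounded.eq_top (hG : UncountablyBounded N G) {K : Subgroup G}
    (hK : ¬ (K : Set G).Countable) : K = ⊤ := by
  rw [Subgroup.eq_top_iff']
  intro g
  obtain ⟨x, hx, y, hy, h, hh, rfl⟩ := hG K hK g
  refine K.list_prod_mem fun z hz => ?_
  obtain ⟨j, rfl⟩ := List.mem_ofFn.1 hz
  exact K.mul_mem (K.mul_mem hx (hh j)) hy

theorem UncountablyBounded.jonsson (hG : UncountablyBounded N G) (hcard : #G = aleph 1) :
    Jonsson G := by
  intro K hK
  rw [hcard, ← succ_aleph0, Order.lt_succ_iff]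
  by_contra h
  exact hK (hG.eq_top fun hc => h (mk_le_aleph0_iff.2 hc))

theorem dist_list_prod_smul_le {X : Type*} [MetricSpace X] [MulAction G X]
    (hiso : ∀ g : G, Isometry fun x : X => g • x) (x : X) {c : ℝ} (l : List G)
    (hl : ∀ g ∈ l, dist x (g • x) ≤ c) : dist x (l.prod • x) ≤ l.length * c := by
  induction l with
  | nil => simp
  | cons g l ih =>
    have h1 := ih fun a ha => hl a (List.mem_cons_of_mem _ ha)
    have h2 := hl g List.mem_cons_self
    have h3 : dist (g • x) (g • l.prod • x) = dist x (l.prod • x) := (hiso g).dist_eq _ _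
    rw [List.prod_cons, mul_smul, List.length_cons]
    push_cast
    linarith [dist_triangle x (g • x) (g • l.prod • x)]

theorem UncountablyBounded.stronglyBounded (hG : UncountablyBounded N G) [Uncountable G] :
    StronglyBounded G := by
  intro X _ _ hiso x
  obtain ⟨n, hn⟩ := exists_fiber_not_countable (Set.not_countable_univ (α := G))
    (fun g (n : ℕ) => dist x (g • x) ≤ n) fun g _ => exists_nat_ge _
  refine Metric.isBounded_iff_subset_closedBall x |>.2 ⟨N * (3 * n), ?_⟩
  rintro _ ⟨g, rfl⟩
  obtain ⟨a, ha, b, hb, h, hh, rfl⟩ := hG _ hn g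
  rw [Metric.mem_closedBall']
  refine (dist_list_prod_smul_le hiso x (c := 3 * n) _ fun z hz => ?_).trans (by simp)
  obtain ⟨j, rfl⟩ := List.mem_ofFn.1 hz
  have := dist_list_prod_smul_le hiso x (c := n) [a, h j, b] (by
    simpa using ⟨ha.2, (hh j).2, hb.2⟩)
  simpa [mul_assoc] using this

theorem UncountablyBounded.isSimpleGroup (hG : UncountablyBounded N G) [Uncountable G]
    (hcen : Subgroup.center G = ⊥) : IsSimpleGroup G where
  eq_bot_or_eq_top_of_normal K hK := by
    refine or_iff_not_imp_right.2 fun hne => ?_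
    have hc : (K : Set G).Countable := by
      by_contra h
      exact hne (hG.eq_top h)
    have := hc.to_subtype
    rw [Subgroup.eq_bot_iff_forall]
    intro x hx
    obtain ⟨⟨y, hy⟩, h⟩ := exists_fiber_not_countable (Set.not_countable_univ (α := G))
      (fun g (y : (K : Set G)) => g * x * g⁻¹ = y.1) fun g _ => ⟨⟨_, hK.conj_mem x hx g⟩, rfl⟩
    obtain ⟨g₀, hg₀⟩ : {g ∈ (Set.univ : Set G) | g * x * g⁻¹ = y}.Nonempty :=
      Set.nonempty_iff_ne_empty.2 fun h' => h (h' ▸ Set.countable_empty)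
    have htop : Subgroup.centralizer {x} = ⊤ := by
      refine hG.eq_top fun hc => h ((hc.image fun z => g₀ * z).mono fun g hg => ?_)
      refine ⟨g₀⁻¹ * g, ?_, mul_inv_cancel_left _ _⟩
      rw [SetLike.mem_coe, Subgroup.mem_centralizer_singleton_iff]
      have := hg.2.trans hg₀.2.symm
      calc g₀⁻¹ * g * x = g₀⁻¹ * (g * x * g⁻¹) * g := by group
        _ = x * (g₀⁻¹ * g) := by rw [this]; group
    have : x ∈ Subgroup.center G := Subgroup.mem_center_iff.2 fun g =>
      Subgroup.mem_centralizer_singleton_iff.1 (htop ▸ Subgroup.mem_top g)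
    rwa [hcen, Subgroup.mem_bot] at this

variable {W : Type} [LinearOrder W] {nm : G → Name W}

theorem Named.countable_level_le [∀ α : W, Countable (Set.Iio α)] (hnm : Named nm) (η : W) :
    {a | level (nm a) ≤ η}.Countable := by
  have hc : (insert none (some '' (Set.Iic η ×ˢ Set.univ)) : Set (Name W)).Countable :=
    ((((countable_Iic_of_Iio η).prod (Set.to_countable _)).image _).insert _)
  refine Set.MapsTo.countable_of_injOn (f := nm) (fun a ha => ?_) hnm.inj.injOn hc
  rcases h : nm a with _ | p
  · exact Or.inl rfl
  · refine Or.inr ⟨p, ⟨WithBot.coe_le_coe.1 ?_, trivial⟩, rfl⟩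
    have : level (nm a) ≤ η := ha
    rwa [h] at this

theorem Named.level_mul_inv (hnm : Named nm) {a b : G} (h : level (nm a) < level (nm b)) :
    level (nm (b * a⁻¹)) = level (nm b) := by
  refine le_antisymm ((hnm.mul _ _).trans ?_) ?_
  · rw [hnm.level_inv, max_eq_left h.le]
  · have := hnm.mul (b * a⁻¹) a
    rw [inv_mul_cancel_right] at this
    rcases le_max_iff.1 this with h' | h'
    · exact h'
    · exact absurd h h'.not_gt

theorem Named.exists_sidonSeq [∀ α : W, Countable (Set.Iio α)] [Nonempty W] (hnm : Named nm)
    {Y : Set G} (hY : ¬ Y.Countable) (N : ℕ) : ∃ h : Fin N → G, (∀ j, h j ∈ Y) ∧ SidonSeq h := by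
  obtain ⟨f, hf, hlt⟩ := exists_seq_of_forall_finset_exists (· ∈ Y)
    (fun a b => level (nm a) < level (nm b)) fun s _ => by
      have : (⋃ a ∈ s, {b | level (nm b) ≤ level (nm a)}).Countable := by
        refine s.countable_toSet.biUnion fun a _ => ?_
        rcases h : level (nm a) with _ | η
        · obtain ⟨η⟩ := ‹Nonempty W›
          exact (hnm.countable_level_le η).mono fun b hb =>
            le_trans (α := WithBot W) hb bot_le
        · exact hnm.countable_level_le η
      obtain ⟨y, hy, hy'⟩ := Set.not_subset.1 fun h => hY (this.mono h)
      refine ⟨y, hy, fun a ha => ?_⟩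
      by_contra! h
      exact hy' (Set.mem_biUnion ha h)
  have hmono : StrictMono fun n => level (nm (f n)) := fun m n h => hlt m n h
  refine ⟨fun j => f j, fun j => hf j, fun a b h => Fin.ext (hmono.injective 
    (congrArg (fun z => level (nm z)) h)),
    fun a b _ _ h => ?_⟩
  have := congrArg (fun z => level (nm z)) h
  simp only [hnm.level_mul_inv (hlt _ _ (Nat.lt_succ_self _))] at this
  exact Nat.succ_injective (hmono.injective this)

/-- The relations to be imposed, read off from a colouring `s` of the levels and a family `r` of
reals: the level that `γ` aims at is the first one above `γ` among those present at the stage where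
the reals of `γ` and `β` split. -/
noncomputable def target [WellFoundedLT W] {T : Type} (s : W → T) (r : W → ℕ → Bool) (β γ : W)
    (F : ℕ → Set W) : T :=
  open Classical in
  if h : {δ ∈ F (PiNat.firstDiff (r γ) (r β)) | γ ≤ δ}.Nonempty then s (wellFounded_lt.min _ h)
  else s γ

theorem target_eq [WellFoundedLT W] {T : Type} {s : W → T} {r : W → ℕ → Bool} {β γ δ : W} {d : ℕ}
    {F : ℕ → Set W} (hd : ∀ i < d, r γ i = r β i) (hd' : r γ d ≠ r β d) (hδ : δ ∈ F d)
    (hγδ : γ ≤ δ) (hlt : ∀ η ∈ F d, η < δ → η < γ) : target s r β γ F = s δ := by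
  have hne : r γ ≠ r β := fun h => hd' (congrFun h d)
  have hfd : PiNat.firstDiff (r γ) (r β) = d := by
    refine le_antisymm ?_ ?_
    · by_contra! h
      exact hd' (PiNat.apply_eq_of_lt_firstDiff h)
    · by_contra! h
      exact PiNat.apply_firstDiff_ne hne (hd _ h)
  subst hfd
  have h : {δ ∈ F (PiNat.firstDiff (r γ) (r β)) | γ ≤ δ}.Nonempty := ⟨δ, hδ, hγδ⟩
  rw [target, dif_pos h]
  congr 1
  have hmem := wellFounded_lt.min_mem _ h
  have hle := wellFounded_lt.not_lt_min {δ ∈ F (PiNat.firstDiff (r γ) (r β)) | γ ≤ δ} ⟨hδ, hγδ⟩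
  exact le_antisymm (not_lt.1 hle) (not_lt.1 fun h' => ((hlt _ hmem.1 h').trans_le hmem.2).false)

theorem uncountablyBounded_of_tower [WellFoundedLT W] [∀ α : W, Countable (Set.Iio α)]
    [Uncountable W] {s : W → ℕ × (Fin N → Name W) × Name W}
    (hs : ∀ t, Stationary {δ | s δ = t}) {r : W → ℕ → Bool} (hr : Function.Injective r)
    (hnm : Named nm) (hsurj : Function.Surjective nm) {L : W → ℕ → Subgroup G}
    (T : ∀ γ, TowerAt (target s r) nm L γ) : UncountablyBounded N G := by
  intro Y hY g
  have hW : Nonempty W := inferInstance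
  obtain ⟨h, hhY, hsid⟩ := hnm.exists_sidonSeq hY N
  have hY' : ¬ (Y \ {1}).Countable := fun hc =>
    hY ((hc.union (Set.countable_singleton (1 : G))).mono (Set.subset_sdiff_union Y {1}))
  obtain ⟨⟨i, k₀⟩, hik⟩ := exists_fiber_not_countable hY'
    (fun y (q : ℕ × ℕ) => ∃ α, nm y = some (α, q.1) ∧ y ∈ L α q.2) fun y hy => by
      rcases hn : nm y with _ | ⟨α, i⟩
      · exact (hy.2 (hnm.inj (hn.trans hnm.one.symm))).elim
      · obtain ⟨k, hk⟩ := (T α).union y (by rw [hn]; exact le_rfl)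
        exact ⟨(i, k), α, rfl, hk⟩
  let A : Set W := {α | ∃ y ∈ Y, nm y = some (α, i) ∧ y ∈ L α k₀}
  have hA : ¬ A.Countable := fun hc => by
    refine hik (((hc.image fun α => (some (α, i) : Name W)).preimage_of_injOn hnm.inj.injOn).mono
        ?_)
    rintro y ⟨hy, α, hα, hk⟩
    exact ⟨α, ⟨y, hy.1, hα, hk⟩, hα.symm⟩
  obtain ⟨η₀, hη₀⟩ : ∃ η₀ : W, ∀ a ∈ insert g (Set.range h), level (nm a) ≤ η₀ := by
    obtain ⟨w⟩ := hW
    obtain ⟨b, hb⟩ := exists_strict_bound (((Set.countable_range h).insert g).image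
      fun a => (level (nm a)).unbotD w)
    exact ⟨b, fun a ha => (WithBot.le_coe_unbotD _ w).trans
      (WithBot.coe_le_coe.2 (hb _ ⟨a, ha, rfl⟩).le)⟩
  obtain ⟨δ, hηδ, hsδ, α, ⟨y, hyY, hyn, hyL⟩, hδα, hcap⟩ :=
    exists_capture hs hr hA (i, fun j => nm (h j), nm g) η₀
  have hlt : ∀ a ∈ insert g (Set.range h), level (nm a) < α := fun a ha =>
    (hη₀ a ha).trans_lt (WithBot.coe_lt_coe.2 (hηδ.trans hδα))
  obtain ⟨z, hz⟩ := hsurj (some (δ, 0))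
  obtain ⟨m, hm⟩ : ∃ m, ∀ a ∈ insert z (insert g (Set.range h)), a ∈ L α m := by
    have hu : ∀ a ∈ insert z (insert g (Set.range h)), ∃ k, a ∈ L α k := by
      rintro a (rfl | ha)
      · exact (T α).union a (by rw [hz]; exact WithBot.coe_le_coe.2 hδα.le)
      · exact (T α).union a (hlt a ha).le
    choose! k hk using hu
    obtain ⟨m, hm⟩ := ((((Set.finite_range h).insert g).insert z).image k).bddAbove
    exact ⟨m, fun a ha => (T α).mono (hm ⟨a, ha, rfl⟩) (hk a ha)⟩
  obtain ⟨d, hmd, hd⟩ := hcap (max m k₀)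
  set F := levels nm α (L α) with hF
  have hFmono : Monotone F := fun k l hkl γ hγ => ⟨hγ.1, hγ.2.imp fun a ha =>
    ⟨(T α).mono hkl ha.1, ha.2⟩⟩
  have hδF : δ ∈ F d := hFmono ((le_max_left _ _).trans hmd)
    ⟨hδα, z, hm z (Set.mem_insert _ _), by rw [hz]; rfl⟩
  obtain ⟨η, hη, hmax⟩ := Set.exists_max_image (insert η₀ (F d ∩ Set.Iio δ)) id
    (((T α).fin d).inter_of_left _ |>.insert η₀) ⟨η₀, Set.mem_insert _ _⟩
  have hηlt : η < δ := by
    rcases hη with rfl | hη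
    · exact hηδ
    · exact hη.2
  obtain ⟨β, ⟨x, hxY, hxn, hxL⟩, hηβ, hβδ, hβα, hβα'⟩ := hd η hηlt
  have htar : target s r α β F = s δ := target_eq hβα hβα' hδF hβδ.le fun ζ hζ hζδ =>
    (hmax ζ (Set.mem_insert_of_mem _ ⟨hζ, hζδ⟩)).trans_lt hηβ
  have hβd : β ∉ F d := fun hβ =>
    ((hmax β (Set.mem_insert_of_mem _ ⟨hβ, hβδ⟩)).trans_lt hηβ).false
  have hex : ∃ k, β ∈ F k := by
    obtain ⟨k, hk⟩ := (T α).union x (by rw [hxn]; exact WithBot.coe_le_coe.2 (hβδ.trans hδα).le)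
    exact ⟨k, hβδ.trans hδα, x, hk, by rw [hxn]; rfl⟩
  obtain ⟨k, hk, hk'⟩ : ∃ k, β ∉ F k ∧ β ∈ F (k + 1) := by
    by_contra! h
    obtain ⟨k, hk⟩ := hex
    induction k with
    | zero => exact hβd (hFmono (Nat.zero_le d) hk)
    | succ k ih => exact ih (not_not.1 fun h' => h k h' hk)
  have hdk : d ≤ k := by
    by_contra! h
    exact hβd (hFmono h hk')
  have hmk : ∀ a ∈ insert g (Set.range h), a ∈ L α k := fun a ha =>
    (T α).mono (((le_max_left _ _).trans hmd).trans hdk) (hm a (Set.mem_insert_of_mem _ ha))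
  have hk₀k : k₀ ≤ k := ((le_max_right _ _).trans hmd).trans hdk
  have hxL' : x ∈ L α (k + 1) := ((T α).sync (k + 1) β hk' x (by rw [hxn]; exact le_rfl)).2
    ((T β).mono (hk₀k.trans k.le_succ) hxL)
  refine ⟨x, hxY, y, hyY, h, hhY, ?_⟩
  have hhmem : ∀ j, h j ∈ insert g (Set.range h) := fun j => Set.mem_insert_of_mem _ ⟨j, rfl⟩
  have hgmem : g ∈ insert g (Set.range h) := Set.mem_insert _ _
  refine (T α).rel k β hk' hk x h g hxL' (fun j => hmk _ (hhmem j)) (hmk g hgmem)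
    (fun j => hlt _ (hhmem j)) (hlt g hgmem) hsid ?_ (fun j => ?_) ?_ y ((T α).mono hk₀k hyL)
    (by rw [hyn]; rfl)
  · rw [← hF, htar, hsδ, hxn]
  · rw [← hF, htar, hsδ]
  · rw [← hF, htar, hsδ]

end Final

end TreeSide

open Cardinal TreeSide

theorem exists_simple_jonsson_stronglyBounded :
    ∃ (G : Type) (_ : Group G),
      IsSimpleGroup G ∧
      Cardinal.mk G = Cardinal.aleph 1 ∧
      Jonsson G ∧
      StronglyBounded G := by
  let W : Type := (aleph 1).ord.ToType
  have hW : #W = aleph 1 := mk_ord_toType _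
  have : ∀ α : W, Countable (Set.Iio α) := fun α => by
    rw [← mk_le_aleph0_iff, ← Order.lt_succ_iff, succ_aleph0]
    exact (mk_Iio_lt α (by rw [hW]; exact (Ordinal.type_toType _).symm)).trans_eq hW
  have hunc : ∀ {X : Type}, #X = aleph 1 → Uncountable X := fun h => by
    rw [← aleph0_lt_mk_iff, h, ← succ_aleph0]
    exact Order.lt_succ _
  have : Uncountable W := hunc hW
  have hal : ℵ₀ ≤ aleph 1 := aleph0_le_aleph 1
  have hName : #(Name W) = aleph 1 := by
    rw [mk_option, mk_prod, lift_id, lift_id, hW, mk_nat, mul_aleph0_eq hal,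
      add_one_eq hal]
  obtain ⟨s, hs⟩ := exists_stationary_coloring (W := W)
    (T := ℕ × (Fin 1000 → Name W) × Name W) (by
      simp only [mk_prod, lift_id, mk_nat, mk_pi, prod_const, mk_fin, hName]
      refine mul_le_of_le hal hal (mul_le_of_le hal ?_ le_rfl)
      rw [power_natCast]
      exact power_nat_le hal)
  obtain ⟨r⟩ : #W ≤ #(ℕ → Bool) := by
    rw [hW]
    simpa using aleph_one_le_continuum
  obtain ⟨G, _, nm, L, hnm, hsurj, T⟩ := exists_tower le_rfl (target s r)
  have hG : #G = aleph 1 := by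
    rw [← hName]
    exact mk_congr (Equiv.ofBijective nm ⟨hnm.inj, hsurj⟩)
  have : Uncountable G := hunc hG
  have hb := uncountablyBounded_of_tower hs r.injective hnm hsurj T
  refine ⟨G, inferInstance, hb.isSimpleGroup ?_, hG, hb.jonsson hG, hb.stronglyBounded⟩
  rw [Subgroup.eq_bot_iff_forall]
  intro x hx
  have hW : Nonempty W := inferInstance
  obtain ⟨w⟩ := hW
  obtain ⟨β, hβ⟩ := exists_strict_bound (Set.countable_singleton ((level (nm x)).unbotD w))
  have hxβ : level (nm x) < β := (WithBot.le_coe_unbotD _ w).trans_lt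
    (WithBot.coe_lt_coe.2 (hβ _ rfl))
  obtain ⟨g, hg⟩ := hsurj (some (β, 0))
  exact (T β).malLt g x x (by rw [hg]; rfl) hxβ hxβ (Subgroup.mem_center_iff.1 hx g).symm
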